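/- Let q be a divisor of e with e/q and e/p coprime, α ∈ 𝒫_{n,e}, and suppose χ^{α,φ} is σ^q-stable. Then for w ∈ σ^q W and 0 ≤ j < p: Tr(Dτ^j w, V_{α,φ}⊗Z̃_{α,φ}) = φ(τ^j)·(Σ_{0≤i<c} ζ^{qid} s_{θ^i(α){j}}(𝒳_j))·χ̃^{α,φ}(w) if c = c_{α,p} divides j, and 0 otherwise. -/

import Mathlib

/-!
Common framework for formalizing T. Shoji, "Green functions associated to
complex reflection groups, II" (arXiv:math/0105053).

We model:
* `e`-partitions of `n` as functions `ZMod e → Multiset ℕ`;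
* the complex reflection group `W̃ = G(e,1,n)` as the semidirect product
  `(Fin n → Multiplicative (ZMod e)) ⋊ Equiv.Perm (Fin n)`, and
  `W = G(e,p,n)` as the kernel of the mod-`p` sum character;
* the tensor space `V^{⊗n}` concretely via matrices indexed by
  `Fin n → (Σ k : ZMod e, Fin (m k))`;
* symmetric functions in the (finitely many, `m k ≥ n`) variables
  `x_i^{(k)}` in evaluated form, i.e. as functions of an assignment
  `xv : (Σ k : ZMod e, Fin (m k)) → ℂ`.
-/

open scoped BigOperators

attribute [local instance] Classical.propDecidable

namespace GreenII

/-! ## Combinatorics of e-partitions -/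

/-- An `e`-partition of `n`: a tuple of partitions (multisets of positive
integers) indexed by `ZMod e`, with total size `n`. -/
def IsEPartition (e : ℕ) [NeZero e] (n : ℕ) (α : ZMod e → Multiset ℕ) : Prop :=
  (∀ k, ∀ x ∈ α k, 0 < x) ∧ (∑ k : ZMod e, (α k).sum) = n

/-- The shift operator `θ = θ_p`, `θ(α)^{(k)} = α^{(k-d)}`. -/
def theta (e : ℕ) [NeZero e] (d : ℕ) (α : ZMod e → Multiset ℕ) : ZMod e → Multiset ℕ :=
  fun k => α (k - (d : ZMod e))

/-- `c_{α,p}`: the size of the `θ`-orbit of `α`. -/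
noncomputable def csize (e : ℕ) [NeZero e] (d : ℕ) (α : ZMod e → Multiset ℕ) : ℕ :=
  Function.minimalPeriod (theta e d) α

/-- `Δ(α) = ∑_k k · l(α^{(k)})`. -/
def Delta (e : ℕ) [NeZero e] (α : ZMod e → Multiset ℕ) : ℕ :=
  ∑ k : ZMod e, k.val * (α k).card

/-- `l(α) = ∑_k l(α^{(k)})`, the total number of parts. -/
def lenE (e : ℕ) [NeZero e] (α : ZMod e → Multiset ℕ) : ℕ :=
  ∑ k : ZMod e, (α k).card

/-- `α` and `β` lie in the same `θ`-orbit. -/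
def SameOrbit (e : ℕ) [NeZero e] (d : ℕ) (α β : ZMod e → Multiset ℕ) : Prop :=
  ∃ i, (theta e d)^[i] α = β

/-! ## The groups `W̃ = G(e,1,n)` and `W = G(e,p,n)` -/

/-- The "diagonal" part of `G(e,1,n)`. -/
abbrev NC (e n : ℕ) := Fin n → Multiplicative (ZMod e)

/-- The permutation action of `𝔖_n` on the diagonal part. -/
def permAut (e n : ℕ) (x : Equiv.Perm (Fin n)) : NC e n ≃* NC e n where
  toFun f := f ∘ ⇑x.symm
  invFun f := f ∘ ⇑x
  left_inv f := by funext i; simp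
  right_inv f := by funext i; simp
  map_mul' f g := rfl

def permHom (e n : ℕ) : Equiv.Perm (Fin n) →* MulAut (NC e n) where
  toFun x := permAut e n x
  map_one' := rfl
  map_mul' x y := rfl

/-- `W̃ = G(e,1,n) ≅ (ℤ/eℤ)^n ⋊ 𝔖_n`, with `w = x(a_1,…,a_n)` recorded as
`⟨(a_i), x⟩`. -/
abbrev Wt (e n : ℕ) := NC e n ⋊[permHom e n] Equiv.Perm (Fin n)

noncomputable instance WtFintype (e n : ℕ) [NeZero e] : Fintype (Wt e n) :=
  Fintype.ofEquiv (NC e n × Equiv.Perm (Fin n))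
    { toFun := fun x => ⟨x.1, x.2⟩
      invFun := fun x => (x.left, x.right)
      left_inv := fun _ => rfl
      right_inv := fun _ => rfl }

/-- The character `w ↦ ∑ a_i mod p` of `W̃`. -/
noncomputable def wsumHom (e p n : ℕ) (hp : p ∣ e) : Wt e n →* Multiplicative (ZMod p) where
  toFun w := Multiplicative.ofAdd (∑ i, ZMod.castHom hp (ZMod p) (w.left i).toAdd)
  map_one' := by simp
  map_mul' w w' := by
    have h : ∀ i, ((w * w').left i).toAdd
        = (w.left i).toAdd + (w'.left (w.right.symm i)).toAdd := fun _ => rfl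
    simp only [h, map_add, Finset.sum_add_distrib, ofAdd_add]
    congr 2
    exact Equiv.sum_comp w.right.symm
      (fun i => ZMod.castHom hp (ZMod p) ((w'.left i).toAdd))

/-- `W = G(e,p,n)`: the subgroup of `W̃` on which `∑ a_i ≡ 0 (mod p)`. -/
noncomputable def Wgrp (e p n : ℕ) (hp : p ∣ e) : Subgroup (Wt e n) :=
  (wsumHom e p n hp).ker

/-- `σ = t_1 ∈ W̃`. -/
def sigmaElt (e n : ℕ) [NeZero n] : Wt e n :=
  SemidirectProduct.inl (fun i => Multiplicative.ofAdd (if i = (0 : Fin n) then (1 : ZMod e) else 0))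

/-- membership in the coset `σ^q W`. -/
def inCoset (e p n : ℕ) [NeZero n] (hp : p ∣ e) (q : ℕ) (w : Wt e n) : Prop :=
  ∃ u ∈ Wgrp e p n hp, w = (sigmaElt e n) ^ q * u

/-- conjugacy under `W`. -/
def IsConjW (e p n : ℕ) (hp : p ∣ e) (w w' : Wt e n) : Prop :=
  ∃ u ∈ Wgrp e p n hp, u * w * u⁻¹ = w'

/-- The `e`-partition recording the conjugacy class of `w ∈ W̃`:
a `k`-cycle of length `l` (a cycle of the underlying permutation whose
accumulated `ZMod e`-color is `k`, fixed points counting as `1`-cycles)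
contributes a part `l` to the `k`-th component. -/
noncomputable def classOf (e n : ℕ) [NeZero e] (w : Wt e n) : ZMod e → Multiset ℕ := fun k =>
  ((w.right.cycleFactorsFinset.val.filter
      (fun c => (∑ i ∈ c.support, (w.left i).toAdd) = k)).map fun c => c.support.card)
    + Multiset.replicate
        ((Finset.univ.filter fun i : Fin n => w.right i = i ∧ (w.left i).toAdd = k).card) 1

/-! ### The standard class representative `w_α(b)` -/

/-- The list of (part, color) pairs of an `e`-partition. -/
noncomputable def partsList (e : ℕ) [NeZero e] (α : ZMod e → Multiset ℕ) : List (ℕ × ZMod e) :=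
  (Finset.univ : Finset (ZMod e)).toList.flatMap fun k => (α k).toList.map fun r => (r, k)

/-- the color datum of `w_α(b)`: each cycle carries its color at its first
point, except the first (exceptional) cycle, which carries `k - b` at its
first point and `b` at its last point. -/
noncomputable def aexc (e : ℕ) [NeZero e] (L : List (ℕ × ZMod e)) (b : ZMod e) :
    (Σ i : Fin L.length, Fin (L.get i).1) → ZMod e := fun x =>
  if (x.1 : ℕ) = 0 then
    (if (x.2 : ℕ) = 0 then (L.get x.1).2 - b else 0)
      + (if (x.2 : ℕ) = (L.get x.1).1 - 1 then b else 0)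
  else if (x.2 : ℕ) = 0 then (L.get x.1).2 else 0

/-- The standard representative `w_α(b) ∈ W̃` of the paper, 2.6: a product of
disjoint cycles matching `α`, of the form `t_{i_1}^k z` except for one
exceptional cycle `t_{i_1}^{k-b} t_{i_m}^{b} z`. -/
noncomputable def wrep (e n : ℕ) [NeZero e] (α : ZMod e → Multiset ℕ) (b : ZMod e) : Wt e n :=
  if hcard : Fintype.card (Σ i : Fin (partsList e α).length, Fin ((partsList e α).get i).1) = n then
    let φ := Fintype.equivFinOfCardEq hcard
    ⟨fun t => Multiplicative.ofAdd (aexc e (partsList e α) b (φ.symm t)),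
      φ.symm.trans ((Equiv.sigmaCongrRight fun _ => finRotate _).trans φ)⟩
  else 1

/-! ## The tensor space `V^{⊗n}` -/

/-- Basis index of `V = ⊕_k V_k`, `dim V_k = m k`. -/
abbrev BIdx (e : ℕ) [NeZero e] (m : ZMod e → ℕ) := Σ k : ZMod e, Fin (m k)

/-- Basis index of `V^{⊗n}`. -/
abbrev TIdx (e n : ℕ) [NeZero e] (m : ZMod e → ℕ) := Fin n → BIdx e m

/-- `ζ` raised to a `ZMod e` exponent. -/
noncomputable def zmpow (e : ℕ) [NeZero e] (ζ : ℂ) (c : ZMod e) : ℂ := ζ ^ c.val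

/-- the matrix of `w ∈ W̃` on `V^{⊗n}` (𝔖_n permutes the factors, and
`t_k` multiplies by `ζ^j` if the `k`-th factor lies in `V_j`). -/
noncomputable def rhoMat (e n : ℕ) [NeZero e] (ζ : ℂ) (m : ZMod e → ℕ) (w : Wt e n) :
    Matrix (TIdx e n m) (TIdx e n m) ℂ := fun b' b =>
  if b' = b ∘ ⇑w.right.symm then ∏ s, ζ ^ (((w.left s).toAdd.val) * (b' s).1.val) else 0

/-- The operator `D` (multiplication by `x_{i_1} ⋯ x_{i_n}`), with the
variables evaluated via `xv`. -/
noncomputable def Dmat (e n : ℕ) [NeZero e] (m : ZMod e → ℕ) (xv : BIdx e m → ℂ) :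
    Matrix (TIdx e n m) (TIdx e n m) ℂ :=
  Matrix.diagonal fun b => ∏ s, xv (b s)

/-- `τ` on the basis of `V`: `v_j^{(k)} ↦ v_j^{(k+d)}` (uses `m (k+d) = m k`). -/
def tauB (e : ℕ) [NeZero e] (d : ℕ) (m : ZMod e → ℕ) (hm : ∀ k, m (k + (d : ZMod e)) = m k) :
    BIdx e m → BIdx e m := fun b => ⟨b.1 + (d : ZMod e), Fin.cast (hm b.1).symm b.2⟩

/-- `g ↦ g^{⊗ n}`: the matrix of `g ∈ End V` acting diagonally on `V^{⊗n}`. -/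
noncomputable def tensorPow (e n : ℕ) [NeZero e] (m : ZMod e → ℕ)
    (g : Matrix (BIdx e m) (BIdx e m) ℂ) : Matrix (TIdx e n m) (TIdx e n m) ℂ :=
  Matrix.of fun b' b => ∏ s, g (b' s) (b s)

/-- the matrix of `τ` on `V`. -/
noncomputable def tauV (e : ℕ) [NeZero e] (d : ℕ) (m : ZMod e → ℕ)
    (hm : ∀ k, m (k + (d : ZMod e)) = m k) : Matrix (BIdx e m) (BIdx e m) ℂ :=
  fun b' b => if b' = tauB e d m hm b then 1 else 0

/-- the matrix of `τ` on `V^{⊗n}`. -/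
noncomputable def tauMat (e n : ℕ) [NeZero e] (d : ℕ) (m : ZMod e → ℕ)
    (hm : ∀ k, m (k + (d : ZMod e)) = m k) : Matrix (TIdx e n m) (TIdx e n m) ℂ :=
  tensorPow e n m (tauV e d m hm)

/-- a member of `G = GL_{m_0} × ⋯ × GL_{m_{e-1}}` (as an endomorphism of V,
invertibility stated separately). -/
def IsBlockDiag (e : ℕ) [NeZero e] (m : ZMod e → ℕ) (g : Matrix (BIdx e m) (BIdx e m) ℂ) : Prop :=
  ∀ b b' : BIdx e m, b.1 ≠ b'.1 → g b b' = 0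

/-- a block upper unitriangular matrix (product of root subgroups for the
positive roots of `G`). -/
def IsUpperUni (e : ℕ) [NeZero e] (m : ZMod e → ℕ) (g : Matrix (BIdx e m) (BIdx e m) ℂ) : Prop :=
  (∀ b, g b b = 1) ∧
    ∀ b b' : BIdx e m, b ≠ b' → ¬(b.1 = b'.1 ∧ b.2.val < b'.2.val) → g b b' = 0

/-! ## Symmetric functions (evaluated form) -/

/-- value of the variable `x_i^{(k)}` under the assignment `xv` (junk `0` out
of range). -/
noncomputable def xval (e : ℕ) [NeZero e] (m : ZMod e → ℕ) (xv : BIdx e m → ℂ)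
    (k : ZMod e) (i : ℕ) : ℂ :=
  if h : i < m k then xv ⟨k, ⟨i, h⟩⟩ else 0

/-- `h_j`: the order of the image of `j` in `ℤ/pℤ`. -/
noncomputable def hOrd (p j : ℕ) : ℕ := addOrderOf ((j : ZMod p))

/-- `j₁ d` where `j₁ = p / h_j`: the number of components of the variable
system `𝒳_j`. -/
noncomputable def Esys (p d j : ℕ) : ℕ := (p / hOrd p j) * d

/-- the variable `X_i^{(k)} = x_i^{(k)} x_i^{(k+jd)} ⋯ x_i^{(k+(h_j-1)jd)}`
of the system `𝒳_j`. -/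
noncomputable def Xvar (e : ℕ) [NeZero e] (p d : ℕ) (m : ZMod e → ℕ) (xv : BIdx e m → ℂ)
    (j k i : ℕ) : ℂ :=
  ∏ s ∈ Finset.range (hOrd p j), xval e m xv (((k + s * j * d : ℕ) : ZMod e)) i

/-- number of variables in the `k`-th component of any of the systems `𝒳_j`. -/
noncomputable def mmX (e : ℕ) [NeZero e] (m : ZMod e → ℕ) : ℕ → ℕ := fun k => m ((k : ℕ) : ZMod e)

/-- The variables of the system `𝒳_j`, as a doubly indexed family. -/
noncomputable def vvX (e : ℕ) [NeZero e] (p d : ℕ) (m : ZMod e → ℕ) (xv : BIdx e m → ℂ)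
    (j : ℕ) : ℕ → ℕ → ℂ := fun k i => Xvar e p d m xv j k i

/-- complete homogeneous symmetric polynomial `h_r` in `N` variables. -/
noncomputable def hcomp (N r : ℕ) (v : ℕ → ℂ) : ℂ :=
  ∑ c ∈ Finset.Nat.antidiagonalTuple N r, ∏ i : Fin N, v i ^ c i

/-- the parts of a partition in decreasing order (`0` beyond the length). -/
noncomputable def lamOf (μ : Multiset ℕ) (i : ℕ) : ℕ := ((μ.sort (· ≤ ·)).reverse).getD i 0

/-- Schur polynomial in `N` variables (Jacobi–Trudi). -/
noncomputable def schurFin (N : ℕ) (μ : Multiset ℕ) (v : ℕ → ℂ) : ℂ :=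
  Matrix.det (Matrix.of fun i j : Fin N =>
    if h : (0 : ℤ) ≤ (lamOf μ i + j : ℤ) - i then hcomp N ((lamOf μ i + j : ℤ) - i).toNat v
    else 0)

/-- monomial symmetric polynomial in `N` variables. -/
noncomputable def monoFin (N : ℕ) (μ : Multiset ℕ) (v : ℕ → ℂ) : ℂ :=
  ∑ c ∈ (Finset.Nat.antidiagonalTuple N μ.sum).filter
      (fun c => ((List.ofFn c : List ℕ) : Multiset ℕ).filter (fun x => 0 < x) = μ),
    ∏ i : Fin N, v i ^ c i

/-! ### generic families for a variable system with `E` components -/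

/-- `p_r^{(i)} = ∑_{k<E} u^{ik} p_r(x^{(k)})` (formula (2.2.2)/(2.4.2), with
`u` a primitive `E`-th root of unity), for the system of variables
`vv k i` (`k < E`, `i < mm k`); `p_0^{(i)} = 1`. -/
noncomputable def pGenSys (u : ℂ) (E : ℕ) (mm : ℕ → ℕ) (vv : ℕ → ℕ → ℂ) (i r : ℕ) : ℂ :=
  if r = 0 then 1 else ∑ k ∈ Finset.range E, u ^ (i * k) * ∑ s ∈ Finset.range (mm k), vv k s ^ r

/-- the power sum `p_γ` of an `E`-tuple of partitions (2.2.1). -/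
noncomputable def pAlphaSys (u : ℂ) (E : ℕ) (mm : ℕ → ℕ) (vv : ℕ → ℕ → ℂ)
    (γ : ℕ → Multiset ℕ) : ℂ :=
  ∏ k ∈ Finset.range E, ((γ k).map fun r => pGenSys u E mm vv k r).prod

/-- the Schur function `s_γ` of an `E`-tuple of partitions. -/
noncomputable def sAlphaSys (E : ℕ) (mm : ℕ → ℕ) (vv : ℕ → ℕ → ℂ) (γ : ℕ → Multiset ℕ) : ℂ :=
  ∏ k ∈ Finset.range E, schurFin (mm k) (γ k) (vv k)

/-- the monomial symmetric function `m_γ` of an `E`-tuple of partitions. -/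
noncomputable def mAlphaSys (E : ℕ) (mm : ℕ → ℕ) (vv : ℕ → ℕ → ℂ) (γ : ℕ → Multiset ℕ) : ℂ :=
  ∏ k ∈ Finset.range E, monoFin (mm k) (γ k) (vv k)

/-- the function `q_{r,±}^{(k)}(x;t)` of [S], (3.1.1). -/
noncomputable def qGenSys (t : ℂ) (E : ℕ) (mm : ℕ → ℕ) (vv : ℕ → ℕ → ℂ)
    (sgn : Bool) (k r : ℕ) : ℂ :=
  if r = 0 then 1 else
    let k' := if sgn then (k + 1) % E else (k + E - 1) % E
    ∑ i ∈ Finset.range (mm k),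
      vv k i ^ ((r : ℤ) + (mm k : ℤ) - 1 - (mm k' : ℤ)) *
        (∏ jj ∈ Finset.range (mm k'), (vv k i - t * vv k' jj)) /
        ∏ jj ∈ (Finset.range (mm k)).erase i, (vv k i - vv k jj)

/-- the function `q_{γ,±}(x;t)` of [S], (3.1.2). -/
noncomputable def qAlphaSys (t : ℂ) (E : ℕ) (mm : ℕ → ℕ) (vv : ℕ → ℕ → ℂ)
    (sgn : Bool) (γ : ℕ → Multiset ℕ) : ℂ :=
  ∏ k ∈ Finset.range E, ((γ k).map fun r => qGenSys t E mm vv sgn k r).prod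

/-- `z_β = ∏ i^{n_i} n_i!` for a partition `β = (1^{n_1} 2^{n_2} ⋯)`. -/
noncomputable def zPart (μ : Multiset ℕ) : ℂ :=
  ∏ i ∈ μ.toFinset, (i : ℂ) ^ (μ.count i) * (Nat.factorial (μ.count i) : ℂ)

/-- `z_γ(t) = z_γ ∏_{k,j} (1 - u^k t^{γ_j^{(k)}})⁻¹` for an `E`-tuple of
partitions `γ` (`u` the `E`-th root of unity), cf. (3.1.3). -/
noncomputable def zClassSys (u t : ℂ) (E : ℕ) (γ : ℕ → Multiset ℕ) : ℂ :=
  ((E : ℂ) ^ (∑ k ∈ Finset.range E, (γ k).card)) * (∏ k ∈ Finset.range E, zPart (γ k)) *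
    (∏ k ∈ Finset.range E, ((γ k).map fun r => (1 - u ^ k * t ^ r)).prod)⁻¹

/-! ### the `j`-th pieces attached to an e-partition -/

/-- the truncation `α{j} = (α^{(0)},…,α^{(j₁d-1)})` (used when `c_{α,p} ∣ j`). -/
noncomputable def braceF (e : ℕ) [NeZero e] (p d : ℕ) (j : ℕ) (α : ZMod e → Multiset ℕ) :
    ℕ → Multiset ℕ :=
  fun k => if k < Esys p d j then α ((k : ℕ) : ZMod e) else 0

/-- the `j₁d`-partition `α[j]` of `n/h` (condition (2.6.1)): component `k/h`
has parts `α_i^{(k)}/h`. -/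
noncomputable def bracketF (e : ℕ) [NeZero e] (p d : ℕ) (j : ℕ) (α : ZMod e → Multiset ℕ) :
    ℕ → Multiset ℕ :=
  fun k' => if k' < Esys p d j then (α (((hOrd p j * k' : ℕ) : ZMod e))).map (fun r => r / hOrd p j)
  else 0

/-- condition (2.6.1): `h_j` divides all parts `α_i^{(k)}`, and `h_j ∣ k`
whenever `α^{(k)} ≠ ∅`. -/
def Cond261 (e : ℕ) [NeZero e] (p j : ℕ) (α : ZMod e → Multiset ℕ) : Prop :=
  (∀ k, ∀ r ∈ α k, hOrd p j ∣ r) ∧ ∀ k : ZMod e, α k ≠ 0 → hOrd p j ∣ k.val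

/-- `s_{α{j}}(𝒳_j)`. -/
noncomputable def schurBrace (e : ℕ) [NeZero e] (p d : ℕ) (m : ZMod e → ℕ) (xv : BIdx e m → ℂ)
    (j : ℕ) (α : ZMod e → Multiset ℕ) : ℂ :=
  sAlphaSys (Esys p d j) (mmX e m) (vvX e p d m xv j) (braceF e p d j α)

/-- `p_{α[j]}(𝒳_j)` (2.6; the root of unity for the system `𝒳_j` is `ζ^h`). -/
noncomputable def pBracket (e : ℕ) [NeZero e] (p d : ℕ) (ζ : ℂ) (m : ZMod e → ℕ)
    (xv : BIdx e m → ℂ) (j : ℕ) (α : ZMod e → Multiset ℕ) : ℂ :=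
  pAlphaSys (ζ ^ hOrd p j) (Esys p d j) (mmX e m) (vvX e p d m xv j) (bracketF e p d j α)

/-- `l(α[j])`. -/
noncomputable def lenBracket (e : ℕ) [NeZero e] (p d : ℕ) (j : ℕ)
    (α : ZMod e → Multiset ℕ) : ℕ :=
  ∑ k ∈ Finset.range (Esys p d j), (bracketF e p d j α k).card

/-! ### Schur functions and power sums for `σ^q W` (2.10) -/

/-- the `j`-th component `s^j_{α,φ}` of the Schur function `𝐬_{α,φ}` for
`σ^q W` (2.10.1); the character `φ = φ_r` of `Γ_α = ⟨τ^c⟩ ≅ ℤ/(p/c)ℤ` is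
encoded by `r`, via `φ_r(τ^j) = ζ^{drj}` for `c ∣ j`. -/
noncomputable def sTuple (e : ℕ) [NeZero e] (p d q : ℕ) (ζ : ℂ) (m : ZMod e → ℕ)
    (xv : BIdx e m → ℂ) (α : ZMod e → Multiset ℕ) (r : ℕ) (j : ℕ) : ℂ :=
  if csize e d α ∣ j then
    ζ ^ (d * r * j) *
      ∑ i ∈ Finset.range (csize e d α),
        ζ ^ (q * i * d) * schurBrace e p d m xv j ((theta e d)^[i] α)
  else 0

/-- the `j`-th component `p^j_{β,b}` of the power sum `𝐩_{β,b}` for `σ^q W`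
(2.10.2). -/
noncomputable def pTuple (e : ℕ) [NeZero e] (p d : ℕ) (ζ : ℂ) (m : ZMod e → ℕ)
    (xv : BIdx e m → ℂ) (β : ZMod e → Multiset ℕ) (b : ZMod e) (j : ℕ) : ℂ :=
  if Cond261 e p j β then
    (hOrd p j : ℂ) ^ (lenBracket e p d j β) *
      zmpow e ζ (-(((Delta e β : ZMod e) + b) * ((j * d : ℕ) : ZMod e))) *
      pBracket e p d ζ m xv j β
  else 0

/-! ## The model for (extensions of) the irreducible characters of `W` -/

/-- trace of `f` on a subspace (junk `0` if not invariant). -/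
noncomputable def traceOn {V : Type*} [AddCommGroup V] [Module ℂ V]
    (S : Submodule ℂ V) (f : V →ₗ[ℂ] V) : ℂ :=
  if h : ∀ v ∈ S, f v ∈ S then LinearMap.trace ℂ S (f.restrict h) else 0

/-- the scalar by which the torus element `diag dv ∈ G` acts on a highest
weight vector of weight `α`. -/
noncomputable def weightOf (e : ℕ) [NeZero e] (m : ZMod e → ℕ) (α : ZMod e → Multiset ℕ)
    (dv : BIdx e m → ℂ) : ℂ :=
  ∏ b : BIdx e m, dv b ^ (lamOf (α b.1) b.2.val)

/-- the space of highest weight vectors of weight `α` in `V^{⊗n}`: the model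
for the irreducible `W̃`-module `Z_α` (1.3.1, 1.4). -/
noncomputable def hwSubmodule (e n : ℕ) [NeZero e] (m : ZMod e → ℕ)
    (α : ZMod e → Multiset ℕ) : Submodule ℂ (TIdx e n m → ℂ) :=
  (⨅ g ∈ {g | IsUpperUni e m g},
      Module.End.eigenspace (Matrix.mulVecLin (tensorPow e n m g)) 1) ⊓
    ⨅ dv : BIdx e m → ℂ,
      Module.End.eigenspace (Matrix.mulVecLin (tensorPow e n m (Matrix.diagonal dv)))
        (weightOf e m α dv)

/-- the model for the irreducible `W`-module `Z_{α,φ_r}`: the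
`φ_r(τ^c)`-eigenspace of `τ^c` on `Z_α`, where `c = c_{α,p}` and
`φ_r(τ^c) = ζ^{cdr}`. -/
noncomputable def ZSub (e n : ℕ) [NeZero e] (d : ℕ) (m : ZMod e → ℕ)
    (hm : ∀ k, m (k + (d : ZMod e)) = m k) (ζ : ℂ) (α : ZMod e → Multiset ℕ) (r : ℕ) :
    Submodule ℂ (TIdx e n m → ℂ) :=
  hwSubmodule e n m α ⊓
    Module.End.eigenspace (Matrix.mulVecLin ((tauMat e n d m hm) ^ (csize e d α)))
      (ζ ^ (csize e d α * d * r))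

/-- The model for the irreducible character `χ^{α,φ_r}` of `W` and for its
chosen extension `χ̃^{α,φ_r}` to `⟨σ^q⟩ ⋉ W`: the trace of `w` on the model
`Z_{α,φ_r} ⊆ V^{⊗n}`. -/
noncomputable def charExt (e n : ℕ) [NeZero e] (d : ℕ) (m : ZMod e → ℕ)
    (hm : ∀ k, m (k + (d : ZMod e)) = m k) (ζ : ℂ) (α : ZMod e → Multiset ℕ) (r : ℕ)
    (w : Wt e n) : ℂ :=
  traceOn (ZSub e n d m hm ζ α r) (Matrix.mulVecLin (rhoMat e n ζ m w))

/-! ## symbols, a-function, similarity; the reflection representation -/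

/-- the multiset of entries of the symbol `Λ(α) = α + Λ⁰` of type `(r,0)`. -/
noncomputable def entriesSym (e : ℕ) [NeZero e] (m : ZMod e → ℕ) (rsym : ℕ)
    (α : ZMod e → Multiset ℕ) : Multiset ℕ :=
  (Finset.univ : Finset (BIdx e m)).val.map fun b =>
    lamOf (α b.1) b.2.val + rsym * (m b.1 - 1 - b.2.val)

noncomputable def pairMinSum (M : Multiset ℕ) : ℕ :=
  (M.bind fun a => M.map fun b => min a b).sum

/-- the `a`-function (3.5.2) on symbols of type `(rsym, 0)`. -/
noncomputable def aVal (e : ℕ) [NeZero e] (m : ZMod e → ℕ) (rsym : ℕ)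
    (α : ZMod e → Multiset ℕ) : ℕ :=
  pairMinSum (entriesSym e m rsym α) - pairMinSum (entriesSym e m rsym (fun _ => 0))

/-- similarity of symbols: equality of entries with multiplicities. -/
def SimSym (e : ℕ) [NeZero e] (m : ZMod e → ℕ) (rsym : ℕ) (α β : ZMod e → Multiset ℕ) : Prop :=
  entriesSym e m rsym α = entriesSym e m rsym β

/-- the reflection representation `M = ℂ^n` of `W̃` (`w(e_i) = ζ^{a_i} e_{x(i)}`). -/
noncomputable def refMat (e n : ℕ) [NeZero e] (ζ : ℂ) (w : Wt e n) :
    Matrix (Fin n) (Fin n) ℂ :=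
  fun i' i => if i' = w.right i then zmpow e ζ (w.left i').toAdd else 0

/-- The functional `R_q(f)` of (4.2.1), for a function `f` on the coset `σ^q W`. -/
noncomputable def Rq (e p d n : ℕ) [NeZero e] [NeZero n] (hp : p ∣ e) (ζ t : ℂ) (q : ℕ)
    (f : Wt e n → ℂ) : ℂ :=
  (ζ ^ (q * d) * t ^ (d * n) - 1) * (∏ i ∈ Finset.Icc 1 (n - 1), (t ^ (e * i) - 1)) *
    (Nat.card (Wgrp e p n hp) : ℂ)⁻¹ *
    ∑ w ∈ Finset.univ.filter (fun w => inCoset e p n hp q w),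
      (refMat e n ζ w).det * f w / (t • (1 : Matrix (Fin n) (Fin n) ℂ) - refMat e n ζ w).det

/-- `N^*`: the number of reflections in `W`. -/
noncomputable def Nstar (e p n : ℕ) [NeZero e] (hp : p ∣ e) (ζ : ℂ) : ℕ :=
  Nat.card {w : Wt e n // w ∈ Wgrp e p n hp ∧ w ≠ 1 ∧ (refMat e n ζ w - 1).rank = 1}

end GreenII
namespace GreenII

/-- The model for the isotypic component `V_{α,φ}⊗Z̃_{α,φ}` inside `V^{⊗n}`:
the `G̃`-span of the model `Z_{α,φ_r}` of the irreducible `W`-module. -/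
noncomputable def compSub (e n : ℕ) [NeZero e] (d : ℕ) (m : ZMod e → ℕ)
    (hm : ∀ k, m (k + (d : ZMod e)) = m k) (ζ : ℂ) (α : ZMod e → Multiset ℕ) (r : ℕ) :
    Submodule ℂ (TIdx e n m → ℂ) :=
  Submodule.span ℂ
    {u | ∃ g i v, IsBlockDiag e m g ∧ IsUnit g ∧ v ∈ ZSub e n d m hm ζ α r ∧
      u = Matrix.mulVecLin (tensorPow e n m g * (tauMat e n d m hm) ^ i) v}


/-! ## Part A: Jacobi--Trudi versus bialternant -/

noncomputable def hGen {R : Type*} [CommRing R] (N r : ℕ) (v : Fin N → R) : R :=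
  ∑ c ∈ Finset.Nat.antidiagonalTuple N r, ∏ i : Fin N, v i ^ c i

noncomputable def hGenZ {R : Type*} [CommRing R] (N : ℕ) (v : Fin N → R) (a : ℤ) : R :=
  if 0 ≤ a then hGen N a.toNat v else 0

noncomputable def schurGen {R : Type*} [CommRing R] (N : ℕ) (lam : Fin N → ℕ) (v : Fin N → R) : R :=
  Matrix.det (Matrix.of fun i j : Fin N => hGenZ N v ((lam i : ℤ) + j - i))

/-- alternant -/
noncomputable def altGen {R : Type*} [CommRing R] (N : ℕ) (mu : Fin N → ℕ) (v : Fin N → R) : R :=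
  Matrix.det (Matrix.of fun i k : Fin N => v k ^ mu i)

lemma schurFin_eq (N : ℕ) (μ : Multiset ℕ) (v : ℕ → ℂ) :
    schurFin N μ v = schurGen N (fun i => lamOf μ i) (fun i : Fin N => v i) := by
  unfold schurFin schurGen hGenZ hGen hcomp
  congr 1

lemma hGen_map {R S : Type*} [CommRing R] [CommRing S] (f : R →+* S) (N r : ℕ) (v : Fin N → R) :
    f (hGen N r v) = hGen N r (fun i => f (v i)) := by
  simp [hGen, map_sum, map_prod, map_pow]

lemma schurGen_map {R S : Type*} [CommRing R] [CommRing S] (f : R →+* S) (N : ℕ)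
    (lam : Fin N → ℕ) (v : Fin N → R) :
    f (schurGen N lam v) = schurGen N lam (fun i => f (v i)) := by
  unfold schurGen
  rw [RingHom.map_det]
  congr 1
  ext i j
  simp only [RingHom.mapMatrix_apply, Matrix.map_apply, Matrix.of_apply, hGenZ]
  split_ifs
  · exact hGen_map f _ _ _
  · simp

lemma hGen_zero {R : Type*} [CommRing R] (N : ℕ) (v : Fin N → R) : hGen N 0 v = 1 := by
  simp [hGen, Finset.Nat.antidiagonalTuple_zero_right]

lemma coeff_prod_geom {R : Type*} [CommRing R] (N r : ℕ) (v : Fin N → R) :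
    PowerSeries.coeff r (∏ i : Fin N, PowerSeries.mk (fun s => v i ^ s)) = hGen N r v := by
  rw [PowerSeries.coeff_prod, hGen]
  refine Finset.sum_bij' (fun l _ => (l : Fin N → ℕ)) (fun c _ => Finsupp.equivFunOnFinite.symm c)
    ?_ ?_ ?_ ?_ ?_
  · intro l hl
    simp only [Finset.mem_finsuppAntidiag] at hl
    exact Finset.Nat.mem_antidiagonalTuple.mpr hl.1
  · intro c hc
    simp only [Finset.mem_finsuppAntidiag]
    exact ⟨Finset.Nat.mem_antidiagonalTuple.mp hc, Finset.subset_univ _⟩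
  · intro l _; ext i; rfl
  · intro c _; rfl
  · intro l _; simp

lemma geom_mul {R : Type*} [CommRing R] (x : R) :
    PowerSeries.mk (fun s => x ^ s) * ((1 - Polynomial.C x * Polynomial.X : Polynomial R) : PowerSeries R) = 1 := by
  ext s
  simp only [Polynomial.coe_sub, Polynomial.coe_one, Polynomial.coe_mul, Polynomial.coe_C,
    Polynomial.coe_X, mul_sub, mul_one]
  rw [← mul_assoc, mul_comm _ (PowerSeries.C x)]
  cases s with
  | zero => simp
  | succ s => simp [PowerSeries.coeff_one, pow_succ, mul_comm]

noncomputable def gPol {R : Type*} [CommRing R] (N : ℕ) (v : Fin N → R) (k : Fin N) : Polynomial R :=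
  ∏ i ∈ Finset.univ.erase k, (1 - Polynomial.C (v i) * Polynomial.X)

lemma gPol_natDegree {R : Type*} [CommRing R] (N : ℕ) (v : Fin N → R) (k : Fin N) :
    (gPol N v k).natDegree ≤ N - 1 := by
  unfold gPol
  refine (Polynomial.natDegree_prod_le _ _).trans ?_
  refine (Finset.sum_le_card_nsmul _ _ 1 ?_).trans ?_
  · intro i _
    refine (Polynomial.natDegree_sub_le _ _).trans ?_
    simp only [Polynomial.natDegree_one, zero_le, sup_of_le_right]
    simpa using Polynomial.natDegree_C_mul_X_pow_le (v i) 1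
  · simp [Finset.card_erase_of_mem]

lemma pow_eq_conv {R : Type*} [CommRing R] (N : ℕ) (v : Fin N → R) (k : Fin N) (r : ℕ) :
    v k ^ r = ∑ x ∈ Finset.HasAntidiagonal.antidiagonal r, hGen N x.1 v * (gPol N v k).coeff x.2 := by
  have h : (∏ i : Fin N, PowerSeries.mk (fun s => v i ^ s)) * ((gPol N v k : Polynomial R) : PowerSeries R)
      = PowerSeries.mk (fun s => v k ^ s) := by
    rw [← Finset.mul_prod_erase Finset.univ _ (Finset.mem_univ k), mul_assoc]
    unfold gPol
    rw [show ((∏ i ∈ Finset.univ.erase k, (1 - Polynomial.C (v i) * Polynomial.X) : Polynomial R) : PowerSeries R)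
      = ∏ i ∈ Finset.univ.erase k, ((1 - Polynomial.C (v i) * Polynomial.X : Polynomial R) : PowerSeries R) by
        simp only [← Polynomial.coeToPowerSeries.ringHom_apply]
        exact map_prod (Polynomial.coeToPowerSeries.ringHom (R := R))
          (fun i => (1 - Polynomial.C (v i) * Polynomial.X : Polynomial R)) _]
    rw [← Finset.prod_mul_distrib, Finset.prod_congr rfl (fun i _ => geom_mul (v i))]
    simp
  have h2 := congrArg (PowerSeries.coeff r) h
  rw [PowerSeries.coeff_mul] at h2
  simp only [PowerSeries.coeff_mk, coeff_prod_geom, Polynomial.coeff_coe] at h2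
  exact h2.symm

lemma pow_eq_hGenZ {R : Type*} [CommRing R] (N : ℕ) (v : Fin N → R) (k : Fin N) (r : ℕ) :
    v k ^ r = ∑ j : Fin N, hGenZ N v ((r : ℤ) - (N - 1) + j) * (gPol N v k).coeff (N - 1 - j) := by
  rw [pow_eq_conv]
  have hN : 0 < N := k.pos
  rw [Finset.Nat.sum_antidiagonal_eq_sum_range_succ_mk]
  have e1 : ∀ j : Fin N, hGenZ N v ((r : ℤ) - (N - 1) + j) * (gPol N v k).coeff (N - 1 - j)
     = (fun b : ℕ => (if b ≤ r then hGen N (r - b) v * (gPol N v k).coeff b else 0)) (N - 1 - j) := by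
    intro j
    have hj := j.2
    simp only [hGenZ]
    by_cases h : N - 1 - (j:ℕ) ≤ r
    · rw [if_pos (by omega), if_pos h]; congr 2; omega
    · rw [if_neg (by omega), if_neg h, zero_mul]
  rw [Finset.sum_congr rfl (fun j _ => e1 j), Fin.sum_univ_eq_sum_range (fun j => (fun b : ℕ => (if b ≤ r then hGen N (r - b) v * (gPol N v k).coeff b else 0)) (N - 1 - j)) N,
    Finset.sum_range_reflect (fun b : ℕ => (if b ≤ r then hGen N (r - b) v * (gPol N v k).coeff b else 0)) N]
  have h0 : ∀ b, N ≤ b → (gPol N v k).coeff b = 0 := fun b hb =>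
    Polynomial.coeff_eq_zero_of_natDegree_lt (lt_of_le_of_lt (gPol_natDegree N v k) (by omega))
  rw [← Finset.sum_range_reflect]
  rw [← Finset.sum_filter]
  have : ∑ x ∈ Finset.range r.succ, hGen N (r + 1 - 1 - x) v * (gPol N v k).coeff (r - (r + 1 - 1 - x))
    = ∑ x ∈ Finset.range r.succ, hGen N (r - x) v * (gPol N v k).coeff x := by
    apply Finset.sum_congr rfl
    intro x hx
    rw [Finset.mem_range] at hx
    congr 2
    omega
  refine this.trans ?_
  symm
  apply Finset.sum_subset
  · intro b hb
    simp only [Finset.mem_filter, Finset.mem_range] at hb ⊢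
    omega
  · intro b hb hb'
    simp only [Finset.mem_filter, Finset.mem_range] at hb hb'
    rw [h0 b (by omega), mul_zero]

lemma alt_eq_schur_mul {R : Type*} [CommRing R] (N : ℕ) (lam : Fin N → ℕ) (v : Fin N → R) :
    altGen N (fun i => lam i + (N - 1 - i)) v = schurGen N lam v *
      Matrix.det (Matrix.of fun j k : Fin N => (gPol N v k).coeff (N - 1 - j)) := by
  unfold altGen schurGen
  rw [← Matrix.det_mul]
  congr 1
  ext i k
  rw [Matrix.mul_apply]
  simp only [Matrix.of_apply]
  rw [pow_eq_hGenZ]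
  apply Finset.sum_congr rfl
  intro j _
  congr 2
  have := i.2
  push_cast [Nat.sub_sub, Nat.cast_sub (show 1 + (i:ℕ) ≤ N by omega)]
  ring

lemma schurGen_zero {R : Type*} [CommRing R] (N : ℕ) (v : Fin N → R) :
    schurGen N (fun _ => 0) v = 1 := by
  unfold schurGen
  rw [Matrix.det_of_isUpperTriangular]
  · simp [hGenZ, hGen_zero]
  · intro i j hij
    simp only [Matrix.of_apply, hGenZ]
    rw [if_neg]
    simp only [id] at hij
    have : (j : ℕ) < i := hij
    push_cast
    omega

/-- Bialternant formula: `a_{λ+δ} = s_λ a_δ`. -/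
lemma alt_eq_schur {R : Type*} [CommRing R] (N : ℕ) (lam : Fin N → ℕ) (v : Fin N → R) :
    altGen N (fun i => lam i + (N - 1 - i)) v =
      schurGen N lam v * altGen N (fun i => N - 1 - i) v := by
  have h0 := alt_eq_schur_mul N (fun _ => 0) v
  rw [schurGen_zero, one_mul] at h0
  simp only [zero_add] at h0
  rw [alt_eq_schur_mul, h0]



/-! ## Part B: a polynomial characterisation of Schur functions (Casimir argument) -/

lemma deriv_prod {R P ι : Type*} [DecidableEq ι] [CommRing R] [CommRing P] [Algebra R P] (D : Derivation R P P)
    (s : Finset ι) (f : ι → P) :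
    D (∏ x ∈ s, f x) = ∑ x ∈ s, (∏ y ∈ s.erase x, f y) * D (f x) := by
  induction s using Finset.induction_on with
  | empty => simp
  | insert a s ha ih =>
    rw [Finset.prod_insert ha, Derivation.leibniz, ih, Finset.sum_insert ha, Finset.erase_insert ha]
    simp only [smul_eq_mul]
    rw [add_comm]
    congr 1
    rw [Finset.mul_sum]
    apply Finset.sum_congr rfl
    intro x hx
    have hxa : a ≠ x := fun h => ha (h ▸ hx)
    rw [Finset.erase_insert_of_ne hxa, Finset.prod_insert (fun h => ha (Finset.mem_of_mem_erase h))]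
    ring

lemma vander_quot {R P : Type*} [CommRing R] [CommRing P] [Algebra R P] (N : ℕ) (v : Fin N → P) :
    ∃ Q : Fin N → Fin N → P,
      (∀ i j, i ≠ j → Q i j * (v i - v j) = (Matrix.vandermonde v).det) ∧
      (∀ i j, i ≠ j → Q j i = - Q i j) ∧
      ∀ D : Derivation R P P, D (Matrix.vandermonde v).det =
        ∑ i, ∑ j, if i ≠ j then Q i j * D (v i) else 0 := by
  set pr : Finset (Fin N × Fin N) := Finset.univ.filter (fun x => x.1 < x.2) with hpr
  have hA : (Matrix.vandermonde v).det = ∏ x ∈ pr, (v x.2 - v x.1) := by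
    rw [Matrix.det_vandermonde, hpr, Finset.prod_filter, ← Finset.univ_product_univ,
      Finset.prod_product]
    apply Finset.prod_congr rfl
    intro i _
    rw [← Finset.prod_filter]
    apply Finset.prod_congr _ (fun _ _ => rfl)
    ext j; simp
  let R0 : Fin N × Fin N → P := fun x => ∏ y ∈ pr.erase x, (v y.2 - v y.1)
  have hR0 : ∀ x ∈ pr, R0 x * (v x.2 - v x.1) = (Matrix.vandermonde v).det := by
    intro x hx
    rw [hA, mul_comm]
    exact Finset.mul_prod_erase pr (fun x => v x.2 - v x.1) hx
  refine ⟨fun i j => if i < j then - R0 (i, j) else R0 (j, i), ?_, ?_, ?_⟩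
  · intro i j hij
    rcases lt_or_gt_of_ne hij with h | h
    · simp only [h, if_true]
      have := hR0 (i, j) (by simp [hpr, h])
      simp only at this
      rw [← this]; ring
    · simp only [h.not_gt, if_false]
      exact hR0 (j, i) (by simp [hpr, h])
  · intro i j hij
    rcases lt_or_gt_of_ne hij with h | h
    · simp [h, h.not_gt]
    · simp [h, h.not_gt]
  · intro D
    rw [hA, deriv_prod]
    have e1 : ∑ x ∈ pr, (∏ y ∈ pr.erase x, (v y.2 - v y.1)) * D (v x.2 - v x.1)
      = ∑ i, ∑ j, ((if i < j then R0 (i, j) * D (v j) else 0) + (if i < j then - R0 (i, j) * D (v i) else 0)) := by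
      rw [hpr, Finset.sum_filter, ← Finset.univ_product_univ, Finset.sum_product]
      refine Finset.sum_congr rfl fun i _ => Finset.sum_congr rfl fun j _ => ?_
      by_cases h : i < j
      · simp only [h, if_true, map_sub]
        simp only [R0, hpr, ← Finset.univ_product_univ]
        ring
      · simp [h]
    rw [e1]
    simp only [Finset.sum_add_distrib]
    rw [Finset.sum_comm]
    simp only [← Finset.sum_add_distrib]
    refine Finset.sum_congr rfl fun i _ => Finset.sum_congr rfl fun j _ => ?_
    rcases lt_trichotomy i j with h | h | h
    · simp [h, h.not_gt, h.ne]
    · subst h; simp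
    · simp [h, h.not_gt, h.ne']

lemma alt_quot {R P : Type*} [CommRing R] [CommRing P] [Algebra R P] (N : ℕ) (v : Fin N → P) :
    ∃ Q : Fin N → Fin N → P,
      (∀ i j, i ≠ j → Q i j * (v i - v j) = altGen N (fun i => N - 1 - i) v) ∧
      (∀ i j, i ≠ j → Q j i = - Q i j) ∧
      ∀ D : Derivation R P P, D (altGen N (fun i => N - 1 - i) v) =
        ∑ i, ∑ j, if i ≠ j then Q i j * D (v i) else 0 := by
  obtain ⟨Q, h1, h2, h3⟩ := vander_quot (R := R) N (fun i => v i.rev)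
  have hdet : (Matrix.vandermonde fun i : Fin N => v i.rev).det = altGen N (fun i => N - 1 - i) v := by
    unfold altGen
    rw [← Matrix.det_submatrix_equiv_self Fin.revPerm, ← Matrix.det_transpose]
    congr 1
    ext i j
    simp [Matrix.vandermonde_apply, Fin.val_rev, Nat.sub_sub, add_comm]
  rw [hdet] at h1 h3
  refine ⟨fun i j => Q i.rev j.rev, ?_, ?_, ?_⟩
  · intro i j hij
    have := h1 i.rev j.rev (by simpa using hij)
    simpa using this
  · intro i j hij
    exact h2 _ _ (by simpa using hij)
  · intro D
    rw [h3 D]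
    rw [← Equiv.sum_comp Fin.revPerm]
    refine Finset.sum_congr rfl fun i _ => ?_
    rw [← Equiv.sum_comp Fin.revPerm]
    refine Finset.sum_congr rfl fun j _ => ?_
    simp

lemma pde {R P : Type*} [CommRing R] [CommRing P] [Algebra R P] (N : ℕ) (v : Fin N → P)
    (θ : Fin N → Derivation R P P) 
    (a : P) (Q : Fin N → Fin N → P) (hQ : ∀ i j, i ≠ j → Q i j * (v i - v j) = a)
    (hQ' : ∀ i j, i ≠ j → Q j i = - Q i j)
    (ha : ∀ i, θ i a = ∑ j, if i ≠ j then Q i j * v i else 0)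
    (F : P) (S : Fin N → Fin N → P)
    (hS : ∀ i j, i ≠ j → (v i - v j) * S i j = v i * (θ i F - θ j F)) (c g D2 : R)
    (hC : ∑ i, θ i (θ i F) + ∑ i, ∑ j, (if i ≠ j then S i j else 0) = c • F)
    (hg : ∑ i, θ i F = g • F) (hD2 : ∑ i, θ i (θ i a) = D2 • a) :
    ∑ i, θ i (θ i (a * F)) = (c + D2 + (N - 1) * g) • (a * F) := by
  have h1 : ∀ i, θ i (θ i (a * F)) = a * θ i (θ i F) + 2 * (θ i a * θ i F) + F * θ i (θ i a) := by
    intro i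
    simp only [Derivation.leibniz, smul_eq_mul, map_add]
    ring
  simp only [h1, Finset.sum_add_distrib, ← Finset.mul_sum, hD2]
  have h2 : ∑ i, θ i a * θ i F = ∑ i, ∑ j, if i ≠ j then Q i j * v i * θ i F else 0 := by
    refine Finset.sum_congr rfl fun i _ => ?_
    rw [ha, Finset.sum_mul]
    refine Finset.sum_congr rfl fun j _ => ?_
    split_ifs <;> simp
  have h3 : a * ∑ i, ∑ j, (if i ≠ j then S i j else 0) =
      ∑ i, ∑ j, ((if i ≠ j then Q i j * v i * θ i F else 0) - (if i ≠ j then Q i j * v i * θ j F else 0)) := by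
    rw [Finset.mul_sum]
    refine Finset.sum_congr rfl fun i _ => ?_
    rw [Finset.mul_sum]
    refine Finset.sum_congr rfl fun j _ => ?_
    by_cases h : i ≠ j
    · simp only [if_pos h]
      rw [← hQ i j h, mul_assoc, hS i j h]; ring
    · simp [h]
  have h4 : ∑ i, ∑ j, (if i ≠ j then Q i j * v i * θ j F else 0) =
      - ∑ i, ∑ j, (if i ≠ j then Q i j * v j * θ i F else 0) := by
    rw [Finset.sum_comm, ← Finset.sum_neg_distrib]
    refine Finset.sum_congr rfl fun i _ => ?_
    rw [← Finset.sum_neg_distrib]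
    refine Finset.sum_congr rfl fun j _ => ?_
    by_cases h : i ≠ j
    · rw [if_pos h, if_pos h.symm, hQ' i j h]; ring
    · push Not at h; simp [h]
  have h5 : ∑ i, ∑ j, (if i ≠ j then Q i j * v i * θ i F else 0)
      - ∑ i, ∑ j, (if i ≠ j then Q i j * v j * θ i F else 0) = ((N - 1) * g) • (a * F) := by
    rw [← Finset.sum_sub_distrib]
    have : ∀ i, ∑ j, (if i ≠ j then Q i j * v i * θ i F else 0)
      - ∑ j, (if i ≠ j then Q i j * v j * θ i F else 0) = ((N:R) - 1) • (a * θ i F) := by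
      intro i
      rw [← Finset.sum_sub_distrib]
      have : ∀ j, ((if i ≠ j then Q i j * v i * θ i F else 0) - (if i ≠ j then Q i j * v j * θ i F else 0))
        = if j = i then 0 else a * θ i F := by
        intro j
        by_cases h : i ≠ j
        · rw [if_pos h, if_pos h, if_neg h.symm, ← hQ i j h]; ring
        · push Not at h; simp [h]
      simp only [this]
      rw [Finset.sum_ite]
      simp only [Finset.sum_const_zero, zero_add, Finset.sum_const]
      rw [Finset.filter_ne', Finset.card_erase_of_mem (Finset.mem_univ _), Finset.card_univ, Fintype.card_fin]
      rw [← Nat.cast_smul_eq_nsmul R, Nat.cast_sub i.pos]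
      simp
    simp only [this]
    rw [← Finset.smul_sum, ← Finset.mul_sum, hg, mul_smul, mul_smul_comm]
  have h6 : a * ∑ i, θ i (θ i F) = c • (a * F) - a * ∑ i, ∑ j, (if i ≠ j then S i j else 0) := by
    rw [eq_sub_iff_add_eq, ← mul_add, hC, mul_smul_comm]
  rw [h6, h3, h2]
  simp only [Finset.sum_sub_distrib]
  rw [h4]
  rw [add_smul, add_smul, ← h5, mul_smul_comm, mul_comm F a]
  ring

/-- partial sums -/
def psum {N : ℕ} (f : Fin N → ℕ) (r : ℕ) : ℕ := ∑ i : Fin N, if i.val < r then f i else 0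

lemma psum_succ {N : ℕ} (f : Fin N → ℕ) (r : Fin N) : psum f (r + 1) = psum f r + f r := by
  unfold psum
  have : ∀ i : Fin N, (if i.val < r.val + 1 then f i else 0) =
    (if i.val < r.val then f i else 0) + (if i = r then f i else 0) := by
    intro i
    rcases lt_trichotomy i r with h | h | h
    · have h' : i.val < r.val := h
      simp [h', h.ne, Nat.lt_succ_of_lt h']
    · subst h; simp
    · have h' : r.val < i.val := h
      simp [h.ne', show ¬ i.val < r.val + 1 by omega, show ¬ i.val < r.val by omega]
  simp only [this, Finset.sum_add_distrib]
  simp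

lemma psum_top {N : ℕ} (f : Fin N → ℕ) : psum f N = ∑ i, f i := by
  unfold psum; simp

lemma eq_of_psum {N : ℕ} (f g : Fin N → ℕ) (h : ∀ r, psum f r = psum g r) : f = g := by
  funext i
  have h1 := psum_succ f i
  have h2 := psum_succ g i
  rw [h, h] at h1
  omega

lemma psum_add {N : ℕ} (f g : Fin N → ℕ) (r : ℕ) : psum (fun i => f i + g i) r = psum f r + psum g r := by
  unfold psum
  rw [← Finset.sum_add_distrib]
  refine Finset.sum_congr rfl fun i _ => ?_
  split_ifs <;> simp

lemma psum_perm_le {N : ℕ} (f : Fin N → ℕ) (hf : Antitone f) (u : Equiv.Perm (Fin N)) (r : ℕ) :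
    psum (fun i => f (u i)) r ≤ psum f r := by
  unfold psum
  have hmv : Monovary (fun i : Fin N => if i.val < r then 1 else 0) f := by
    intro i j hij
    have hji : j < i := by
      by_contra h
      exact absurd (hf (not_lt.mp h)) (not_le.mpr hij)
    have : j.val < i.val := hji
    simp only
    split_ifs <;> omega
  have := hmv.sum_mul_comp_perm_le_sum_mul (σ := u)
  simpa using this

lemma abel_sum (x w : ℕ → ℤ) (n : ℕ) :
    ∑ i ∈ Finset.range (n + 1), x i * w i = (∑ i ∈ Finset.range (n + 1), x i) * w n +
      ∑ r ∈ Finset.range n, (∑ i ∈ Finset.range (r + 1), x i) * (w r - w (r + 1)) := by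
  induction n with
  | zero => simp
  | succ n ih =>
    rw [Finset.sum_range_succ, ih, Finset.sum_range_succ (fun i => x i) (n + 1),
      Finset.sum_range_succ (fun r => (∑ i ∈ Finset.range (r + 1), x i) * (w r - w (r + 1))) n]
    ring

lemma psum_range {N : ℕ} (f : Fin N → ℕ) (r : ℕ) (hr : r ≤ N) :
    psum f r = ∑ i ∈ Finset.range r, (if h : i < N then f ⟨i, h⟩ else 0) := by
  induction r with
  | zero => simp [psum]
  | succ r ih =>
    rw [Finset.sum_range_succ, ← ih (by omega), dif_pos (show r < N by omega)]
    exact psum_succ f ⟨r, by omega⟩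

lemma eq_of_dom_norm {N : ℕ} (f g : Fin N → ℕ) (hf : StrictAnti f) (hg : StrictAnti g)
    (hdom : ∀ r, psum f r ≤ psum g r) (htot : ∑ i, f i = ∑ i, g i)
    (hnorm : ∑ i, f i ^ 2 = ∑ i, g i ^ 2) : f = g := by
  rcases Nat.eq_zero_or_pos N with rfl | hN
  · funext i; exact i.elim0
  obtain ⟨n, rfl⟩ : ∃ n, N = n + 1 := ⟨N - 1, by omega⟩
  let F : ℕ → ℤ := fun i => if h : i < n + 1 then (f ⟨i, h⟩ : ℤ) else 0
  let G : ℕ → ℤ := fun i => if h : i < n + 1 then (g ⟨i, h⟩ : ℤ) else 0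
  have hFp : ∀ r ≤ n + 1, ∑ i ∈ Finset.range r, F i = (psum f r : ℤ) := by
    intro r hr
    rw [psum_range f r hr]; push_cast
    refine Finset.sum_congr rfl fun i _ => ?_
    simp only [F]; split_ifs <;> simp
  have hGp : ∀ r ≤ n + 1, ∑ i ∈ Finset.range r, G i = (psum g r : ℤ) := by
    intro r hr
    rw [psum_range g r hr]; push_cast
    refine Finset.sum_congr rfl fun i _ => ?_
    simp only [G]; split_ifs <;> simp
  have hab := abel_sum (fun i => G i - F i) (fun i => G i + F i) n
  have hL : ∑ i ∈ Finset.range (n + 1), (G i - F i) * (G i + F i) = 0 := by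
    have : ∀ i, (G i - F i) * (G i + F i) = G i ^ 2 - F i ^ 2 := fun i => by ring
    simp only [this]
    rw [← Fin.sum_univ_eq_sum_range (fun i => G i ^ 2 - F i ^ 2), Finset.sum_sub_distrib]
    simp only [G, F, Fin.is_lt, dite_true, Fin.eta]
    rw [sub_eq_zero]
    exact_mod_cast hnorm.symm
  have hD : ∀ r ≤ n + 1, ∑ i ∈ Finset.range r, (G i - F i) = (psum g r : ℤ) - psum f r := by
    intro r hr; rw [Finset.sum_sub_distrib, hFp r hr, hGp r hr]
  rw [hL, hD _ le_rfl, psum_top, psum_top, htot, sub_self, zero_mul, zero_add] at hab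
  have hpos : ∀ r ∈ Finset.range n, 0 ≤ (∑ i ∈ Finset.range (r + 1), (G i - F i)) * (G r + F r - (G (r+1) + F (r+1))) ∧
     0 < (G r + F r - (G (r+1) + F (r+1))) := by
    intro r hr
    rw [Finset.mem_range] at hr
    have a1 : f ⟨r + 1, by omega⟩ < f ⟨r, by omega⟩ := hf (by simp [Fin.lt_def])
    have a2 : g ⟨r + 1, by omega⟩ < g ⟨r, by omega⟩ := hg (by simp [Fin.lt_def])
    have h2 : 0 < (G r + F r - (G (r+1) + F (r+1))) := by
      simp only [G, F, dif_pos (show r < n + 1 by omega), dif_pos (show r + 1 < n + 1 by omega)]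
      omega
    refine ⟨mul_nonneg ?_ h2.le, h2⟩
    rw [hD _ (by omega)]
    have := hdom (r + 1)
    omega
  have hz := (Finset.sum_eq_zero_iff_of_nonneg (fun r hr => (hpos r hr).1)).mp hab.symm
  have hps : ∀ r ≤ n + 1, psum g r = psum f r := by
    intro r hr
    rcases Nat.eq_zero_or_pos r with rfl | hr0
    · simp [psum]
    rcases Nat.lt_or_ge r (n + 1) with h | h
    · have h1 := hz (r - 1) (by rw [Finset.mem_range]; omega)
      have h2 := (hpos (r - 1) (by rw [Finset.mem_range]; omega)).2
      have h3 := (mul_eq_zero.mp h1).resolve_right h2.ne'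
      rw [Nat.sub_add_cancel hr0, hD r hr] at h3
      omega
    · have : r = n + 1 := by omega
      rw [this, psum_top, psum_top, htot]
  funext i
  have h1 := psum_succ f i
  have h2 := psum_succ g i
  have h3 := hps i (by omega)
  have h4 := hps (i + 1) (by omega)
  omega



section Weyl
variable {K : Type*} [Fintype K] {N : K → ℕ}

/-- The Euler derivation `x_b ∂/∂x_b`. -/
noncomputable def thD (b : Σ k, Fin (N k)) :
    Derivation ℂ (MvPolynomial (Σ k, Fin (N k)) ℂ) (MvPolynomial (Σ k, Fin (N k)) ℂ) :=
  (MvPolynomial.X b : MvPolynomial (Σ k, Fin (N k)) ℂ) • MvPolynomial.pderiv b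

lemma thD_monomial (b : Σ k, Fin (N k)) (s : (Σ k, Fin (N k)) →₀ ℕ) (a : ℂ) :
    thD b (MvPolynomial.monomial s a) = MvPolynomial.monomial s ((s b : ℂ) * a) := by
  unfold thD
  rw [Derivation.smul_apply, smul_eq_mul, MvPolynomial.X_mul_pderiv_monomial,
    MvPolynomial.smul_monomial, nsmul_eq_mul]

lemma thD_coeff (b : Σ k, Fin (N k)) (F : MvPolynomial (Σ k, Fin (N k)) ℂ)
    (μ : (Σ k, Fin (N k)) →₀ ℕ) :
    MvPolynomial.coeff μ (thD b F) = (μ b : ℂ) * MvPolynomial.coeff μ F := by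
  induction F using MvPolynomial.induction_on' with
  | monomial s a =>
    rw [thD_monomial, MvPolynomial.coeff_monomial, MvPolynomial.coeff_monomial]
    split_ifs with h
    · rw [h]
    · simp
  | add p q hp hq => rw [map_add, MvPolynomial.coeff_add, hp, hq, MvPolynomial.coeff_add, mul_add]

lemma thD_X (b c : Σ k, Fin (N k)) :
    thD b (MvPolynomial.X c) = if c = b then MvPolynomial.X b else 0 := by
  unfold thD
  rw [Derivation.smul_apply, smul_eq_mul, MvPolynomial.pderiv_X]
  by_cases h : c = b
  · subst h; simp
  · simp [h, Pi.single_apply]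

/-- product of alternants over the blocks -/
noncomputable def aProd (L : (Σ k, Fin (N k)) → ℕ) : MvPolynomial (Σ k, Fin (N k)) ℂ :=
  ∏ k, altGen (N k) (fun i => L ⟨k, i⟩) (fun i => MvPolynomial.X ⟨k, i⟩)

/-- precomposition by a blockwise permutation -/
noncomputable def bperm (L : (Σ k, Fin (N k)) → ℕ) (u : ∀ k, Equiv.Perm (Fin (N k))) :
    (Σ k, Fin (N k)) →₀ ℕ :=
  Finsupp.equivFunOnFinite.symm fun b => L ⟨b.1, u b.1 b.2⟩

noncomputable def bsgn (u : ∀ k, Equiv.Perm (Fin (N k))) : ℂ :=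
  ∏ k, ((Equiv.Perm.sign (u k) : ℤ) : ℂ)

lemma aProd_expand (L : (Σ k, Fin (N k)) → ℕ) :
    aProd L = ∑ u : ∀ k, Equiv.Perm (Fin (N k)), MvPolynomial.monomial (bperm L u) (bsgn u) := by
  unfold aProd altGen
  simp only [Matrix.det_apply, Matrix.of_apply]
  rw [Finset.prod_univ_sum, Fintype.piFinset_univ]
  refine Finset.sum_congr rfl fun u _ => ?_
  rw [MvPolynomial.monomial_eq, Finsupp.prod_fintype _ _ (fun i => pow_zero _),
    Fintype.prod_sigma, bsgn, map_prod, ← Finset.prod_mul_distrib]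
  refine Finset.prod_congr rfl fun k _ => ?_
  rw [Units.smul_def, zsmul_eq_mul]
  simp [bperm]

lemma bsgn_sq (u : ∀ k, Equiv.Perm (Fin (N k))) : bsgn u * bsgn u = 1 := by
  unfold bsgn
  rw [← Finset.prod_mul_distrib]
  apply Finset.prod_eq_one
  intro k _
  rcases Int.units_eq_one_or (Equiv.Perm.sign (u k)) with h | h <;> simp [h]

lemma aProd_anti (L : (Σ k, Fin (N k)) → ℕ) (u : ∀ k, Equiv.Perm (Fin (N k))) :
    MvPolynomial.rename (Equiv.sigmaCongrRight u) (aProd L) = MvPolynomial.C (bsgn u) * aProd L := by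
  unfold aProd bsgn
  rw [map_prod, map_prod, ← Finset.prod_mul_distrib]
  refine Finset.prod_congr rfl fun k _ => ?_
  unfold altGen
  rw [AlgHom.map_det]
  have : (MvPolynomial.rename (Equiv.sigmaCongrRight u)).mapMatrix
      (Matrix.of fun (i : Fin (N k)) (l : Fin (N k)) =>
        (MvPolynomial.X (⟨k, l⟩ : Σ k, Fin (N k)) : MvPolynomial (Σ k, Fin (N k)) ℂ) ^ L ⟨k, i⟩)
    = (Matrix.of fun (i : Fin (N k)) (l : Fin (N k)) =>
        (MvPolynomial.X (⟨k, l⟩ : Σ k, Fin (N k)) : MvPolynomial (Σ k, Fin (N k)) ℂ) ^ L ⟨k, i⟩).submatrix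
          id (u k) := by
    ext1 i l
    simp [Equiv.sigmaCongrRight]
  rw [this, Matrix.det_permute']
  simp

lemma coeff_anti (G : MvPolynomial (Σ k, Fin (N k)) ℂ)
    (hG : ∀ u : ∀ k, Equiv.Perm (Fin (N k)),
      MvPolynomial.rename (Equiv.sigmaCongrRight u) G = MvPolynomial.C (bsgn u) * G)
    (u : ∀ k, Equiv.Perm (Fin (N k))) (μ : (Σ k, Fin (N k)) →₀ ℕ) :
    MvPolynomial.coeff μ G = bsgn u * MvPolynomial.coeff (bperm μ u) G := by
  have h1 := congrArg (MvPolynomial.coeff μ) (hG u)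
  rw [MvPolynomial.coeff_C_mul] at h1
  have h2 : (bperm μ u).mapDomain (Equiv.sigmaCongrRight u) = μ := by
    ext b
    rw [← Finsupp.equivMapDomain_eq_mapDomain, Finsupp.equivMapDomain_apply]
    simp [bperm, Equiv.sigmaCongrRight]
  have h3 := MvPolynomial.coeff_rename_mapDomain (Equiv.sigmaCongrRight u)
    (Equiv.injective _) G (bperm μ u)
  rw [h2, h1] at h3
  rw [← h3, ← mul_assoc, bsgn_sq, one_mul]

lemma anti_zero (G : MvPolynomial (Σ k, Fin (N k)) ℂ)
    (hG : ∀ u : ∀ k, Equiv.Perm (Fin (N k)),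
      MvPolynomial.rename (Equiv.sigmaCongrRight u) G = MvPolynomial.C (bsgn u) * G)
    (h0 : ∀ μ : (Σ k, Fin (N k)) →₀ ℕ, (∀ k, StrictAnti fun i => μ ⟨k, i⟩) →
      MvPolynomial.coeff μ G = 0) : G = 0 := by
  ext μ
  rw [MvPolynomial.coeff_zero]
  by_cases hinj : ∀ k, Function.Injective fun i => μ ⟨k, i⟩
  · have hs : ∀ k, ∃ u : Equiv.Perm (Fin (N k)), StrictAnti fun i => μ ⟨k, u i⟩ := by
      intro k
      refine ⟨Tuple.sort (fun i => OrderDual.toDual (μ ⟨k, i⟩)), ?_⟩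
      have hm : Monotone _ := Tuple.monotone_sort (fun i => OrderDual.toDual (μ ⟨k, i⟩))
      have hs := hm.strictMono_of_injective (by
        intro a b hab
        exact (Tuple.sort _).injective (hinj k (OrderDual.toDual.injective hab)))
      intro a b hab
      exact hs hab
    choose u hu using hs
    rw [coeff_anti G hG u μ, h0 _ (fun k => by simpa [bperm] using hu k), mul_zero]
  · push Not at hinj
    obtain ⟨k, hk⟩ := hinj
    unfold Function.Injective at hk
    push Not at hk
    obtain ⟨i, l, hil, hne⟩ := hk
    let u : ∀ k, Equiv.Perm (Fin (N k)) := Function.update 1 k (Equiv.swap i l)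
    have h1 : bperm μ u = μ := by
      ext ⟨k', x⟩
      simp only [bperm, Finsupp.equivFunOnFinite_symm_apply_apply, u]
      by_cases hk' : k' = k
      · subst hk'
        simp only [Function.update_self]
        rcases Equiv.swap_apply_def i l x with h
        by_cases hx : x = i
        · subst hx; simpa using hil.symm
        · by_cases hx' : x = l
          · subst hx'; simpa using hil
          · rw [Equiv.swap_apply_of_ne_of_ne hx hx']
      · simp [Function.update_of_ne hk']
    have h2 : bsgn u = -1 := by
      unfold bsgn
      rw [Finset.prod_eq_single k]
      · simp [u, Equiv.Perm.sign_swap hne]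
      · intro b _ hb; simp [u, Function.update_of_ne hb]
      · simp
    have h3 := coeff_anti G hG u μ
    rw [h1, h2] at h3
    linear_combination h3 / 2

lemma perm_eq_one {n : ℕ} (L : Fin n → ℕ) (hL : StrictAnti L) (u : Equiv.Perm (Fin n))
    (h : StrictAnti fun i => L (u i)) : u = 1 := by
  have hu : StrictMono u := by
    intro a b hab
    exact hL.lt_iff_gt.mp (h hab)
  have := (StrictMono.range_inj hu strictMono_id).mp (by simp)
  ext i; simp [this]

lemma aProd_coeff (L : (Σ k, Fin (N k)) → ℕ) (hL : ∀ k, StrictAnti fun i => L ⟨k, i⟩)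
    (ν : (Σ k, Fin (N k)) →₀ ℕ) (hν : ∀ k, StrictAnti fun i => ν ⟨k, i⟩) :
    MvPolynomial.coeff ν (aProd L) = if ⇑ν = L then 1 else 0 := by
  rw [aProd_expand, MvPolynomial.coeff_sum]
  simp only [MvPolynomial.coeff_monomial]
  rw [Finset.sum_eq_single 1]
  · have : bperm L 1 = ν ↔ ⇑ν = L := by
      constructor
      · rintro rfl; rfl
      · intro h; ext b; simp [bperm, h]
    simp [this, bsgn]
  · intro u _ hu
    rw [if_neg]
    intro h
    apply hu
    funext k
    apply perm_eq_one _ (hL k)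
    have := hν k
    rw [← h] at this
    simpa [bperm] using this
  · simp

end Weyl


section Weyl
variable {K : Type*} [Fintype K] {N : K → ℕ}

/-- the staircase -/
def dlt (b : Σ k, Fin (N k)) : ℕ := N b.1 - 1 - b.2.val

lemma dlt_anti (k : K) : StrictAnti fun i => dlt (N := N) ⟨k, i⟩ := by
  intro a b hab
  have : a.val < b.val := hab
  have := b.isLt
  simp only [dlt]; omega

lemma aProd_quot (k : K) : ∃ Q : Fin (N k) → Fin (N k) → MvPolynomial (Σ k, Fin (N k)) ℂ,
    (∀ i j, i ≠ j → Q i j * (MvPolynomial.X ⟨k, i⟩ - MvPolynomial.X ⟨k, j⟩) = aProd dlt) ∧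
    (∀ i j, i ≠ j → Q j i = - Q i j) ∧
    ∀ i, thD ⟨k, i⟩ (aProd (dlt (N := N))) =
      ∑ j, if i ≠ j then Q i j * MvPolynomial.X ⟨k, i⟩ else 0 := by
  obtain ⟨Q, h1, h2, h3⟩ := alt_quot (R := ℂ) (N k)
    (fun i => (MvPolynomial.X ⟨k, i⟩ : MvPolynomial (Σ k, Fin (N k)) ℂ))
  set rest : MvPolynomial (Σ k, Fin (N k)) ℂ := ∏ k' ∈ Finset.univ.erase k,
    altGen (N k') (fun i => dlt (N := N) ⟨k', i⟩) (fun i => MvPolynomial.X ⟨k', i⟩) with hrest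
  have ha : aProd (dlt (N := N)) = altGen (N k) (fun i => N k - 1 - i)
     (fun i => (MvPolynomial.X ⟨k, i⟩ : MvPolynomial (Σ k, Fin (N k)) ℂ)) * rest := by
    unfold aProd
    rw [← Finset.mul_prod_erase _ _ (Finset.mem_univ k)]
    rfl
  refine ⟨fun i j => Q i j * rest, ?_, ?_, ?_⟩
  · intro i j hij
    rw [ha, ← h1 i j hij]; ring
  · intro i j hij
    simp only [h2 i j hij]; ring
  · intro i
    have hr : thD ⟨k, i⟩ rest = 0 := by
      rw [hrest, deriv_prod]
      apply Finset.sum_eq_zero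
      intro k' hk'
      obtain ⟨Q', -, -, h3'⟩ := alt_quot (R := ℂ) (N k')
        (fun i => (MvPolynomial.X ⟨k', i⟩ : MvPolynomial (Σ k, Fin (N k)) ℂ))
      have := h3' (thD ⟨k, i⟩)
      have h0 : thD ⟨k, i⟩ (altGen (N k') (fun i => dlt (N := N) ⟨k', i⟩)
        (fun i => (MvPolynomial.X ⟨k', i⟩ : MvPolynomial (Σ k, Fin (N k)) ℂ))) = 0 := by
        refine this.trans ?_
        apply Finset.sum_eq_zero
        intro a _
        apply Finset.sum_eq_zero
        intro b _
        rw [thD_X, if_neg (c := _ = (⟨k, i⟩ : Σ k, Fin (N k)))]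
        · simp
        · intro h
          have := congrArg Sigma.fst h
          simp at this hk'
          exact hk' this
      rw [h0, mul_zero]
    rw [ha, Derivation.leibniz, hr, h3, smul_zero, zero_add, smul_eq_mul, Finset.mul_sum]
    rw [Finset.sum_eq_single i]
    · rw [Finset.mul_sum]
      refine Finset.sum_congr rfl fun j _ => ?_
      rw [thD_X, if_pos rfl]
      split_ifs <;> ring
    · intro a _ hai
      rw [Finset.sum_eq_zero]
      · simp
      · intro b _
        rw [thD_X, if_neg (c := _ = (⟨k, i⟩ : Σ k, Fin (N k)))]
        · simp
        · intro h
          simp at h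
          exact hai h
    · simp

lemma aProd_D2 (k : K) : ∑ i, thD ⟨k, i⟩ (thD ⟨k, i⟩ (aProd (dlt (N := N)))) =
    (∑ i, (dlt (N := N) ⟨k, i⟩ : ℂ) ^ 2) • aProd (dlt (N := N)) := by
  rw [aProd_expand]
  simp only [map_sum, thD_monomial]
  rw [Finset.sum_comm, Finset.smul_sum]
  refine Finset.sum_congr rfl fun u _ => ?_
  rw [← map_sum, MvPolynomial.smul_monomial]
  congr 1
  simp only [← mul_assoc, ← Finset.sum_mul, smul_eq_mul]
  congr 1
  rw [← Equiv.sum_comp (u k) (fun i => (dlt (N := N) ⟨k, i⟩ : ℂ) ^ 2)]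
  refine Finset.sum_congr rfl fun i _ => ?_
  simp [bperm, sq]

lemma cas_id {n : ℕ} (lam : Fin n → ℕ) :
    (∑ i, (lam i : ℂ) ^ 2 + ∑ i, ∑ j, (if i < j then (lam i : ℂ) - lam j else 0)) +
      (∑ i : Fin n, ((n - 1 - i.val : ℕ) : ℂ) ^ 2) + ((n : ℂ) - 1) * ∑ i, (lam i : ℂ) =
    ∑ i : Fin n, ((lam i + (n - 1 - i.val) : ℕ) : ℂ) ^ 2 := by
  have h1 : ∑ i, ∑ j, (if i < j then (lam i : ℂ) - lam j else 0) =
      ∑ i : Fin n, (lam i : ℂ) * ((n - 1 - i.val : ℕ) : ℂ) - ∑ i : Fin n, (lam i : ℂ) * (i.val : ℂ) := by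
    have : ∀ i j : Fin n, (if i < j then (lam i : ℂ) - lam j else 0) =
      (if i < j then (lam i : ℂ) else 0) - (if i < j then (lam j : ℂ) else 0) := by
      intro i j; split_ifs <;> simp
    simp only [this, Finset.sum_sub_distrib]
    congr 1
    · refine Finset.sum_congr rfl fun i _ => ?_
      rw [← Finset.sum_filter, Finset.sum_const, nsmul_eq_mul, mul_comm]
      have : (Finset.univ.filter fun j => i < j) = Finset.Ioi i := by ext; simp
      rw [this, Fin.card_Ioi]
    · rw [Finset.sum_comm]
      refine Finset.sum_congr rfl fun i _ => ?_
      rw [← Finset.sum_filter, Finset.sum_const, nsmul_eq_mul, mul_comm]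
      have : (Finset.univ.filter fun j => j < i) = Finset.Iio i := by ext; simp
      rw [this, Fin.card_Iio]
  rw [h1, Finset.mul_sum, ← Finset.sum_sub_distrib, ← Finset.sum_add_distrib,
    ← Finset.sum_add_distrib, ← Finset.sum_add_distrib]
  refine Finset.sum_congr rfl fun i _ => ?_
  have := i.isLt
  have e1 : ((n - 1 - i.val : ℕ) : ℂ) = n - 1 - i.val := by
    rw [Nat.cast_sub (by omega), Nat.cast_sub (by omega)]; simp
  rw [Nat.cast_add, e1]
  ring

theorem weyl (F : MvPolynomial (Σ k, Fin (N k)) ℂ) (lam : (Σ k, Fin (N k)) →₀ ℕ)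
    (hlam : ∀ k, Antitone fun i => lam ⟨k, i⟩)
    (hdom : ∀ β, MvPolynomial.coeff β F ≠ 0 →
      ∀ k r, psum (fun i => β ⟨k, i⟩) r ≤ psum (fun i => lam ⟨k, i⟩) r)
    (htot : ∀ β, MvPolynomial.coeff β F ≠ 0 → ∀ k, ∑ i, β ⟨k, i⟩ = ∑ i, lam ⟨k, i⟩)
    (hsym : ∀ u : ∀ k, Equiv.Perm (Fin (N k)),
      MvPolynomial.rename (Equiv.sigmaCongrRight u) F = F)
    (S : ∀ k, Fin (N k) → Fin (N k) → MvPolynomial (Σ k, Fin (N k)) ℂ)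
    (hS : ∀ k i j, i ≠ j → (MvPolynomial.X ⟨k, i⟩ - MvPolynomial.X ⟨k, j⟩) * S k i j =
      MvPolynomial.X ⟨k, i⟩ * (thD ⟨k, i⟩ F - thD ⟨k, j⟩ F))
    (hC : ∀ k, ∑ i, thD ⟨k, i⟩ (thD ⟨k, i⟩ F) + ∑ i, ∑ j, (if i ≠ j then S k i j else 0) =
      (∑ i, (lam ⟨k, i⟩ : ℂ) ^ 2 +
        ∑ i, ∑ j, (if i < j then (lam ⟨k, i⟩ : ℂ) - lam ⟨k, j⟩ else 0)) • F) :
    F = MvPolynomial.C (MvPolynomial.coeff lam F) *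
      ∏ k, schurGen (N k) (fun i => lam ⟨k, i⟩) (fun i => MvPolynomial.X ⟨k, i⟩) := by
  set L : (Σ k, Fin (N k)) → ℕ := fun b => lam b + dlt b with hLdef
  have hL : ∀ k, StrictAnti fun i => L ⟨k, i⟩ := by
    intro k a b hab
    have h1 := hlam k hab.le
    have h2 := dlt_anti (N := N) k hab
    simp only [L] at *; omega
  have hnorm : ∀ ν, MvPolynomial.coeff ν (aProd dlt * F) ≠ 0 →
      ∀ k, ∑ i, (ν ⟨k, i⟩) ^ 2 = ∑ i, (L ⟨k, i⟩) ^ 2 := by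
    intro ν hν k
    obtain ⟨Q, q1, q2, q3⟩ := aProd_quot (N := N) k
    have hg : ∑ i, thD ⟨k, i⟩ F = (∑ i, (lam ⟨k, i⟩ : ℂ)) • F := by
      ext β
      rw [MvPolynomial.coeff_sum, MvPolynomial.coeff_smul]
      simp only [thD_coeff, ← Finset.sum_mul, smul_eq_mul]
      by_cases h : MvPolynomial.coeff β F = 0
      · simp [h]
      · have := htot β h k
        congr 1
        exact_mod_cast this
    have := pde (N k) (fun i => (MvPolynomial.X ⟨k, i⟩ : MvPolynomial (Σ k, Fin (N k)) ℂ))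
      (fun i => thD ⟨k, i⟩) (aProd dlt) Q q1 q2 q3 F (S k) (hS k) _ _ _ (hC k) hg (aProd_D2 k)
    have h2 := congrArg (MvPolynomial.coeff ν) this
    rw [MvPolynomial.coeff_sum, MvPolynomial.coeff_smul] at h2
    simp only [thD_coeff, ← mul_assoc, ← Finset.sum_mul, smul_eq_mul] at h2
    have h3 := mul_right_cancel₀ hν h2
    have h4 := cas_id (fun i => lam ⟨k, i⟩)
    simp only [dlt] at h3
    rw [h4] at h3
    have h5 : ((∑ i, (ν ⟨k, i⟩) ^ 2 : ℕ) : ℂ) = ((∑ i, (L ⟨k, i⟩) ^ 2 : ℕ) : ℂ) := by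
      push_cast
      rw [← Nat.cast_sum] at *
      simp only [sq, L, dlt] at h3 ⊢
      push_cast at h3 ⊢
      exact h3
    exact_mod_cast h5
  have hexp : ∀ ν, MvPolynomial.coeff ν (aProd dlt * F) =
      ∑ u : ∀ k, Equiv.Perm (Fin (N k)), if bperm dlt u ≤ ν then
        bsgn u * MvPolynomial.coeff (ν - bperm dlt u) F else 0 := by
    intro ν
    rw [aProd_expand, Finset.sum_mul, MvPolynomial.coeff_sum]
    refine Finset.sum_congr rfl fun u _ => ?_
    rw [MvPolynomial.coeff_monomial_mul']
  have hsub : ∀ (ν : (Σ k, Fin (N k)) →₀ ℕ) (u : ∀ k, Equiv.Perm (Fin (N k))), bperm dlt u ≤ ν →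
      ∀ k i, ν ⟨k, i⟩ = (ν - bperm dlt u) ⟨k, i⟩ + dlt (N := N) ⟨k, u k i⟩ := by
    intro ν u hu k i
    have := hu ⟨k, i⟩
    simp only [bperm, Finsupp.equivFunOnFinite_symm_apply_apply, Finsupp.tsub_apply] at this ⊢
    omega
  have hmain : aProd dlt * F - MvPolynomial.C (MvPolynomial.coeff lam F) * aProd L = 0 := by
    apply anti_zero
    · intro u
      rw [map_sub, map_mul, map_mul, aProd_anti, aProd_anti, hsym, MvPolynomial.rename_C]
      ring
    · intro ν hν
      rw [MvPolynomial.coeff_sub, MvPolynomial.coeff_C_mul, aProd_coeff L hL ν hν]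
      by_cases hνL : ⇑ν = L
      · rw [if_pos hνL, mul_one, sub_eq_zero, hexp, Finset.sum_eq_single 1]
        · have e0 : bperm (dlt (N := N)) 1 ≤ ν := by
            intro b; simp [bperm, hνL, L]
          have e1 : ν - bperm dlt 1 = lam := by
            ext b
            simp [bperm, hνL, L]
          rw [if_pos e0, e1]
          simp [bsgn]
        · intro u _ hu
          split_ifs with hle
          · by_cases hz : MvPolynomial.coeff (ν - bperm dlt u) F = 0
            · rw [hz, mul_zero]
            exfalso
            apply hu
            funext k
            apply perm_eq_one _ (dlt_anti (N := N) k)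
            have : (fun i => dlt (N := N) ⟨k, u k i⟩) = fun i => dlt (N := N) ⟨k, i⟩ := by
              apply eq_of_psum
              intro r
              have a1 := hdom _ hz k r
              have a2 := psum_perm_le (fun i => dlt (N := N) ⟨k, i⟩) (dlt_anti k).antitone (u k) r
              have a3 := psum_add (fun i => (ν - bperm dlt u) ⟨k, i⟩) (fun i => dlt (N := N) ⟨k, u k i⟩) r
              have a4 := psum_add (fun i => lam ⟨k, i⟩) (fun i => dlt (N := N) ⟨k, i⟩) r
              have a5 : (fun i => (ν - bperm dlt u) ⟨k, i⟩ + dlt (N := N) ⟨k, u k i⟩) =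
                fun i => lam ⟨k, i⟩ + dlt (N := N) ⟨k, i⟩ := by
                funext i
                rw [← hsub ν u hle k i, hνL]
              rw [a5] at a3
              omega
            rw [this]
            exact dlt_anti k
          · rfl
        · simp
      · rw [if_neg hνL, mul_zero, sub_zero]
        by_contra hne
        apply hνL
        have hn := hnorm ν hne
        have hex : ∃ u : ∀ k, Equiv.Perm (Fin (N k)), bperm dlt u ≤ ν ∧
            MvPolynomial.coeff (ν - bperm dlt u) F ≠ 0 := by
          by_contra hcon
          push Not at hcon
          apply hne
          rw [hexp]
          apply Finset.sum_eq_zero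
          intro u _
          split_ifs with h
          · rw [hcon u h, mul_zero]
          · rfl
        obtain ⟨u, hle, hz⟩ := hex
        have hk : ∀ k, (fun i => ν ⟨k, i⟩) = fun i => L ⟨k, i⟩ := by
          intro k
          have a5 : (fun i => ν ⟨k, i⟩) =
              fun i => (ν - bperm dlt u) ⟨k, i⟩ + dlt (N := N) ⟨k, u k i⟩ := by
            funext i; exact hsub ν u hle k i
          apply eq_of_dom_norm _ _ (hν k) (hL k) _ _ (hn k)
          · intro r
            have a1 := hdom _ hz k r
            have a2 := psum_perm_le (fun i => dlt (N := N) ⟨k, i⟩) (dlt_anti k).antitone (u k) r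
            have a3 := psum_add (fun i => (ν - bperm dlt u) ⟨k, i⟩) (fun i => dlt (N := N) ⟨k, u k i⟩) r
            have a4 := psum_add (fun i => lam ⟨k, i⟩) (fun i => dlt (N := N) ⟨k, i⟩) r
            rw [a5, a3]
            refine le_trans ?_ a4.symm.le
            omega
          · rw [a5]
            simp only [L, Finset.sum_add_distrib]
            rw [htot _ hz k, Equiv.sum_comp (u k) (fun i => dlt (N := N) ⟨k, i⟩)]
        funext ⟨k, i⟩
        exact congrFun (hk k) i
  have hL2 : aProd L = (∏ k, schurGen (N k) (fun i => lam ⟨k, i⟩) (fun i => MvPolynomial.X ⟨k, i⟩)) *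
      aProd (dlt (N := N)) := by
    unfold aProd
    rw [← Finset.prod_mul_distrib]
    refine Finset.prod_congr rfl fun k _ => ?_
    exact alt_eq_schur ..
  have hne : aProd (dlt (N := N)) ≠ 0 := by
    intro h
    have := aProd_coeff (dlt (N := N)) dlt_anti (Finsupp.equivFunOnFinite.symm dlt)
      (by intro k; simpa using dlt_anti k)
    rw [h] at this
    simp at this
  apply mul_left_cancel₀ hne
  rw [sub_eq_zero] at hmain
  rw [hmain, hL2]
  ring

end Weyl


section Tens
variable {B : Type*} [Fintype B] {n : ℕ}

/-- tensor product of a family of matrices -/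
noncomputable def tF : MultilinearMap ℂ (fun _ : Fin n => Matrix B B ℂ)
    (Matrix (Fin n → B) (Fin n → B) ℂ) where
  toFun g := Matrix.of fun b' b => ∏ s, g s (b' s) (b s)
  map_update_add' g s x y := by
    ext b' b
    simp only [Matrix.of_apply, Matrix.add_apply]
    rw [← Finset.mul_prod_erase _ _ (Finset.mem_univ s), ← Finset.mul_prod_erase _ _ (Finset.mem_univ s),
      ← Finset.mul_prod_erase _ _ (Finset.mem_univ s)]
    simp only [Function.update_self, Matrix.add_apply, add_mul]
    congr 2 <;>
    · refine Finset.prod_congr rfl fun t ht => ?_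
      simp [Function.update_of_ne (Finset.ne_of_mem_erase ht)]
  map_update_smul' g s a x := by
    ext b' b
    simp only [Matrix.of_apply, Matrix.smul_apply]
    rw [← Finset.mul_prod_erase _ _ (Finset.mem_univ s), ← Finset.mul_prod_erase _ _ (Finset.mem_univ s)]
    simp only [Function.update_self, Matrix.smul_apply, smul_eq_mul, mul_assoc]
    congr 2
    · refine Finset.prod_congr rfl fun t ht => ?_
      simp [Function.update_of_ne (Finset.ne_of_mem_erase ht)]

lemma tF_apply (g : Fin n → Matrix B B ℂ) (b' b : Fin n → B) :
    tF g b' b = ∏ s, g s (b' s) (b s) := rfl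

lemma tF_mul (g h : Fin n → Matrix B B ℂ) : tF g * tF h = tF (g * h) := by
  ext b' b
  rw [Matrix.mul_apply, tF_apply]
  simp only [tF_apply, Pi.mul_apply, Matrix.mul_apply, ← Finset.prod_mul_distrib]
  rw [Finset.prod_univ_sum, Fintype.piFinset_univ]

lemma tF_one : tF (1 : Fin n → Matrix B B ℂ) = 1 := by
  ext b' b
  rw [tF_apply]
  by_cases h : b' = b
  · subst h; simp
  · rw [Matrix.one_apply_ne h]
    obtain ⟨s, hs⟩ := Function.ne_iff.mp h
    exact Finset.prod_eq_zero (Finset.mem_univ s) (by simp [Matrix.one_apply_ne hs])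

/-- `g ⊗ ⋯ ⊗ g` -/
noncomputable def tP (g : Matrix B B ℂ) : Matrix (Fin n → B) (Fin n → B) ℂ := tF (fun _ => g)

lemma tP_mul (g h : Matrix B B ℂ) : tP (n := n) g * tP h = tP (g * h) := tF_mul _ _

lemma tP_one : tP (n := n) (1 : Matrix B B ℂ) = 1 := tF_one

lemma tP_pow (g : Matrix B B ℂ) (i : ℕ) : tP (n := n) g ^ i = tP (g ^ i) := by
  induction i with
  | zero => simp [tP_one]
  | succ i ih => rw [pow_succ, pow_succ, ih, tP_mul]

/-- the derivation action of a matrix -/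
noncomputable def hat (X : Matrix B B ℂ) : Matrix (Fin n → B) (Fin n → B) ℂ :=
  ∑ s, tF (Function.update 1 s X)

lemma hat_add (X Y : Matrix B B ℂ) : hat (n := n) (X + Y) = hat X + hat Y := by
  simp [hat, Finset.sum_add_distrib]

lemma hat_smul (a : ℂ) (X : Matrix B B ℂ) : hat (n := n) (a • X) = a • hat X := by
  simp [hat, Finset.smul_sum]

/-- `hat` as a linear map -/
noncomputable def hatL : Matrix B B ℂ →ₗ[ℂ] Matrix (Fin n → B) (Fin n → B) ℂ where
  toFun := hat
  map_add' := hat_add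
  map_smul' := hat_smul

lemma hatL_apply (X : Matrix B B ℂ) : hatL (n := n) X = hat X := rfl

lemma upd_mul_same (s : Fin n) (X Y : Matrix B B ℂ) (g h : Fin n → Matrix B B ℂ) :
    Function.update g s X * Function.update h s Y = Function.update (g * h) s (X * Y) := by
  funext t
  by_cases h : t = s
  · subst h; simp
  · simp [Function.update_of_ne h]

lemma hat_comm (X Y : Matrix B B ℂ) :
    hat (n := n) X * hat Y = hat Y * hat X + hat (X * Y - Y * X) := by
  have key : ∀ X Y : Matrix B B ℂ, hat (n := n) X * hat Y =
      (∑ s, ∑ t, if s = t then 0 else tF (Function.update (1 : Fin n → Matrix B B ℂ) s X * Function.update (1 : Fin n → Matrix B B ℂ) t Y)) +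
        hat (X * Y) := by
    intro X Y
    unfold hat
    rw [Finset.sum_mul_sum, ← Finset.sum_add_distrib]
    refine Finset.sum_congr rfl fun s _ => ?_
    simp only [tF_mul]
    rw [← Finset.add_sum_erase _ _ (Finset.mem_univ s),
      ← Finset.add_sum_erase (a := s) _ (fun t => if s = t then (0 : Matrix (Fin n → B) (Fin n → B) ℂ) else _) (Finset.mem_univ s)]
    rw [upd_mul_same, mul_one, if_pos rfl, zero_add, add_comm]
    congr 1
    refine Finset.sum_congr rfl fun t ht => ?_
    rw [if_neg (Finset.ne_of_mem_erase ht).symm]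
  rw [key X Y, key Y X]
  have e1 : (∑ s : Fin n, ∑ t, if s = t then (0 : Matrix (Fin n → B) (Fin n → B) ℂ)
        else tF (Function.update (1 : Fin n → Matrix B B ℂ) s X * Function.update (1 : Fin n → Matrix B B ℂ) t Y)) =
      ∑ s : Fin n, ∑ t, if s = t then 0 else tF (Function.update (1 : Fin n → Matrix B B ℂ) s Y * Function.update (1 : Fin n → Matrix B B ℂ) t X) := by
    rw [Finset.sum_comm]
    refine Finset.sum_congr rfl fun s _ => Finset.sum_congr rfl fun t _ => ?_
    by_cases h : s = t
    · subst h; simp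
    · rw [if_neg h, if_neg (Ne.symm h)]
      congr 1
      funext r
      by_cases h1 : r = s
      · subst h1; simp [Function.update_of_ne h]
      · simp [Function.update_of_ne h1]
  have e2 : hat (n := n) (X * Y) = hat (Y * X) + hat (X * Y - Y * X) := by
    rw [← hat_add]; congr 1; abel
  rw [e1, e2, add_assoc]

/-- elementary symmetric type operators -/
noncomputable def eK (k : ℕ) (X : Matrix B B ℂ) : Matrix (Fin n → B) (Fin n → B) ℂ :=
  ∑ S ∈ Finset.powersetCard k (Finset.univ : Finset (Fin n)), tF (S.piecewise (fun _ => X) 1)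

noncomputable def eY (k : ℕ) (Y X : Matrix B B ℂ) : Matrix (Fin n → B) (Fin n → B) ℂ :=
  ∑ S ∈ Finset.powersetCard k (Finset.univ : Finset (Fin n)), ∑ s ∈ Sᶜ,
    tF (Function.update (S.piecewise (fun _ => X) 1) s Y)

lemma sum_erase_reindex {A : Type*} [AddCommMonoid A] (k : ℕ)
    (f : Finset (Fin n) → Fin n → A) :
    ∑ S ∈ Finset.powersetCard (k + 1) (Finset.univ : Finset (Fin n)), ∑ s ∈ S, f (S.erase s) s =
    ∑ S ∈ Finset.powersetCard k (Finset.univ : Finset (Fin n)), ∑ s ∈ Sᶜ, f S s := by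
  rw [Finset.sum_sigma', Finset.sum_sigma']
  refine Finset.sum_bij' (fun x _ => ⟨x.1.erase x.2, x.2⟩) (fun x _ => ⟨insert x.2 x.1, x.2⟩) ?_ ?_ ?_ ?_ ?_
  · rintro ⟨S, s⟩ h
    simp only [Finset.mem_sigma, Finset.mem_powersetCard, Finset.subset_univ, true_and] at h ⊢
    refine ⟨?_, by simp⟩
    rw [Finset.card_erase_of_mem h.2, h.1]; rfl
  · rintro ⟨S, s⟩ h
    simp only [Finset.mem_sigma, Finset.mem_powersetCard, Finset.subset_univ, true_and, Finset.mem_compl] at h ⊢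
    refine ⟨?_, by simp⟩
    rw [Finset.card_insert_of_notMem h.2, h.1]
  · rintro ⟨S, s⟩ h
    simp only [Finset.mem_sigma] at h
    simp [Finset.insert_erase h.2]
  · rintro ⟨S, s⟩ h
    simp only [Finset.mem_sigma, Finset.mem_compl] at h
    simp [Finset.erase_insert h.2]
  · rintro ⟨S, s⟩ h; rfl

lemma eK_zero (X : Matrix B B ℂ) : eK (n := n) 0 X = 1 := by
  simp [eK, tF_one]

lemma eY_zero (Y X : Matrix B B ℂ) : eY (n := n) 0 Y X = hat Y := by
  simp [eY, hat]

lemma pw_erase (S : Finset (Fin n)) (s : Fin n) (hs : s ∈ S) (X Y : Matrix B B ℂ) :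
    Function.update ((S.erase s).piecewise (fun _ => X) (1 : Fin n → Matrix B B ℂ)) s Y =
      Function.update (S.piecewise (fun _ => X) 1) s Y := by
  funext t
  by_cases h : t = s
  · subst h; simp
  · simp [Function.update_of_ne h, Finset.piecewise, h]

lemma eK_succ (k : ℕ) (X : Matrix B B ℂ) :
    ((k + 1 : ℕ) : ℂ) • eK (n := n) (k + 1) X = eY k X X := by
  unfold eY
  rw [← sum_erase_reindex k (fun S s => tF (Function.update (S.piecewise (fun _ => X) 1) s X))]
  unfold eK
  rw [Finset.smul_sum]
  refine Finset.sum_congr rfl fun S hS => ?_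
  rw [Finset.mem_powersetCard] at hS
  rw [Finset.sum_congr rfl (g := fun _ => tF (S.piecewise (fun _ => X) 1))]
  · rw [Finset.sum_const, hS.2, Nat.cast_smul_eq_nsmul]
  · intro s hs
    rw [pw_erase S s hs]
    congr 1
    rw [Function.update_eq_self_iff]
    simp [hs]

lemma hat_eK (k : ℕ) (X Y : Matrix B B ℂ) :
    hat (n := n) Y * eK (k + 1) X = eY (k + 1) Y X + eY k (Y * X) X := by
  unfold eY
  rw [← sum_erase_reindex k (fun S s => tF (Function.update (S.piecewise (fun _ => X) 1) s (Y * X)))]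
  unfold hat eK
  rw [Finset.mul_sum, ← Finset.sum_add_distrib]
  refine Finset.sum_congr rfl fun S hS => ?_
  rw [Finset.sum_mul, ← Finset.sum_compl_add_sum S]
  congr 1
  · refine Finset.sum_congr rfl fun s hs => ?_
    rw [Finset.mem_compl] at hs
    rw [tF_mul]
    congr 1
    funext t
    by_cases h : t = s
    · subst h; simp [hs]
    · simp [Function.update_of_ne h]
  · refine Finset.sum_congr rfl fun s hs => ?_
    rw [pw_erase S s hs, tF_mul]
    congr 1
    funext t
    by_cases h : t = s
    · subst h; simp [hs]
    · simp [Function.update_of_ne h]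

lemma tP_expand (t : ℂ) (X : Matrix B B ℂ) :
    tP (n := n) (1 + t • X) = ∑ k ∈ Finset.range (n + 1), t ^ k • eK k X := by
  unfold tP
  have h0 : (fun _ : Fin n => (1 + t • X)) = (fun _ => t • X) + (1 : Fin n → Matrix B B ℂ) := by
    funext s; simp [add_comm]
  rw [h0, MultilinearMap.map_add_univ]
  have h1 : ∀ S : Finset (Fin n), tF (S.piecewise (fun _ => t • X) 1) =
      t ^ S.card • tF (S.piecewise (fun _ => X) (1 : Fin n → Matrix B B ℂ)) := by
    intro S
    have := (tF (B := B) (n := n)).map_piecewise_smul (fun _ => t) (S.piecewise (fun _ => X) 1) S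
    rw [Finset.prod_const] at this
    rw [← this]
    congr 1
    funext s
    by_cases h : s ∈ S <;> simp [h]
  simp only [h1]
  unfold eK
  rw [← Finset.powerset_univ, Finset.sum_powerset, Finset.card_univ, Fintype.card_fin]
  refine Finset.sum_congr rfl fun k _ => ?_
  rw [Finset.smul_sum]
  refine Finset.sum_congr rfl fun S hS => ?_
  rw [(Finset.mem_powersetCard.mp hS).2]

lemma eK_one (X : Matrix B B ℂ) : eK (n := n) 1 X = hat X := by
  have := eK_succ (n := n) 0 X
  rw [eY_zero] at this
  simpa using this

lemma poly_vec {V : Type*} [AddCommGroup V] [Module ℂ V] (S : Submodule ℂ V) (N : ℕ) (v : ℕ → V)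
    (T : Set ℂ) (hT : T.Infinite) (h : ∀ t ∈ T, ∑ k ∈ Finset.range N, t ^ k • v k ∈ S) :
    ∀ k < N, v k ∈ S := by
  intro k hk
  rw [← Submodule.Quotient.mk_eq_zero, ← Module.forall_dual_apply_eq_zero_iff ℂ]
  intro φ
  let P : Polynomial ℂ := ∑ k ∈ Finset.range N,
    Polynomial.monomial k (φ (Submodule.Quotient.mk (v k)))
  have hP : P = 0 := by
    apply Polynomial.eq_zero_of_infinite_isRoot
    apply hT.mono
    intro t ht
    have h1 := h t ht
    rw [← Submodule.Quotient.mk_eq_zero] at h1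
    have h2 := congrArg φ h1
    change φ (S.mkQ _) = φ 0 at h2
    rw [map_sum, map_sum, map_zero] at h2
    simp only [Set.mem_setOf_eq, Polynomial.IsRoot, P, Polynomial.eval_finset_sum,
      Polynomial.eval_monomial]
    rw [← h2]
    refine Finset.sum_congr rfl fun k _ => ?_
    rw [map_smul, map_smul, smul_eq_mul, mul_comm]
    rfl
  have := congrArg (fun p => Polynomial.coeff p k) hP
  simp only [P, Polynomial.finset_sum_coeff, Polynomial.coeff_monomial, Polynomial.coeff_zero] at this
  rw [Finset.sum_ite_eq_of_mem' _ _ _ (Finset.mem_range.mpr hk)] at this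
  exact this

/-- stability of a submodule under a matrix -/
def Stab (S : Submodule ℂ ((Fin n → B) → ℂ)) (M : Matrix (Fin n → B) (Fin n → B) ℂ) : Prop :=
  ∀ v ∈ S, M.mulVec v ∈ S

lemma Stab.add {S : Submodule ℂ ((Fin n → B) → ℂ)} {M M' : Matrix (Fin n → B) (Fin n → B) ℂ}
    (h : Stab S M) (h' : Stab S M') : Stab S (M + M') := by
  intro v hv; rw [Matrix.add_mulVec]; exact S.add_mem (h v hv) (h' v hv)

lemma Stab.sub {S : Submodule ℂ ((Fin n → B) → ℂ)} {M M' : Matrix (Fin n → B) (Fin n → B) ℂ}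
    (h : Stab S M) (h' : Stab S M') : Stab S (M - M') := by
  intro v hv; rw [Matrix.sub_mulVec]; exact S.sub_mem (h v hv) (h' v hv)

lemma Stab.mul {S : Submodule ℂ ((Fin n → B) → ℂ)} {M M' : Matrix (Fin n → B) (Fin n → B) ℂ}
    (h : Stab S M) (h' : Stab S M') : Stab S (M * M') := by
  intro v hv; rw [← Matrix.mulVec_mulVec]; exact h _ (h' v hv)

lemma Stab.smul {S : Submodule ℂ ((Fin n → B) → ℂ)} {M : Matrix (Fin n → B) (Fin n → B) ℂ}
    (a : ℂ) (h : Stab S M) : Stab S (a • M) := by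
  intro v hv; rw [Matrix.smul_mulVec]; exact S.smul_mem a (h v hv)

lemma Stab.one {S : Submodule ℂ ((Fin n → B) → ℂ)} : Stab S 1 := by
  intro v hv; rwa [Matrix.one_mulVec]

lemma Stab.sum {ι : Type*} {S : Submodule ℂ ((Fin n → B) → ℂ)}
    {M : ι → Matrix (Fin n → B) (Fin n → B) ℂ} (s : Finset ι)
    (h : ∀ i ∈ s, Stab S (M i)) : Stab S (∑ i ∈ s, M i) := by
  intro v hv; rw [Matrix.sum_mulVec]; exact S.sum_mem fun i hi => h i hi v hv

/-- block diagonality -/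
def BD {κ : Type*} (blk : B → κ) (g : Matrix B B ℂ) : Prop := ∀ b b', blk b ≠ blk b' → g b b' = 0

lemma BD.mul {κ : Type*} {blk : B → κ} {g h : Matrix B B ℂ} (hg : BD blk g) (hh : BD blk h) :
    BD blk (g * h) := by
  intro b b' hb
  rw [Matrix.mul_apply]
  apply Finset.sum_eq_zero
  intro c _
  by_cases h1 : blk b = blk c
  · rw [hh c b' (h1 ▸ hb), mul_zero]
  · rw [hg b c h1, zero_mul]

lemma BD.one {κ : Type*} {blk : B → κ} : BD blk (1 : Matrix B B ℂ) := by
  intro b b' hb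
  exact Matrix.one_apply_ne (fun h => hb (h ▸ rfl))

lemma BD.sub {κ : Type*} {blk : B → κ} {g h : Matrix B B ℂ} (hg : BD blk g) (hh : BD blk h) :
    BD blk (g - h) := by
  intro b b' hb
  rw [Matrix.sub_apply, hg b b' hb, hh b b' hb, sub_zero]

lemma BD.add {κ : Type*} {blk : B → κ} {g h : Matrix B B ℂ} (hg : BD blk g) (hh : BD blk h) :
    BD blk (g + h) := by
  intro b b' hb
  rw [Matrix.add_apply, hg b b' hb, hh b b' hb, add_zero]

lemma BD.smul {κ : Type*} {blk : B → κ} {g : Matrix B B ℂ} (a : ℂ) (hg : BD blk g) :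
    BD blk (a • g) := by
  intro b b' hb
  rw [Matrix.smul_apply, hg b b' hb, smul_zero]

lemma stab_eK {κ : Type*} (blk : B → κ) (S : Submodule ℂ ((Fin n → B) → ℂ))
    (hS : ∀ X, BD blk X → Stab S (hat X)) (X : Matrix B B ℂ) (hX : BD blk X) (k : ℕ) :
    Stab S (eK k X) ∧ ∀ Y, BD blk Y → Stab S (eY k Y X) := by
  induction k with
  | zero =>
    refine ⟨by rw [eK_zero]; exact Stab.one, fun Y hY => by rw [eY_zero]; exact hS Y hY⟩
  | succ k ih =>
    have h1 : Stab S (eK (k + 1) X) := by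
      have h2 : eK (n := n) (k + 1) X = ((k + 1 : ℕ) : ℂ)⁻¹ • eY k X X := by
        rw [← eK_succ, smul_smul, inv_mul_cancel₀ (Nat.cast_ne_zero.mpr (Nat.succ_ne_zero k)), one_smul]
      rw [h2]
      exact (ih.2 X hX).smul _
    refine ⟨h1, fun Y hY => ?_⟩
    have h3 : eY (n := n) (k + 1) Y X = hat Y * eK (k + 1) X - eY k (Y * X) X := by
      rw [hat_eK]; abel
    rw [h3]
    exact ((hS Y hY).mul h1).sub (ih.2 _ (hY.mul hX))

lemma stab_tP {κ : Type*} (blk : B → κ) (S : Submodule ℂ ((Fin n → B) → ℂ))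
    (hS : ∀ X, BD blk X → Stab S (hat X)) (g : Matrix B B ℂ) (hg : BD blk g) : Stab S (tP g) := by
  have h1 := tP_expand (n := n) 1 (g - 1)
  rw [one_smul, add_sub_cancel] at h1
  rw [h1]
  refine Stab.sum _ fun k _ => ?_
  rw [one_pow, one_smul]
  exact (stab_eK blk S hS (g - 1) (hg.sub BD.one) k).1

/-- from group to Lie algebra -/
lemma hat_of_tP (S : Submodule ℂ ((Fin n → B) → ℂ)) (X : Matrix B B ℂ) (v : (Fin n → B) → ℂ)
    (T : Set ℂ) (hT : T.Infinite) (h : ∀ t ∈ T, (tP (1 + t • X)).mulVec v ∈ S) (hv : v ∈ S) :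
    (hat X).mulVec v ∈ S := by
  rcases Nat.eq_zero_or_pos n with rfl | hn
  · have : hat (n := 0) X = 0 := by simp [hat]
    rw [this, Matrix.zero_mulVec]; exact S.zero_mem
  have := poly_vec S (n + 1) (fun k => (eK k X).mulVec v) T hT (by
    intro t ht
    have := h t ht
    rw [tP_expand, Matrix.sum_mulVec] at this
    simpa only [Matrix.smul_mulVec] using this) 1 (by omega)
  rwa [eK_one] at this

end Tens


section Cont
variable {B : Type*} [Fintype B] {n : ℕ}

/-- content of a basis tensor -/
noncomputable def cont (t : Fin n → B) (b : B) : ℕ := ∑ s, if t s = b then 1 else 0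

/-- diagonal matrix depending on the content -/
noncomputable def dC (φ : (B → ℕ) → ℂ) : Matrix (Fin n → B) (Fin n → B) ℂ :=
  Matrix.diagonal fun t => φ (cont t)

/-- elementary operators -/
noncomputable def Eh (b b' : B) : Matrix (Fin n → B) (Fin n → B) ℂ := hat (Matrix.single b b' 1)

lemma diag_comm {T : Type*} [Fintype T] [DecidableEq T] (M : Matrix T T ℂ) (f g : T → ℂ)
    (h : ∀ t' t, M t' t ≠ 0 → f t' = g t) : Matrix.diagonal f * M = M * Matrix.diagonal g := by
  ext t' t
  rw [Matrix.diagonal_mul, Matrix.mul_diagonal]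
  by_cases h0 : M t' t = 0
  · simp [h0]
  · rw [h t' t h0, mul_comm]

lemma Eh_ne (b b' : B) (t' t : Fin n → B) (h : Eh b b' t' t ≠ 0) (c : B) :
    cont t' c + (if c = b' then 1 else 0) = cont t c + (if c = b then 1 else 0) := by
  unfold Eh hat at h
  rw [Matrix.sum_apply] at h
  obtain ⟨s, -, hs⟩ := Finset.exists_ne_zero_of_sum_ne_zero h
  rw [tF_apply, Finset.prod_ne_zero_iff] at hs
  have h1 := hs s (Finset.mem_univ s)
  rw [Function.update_self, Matrix.single_apply] at h1
  have h2 : b = t' s ∧ b' = t s := by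
    by_contra hh; rw [if_neg hh] at h1; exact h1 rfl
  have h3 : ∀ r, r ≠ s → t' r = t r := by
    intro r hr
    have := hs r (Finset.mem_univ r)
    rw [Function.update_of_ne hr, Pi.one_apply] at this
    by_contra hh
    exact this (Matrix.one_apply_ne hh)
  unfold cont
  rw [← Finset.add_sum_erase _ _ (Finset.mem_univ s), ← Finset.add_sum_erase (a := s) _ (fun s => if t s = c then 1 else 0) (Finset.mem_univ s)]
  have h4 : ∑ r ∈ Finset.univ.erase s, (if t' r = c then 1 else 0) =
      ∑ r ∈ Finset.univ.erase s, (if t r = c then 1 else 0) :=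
    Finset.sum_congr rfl fun r hr => by rw [h3 r (Finset.ne_of_mem_erase hr)]
  rw [h4, ← h2.1, ← h2.2]
  simp only [eq_comm (a := c)]
  omega

lemma dC_Eh (φ : (B → ℕ) → ℂ) (b b' : B) : dC (n := n) φ * Eh b b' = Eh b b' *
    dC (fun c => φ fun x => c x + (if x = b then 1 else 0) - (if x = b' then 1 else 0)) := by
  have key : ∀ t' t : Fin n → B, Eh b b' t' t ≠ 0 → φ (cont t') =
      φ (fun x => cont t x + (if x = b then 1 else 0) - (if x = b' then 1 else 0)) := by
    intro t' t h
    congr 1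
    funext x
    have := Eh_ne b b' t' t h x
    omega
  unfold dC
  exact diag_comm (Eh b b') (fun t => φ (cont t)) _ key

lemma dC_mul (φ ψ : (B → ℕ) → ℂ) : dC (n := n) φ * dC ψ = dC (fun c => φ c * ψ c) := by
  unfold dC; rw [Matrix.diagonal_mul_diagonal]

lemma tF_diag (d : Fin n → B → ℂ) : tF (fun s => Matrix.diagonal (d s)) =
    Matrix.diagonal fun t => ∏ s, d s (t s) := by
  ext t' t
  rw [tF_apply]
  by_cases h : t' = t
  · subst h; simp
  · rw [Matrix.diagonal_apply_ne _ h]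
    obtain ⟨s, hs⟩ := Function.ne_iff.mp h
    exact Finset.prod_eq_zero (Finset.mem_univ s) (by simp [Matrix.diagonal_apply_ne _ hs])

lemma Eh_self (b : B) : Eh (n := n) b b = dC (fun c => (c b : ℂ)) := by
  unfold Eh hat dC
  have : ∀ s : Fin n, tF (Function.update (1 : Fin n → Matrix B B ℂ) s (Matrix.single b b 1)) =
      Matrix.diagonal fun t : Fin n → B => if t s = b then 1 else 0 := by
    intro s
    have h1 : Function.update (1 : Fin n → Matrix B B ℂ) s (Matrix.single b b 1) =
      fun r => Matrix.diagonal (if r = s then (fun c => if c = b then 1 else 0) else 1) := by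
      funext r
      by_cases h : r = s
      · subst h
        simp only [Function.update_self, if_true]
        ext x y
        rw [Matrix.single_apply, Matrix.diagonal_apply]
        by_cases h1 : x = y
        · subst h1; simp [eq_comm]
        · simp only [h1, if_false]
          rw [if_neg]
          rintro ⟨rfl, rfl⟩; exact h1 rfl
      · rw [Function.update_of_ne h, if_neg h, Pi.one_apply]
        exact Matrix.diagonal_one.symm
    rw [h1, tF_diag]
    congr 1
    funext t
    rw [Finset.prod_eq_single s]
    · simp
    · intro r _ hr; simp [hr]
    · simp
  simp only [this]
  ext t' t
  rw [Matrix.sum_apply]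
  simp only [Matrix.diagonal_apply]
  by_cases h : t' = t
  · subst h; simp [cont]
  · simp [h]

lemma prod_cont (x : B → ℂ) (t : Fin n → B) : ∏ s, x (t s) = ∏ b, x b ^ cont t b := by
  unfold cont
  simp only [← Finset.prod_pow_eq_pow_sum]
  rw [Finset.prod_comm]
  refine Finset.prod_congr rfl fun s _ => ?_
  rw [Finset.prod_eq_single (t s)]
  · simp
  · intro b _ hb; simp [hb.symm]
  · simp

/-- `D_x` in terms of contents -/
noncomputable def Dx (x : B → ℂ) : Matrix (Fin n → B) (Fin n → B) ℂ := dC fun c => ∏ b, x b ^ c b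

lemma Dx_eq (x : B → ℂ) : Dx (n := n) x = Matrix.diagonal fun t => ∏ s, x (t s) := by
  unfold Dx dC; simp only [prod_cont]

lemma Dx_eq_tP (x : B → ℂ) : Dx (n := n) x = tP (Matrix.diagonal x) := by
  rw [Dx_eq]; unfold tP; rw [tF_diag]

lemma Dx_Eh (x : B → ℂ) (b b' : B) : x b' • (Dx (n := n) x * Eh b b') = x b • (Eh b b' * Dx x) := by
  rw [Dx_eq_tP]
  unfold Eh hat
  rw [Finset.mul_sum, Finset.sum_mul, Finset.smul_sum, Finset.smul_sum]
  refine Finset.sum_congr rfl fun s _ => ?_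
  unfold tP
  rw [tF_mul, tF_mul]
  have h1 : ((fun _ => Matrix.diagonal x) * Function.update (1 : Fin n → Matrix B B ℂ) s (Matrix.single b b' 1)) =
      Function.update (fun _ => Matrix.diagonal x) s (x b • Matrix.single b b' 1) := by
    funext r
    by_cases h : r = s
    · subst h
      rw [Pi.mul_apply, Function.update_self, Function.update_self]
      ext c d
      rw [Matrix.diagonal_mul, Matrix.smul_apply, Matrix.single_apply, smul_eq_mul]
      split_ifs with hh
      · rw [hh.1]
      · simp
    · simp [Function.update_of_ne h]
  have h2 : (Function.update (1 : Fin n → Matrix B B ℂ) s (Matrix.single b b' 1) * (fun _ => Matrix.diagonal x)) =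
      Function.update (fun _ => Matrix.diagonal x) s (x b' • Matrix.single b b' 1) := by
    funext r
    by_cases h : r = s
    · subst h
      rw [Pi.mul_apply, Function.update_self, Function.update_self]
      ext c d
      rw [Matrix.mul_diagonal, Matrix.smul_apply, Matrix.single_apply, smul_eq_mul]
      split_ifs with hh
      · rw [hh.2, mul_comm]
      · simp
    · simp [Function.update_of_ne h]
  rw [h1, h2, MultilinearMap.map_update_smul, MultilinearMap.map_update_smul, smul_smul, smul_smul, mul_comm]

lemma hat_eq_sum (X : Matrix B B ℂ) : hat (n := n) X = ∑ b, ∑ b', X b b' • Eh b b' := by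
  rw [← hatL_apply]
  conv_lhs => rw [Matrix.matrix_eq_sum_single X]
  simp only [map_sum]
  refine Finset.sum_congr rfl fun b _ => Finset.sum_congr rfl fun b' _ => ?_
  have : Matrix.single b b' (X b b') = X b b' • Matrix.single b b' (1 : ℂ) := by simp
  rw [this, map_smul]; rfl

lemma Eh_comm (a b c d : B) : Eh (n := n) a b * Eh c d = Eh c d * Eh a b +
    ((if b = c then Eh a d else 0) - (if d = a then Eh c b else 0)) := by
  unfold Eh
  rw [hat_comm]
  congr 1
  rw [← hatL_apply, map_sub]
  congr 1
  · split_ifs with h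
    · subst h; simp [hatL_apply]
    · rw [Matrix.single_mul_single_of_ne _ _ _ _ h, map_zero]
  · split_ifs with h
    · subst h; simp [hatL_apply]
    · rw [Matrix.single_mul_single_of_ne _ _ _ _ h, map_zero]

/-- Casimir of a block -/
noncomputable def Cas (s : Finset B) : Matrix (Fin n → B) (Fin n → B) ℂ :=
  ∑ b ∈ s, ∑ b' ∈ s, Eh b b' * Eh b' b

lemma Cas_comm (s : Finset B) (c d : B) (h : c ∈ s ↔ d ∈ s) :
    Eh (n := n) c d * Cas s = Cas s * Eh c d := by
  unfold Cas
  simp only [Finset.mul_sum, Finset.sum_mul]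
  rw [← sub_eq_zero, ← Finset.sum_sub_distrib]
  simp only [← Finset.sum_sub_distrib]
  have key : ∀ b b' : B, Eh (n := n) c d * (Eh b b' * Eh b' b) - Eh b b' * Eh b' b * Eh c d =
      ((if d = b then Eh c b' * Eh b' d else 0) - (if b = c then Eh c b' * Eh b' d else 0)) +
      ((if d = b' then Eh b d * Eh c b else 0) - (if b' = c then Eh b d * Eh c b else 0)) := by
    intro b b'
    rw [← mul_assoc, Eh_comm c d b b', add_mul, mul_assoc, Eh_comm c d b' b, mul_add, ← mul_assoc]
    have e1 : (if d = b then Eh (n := n) c b' else 0) * Eh b' b = if d = b then Eh c b' * Eh b' d else 0 := by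
      split_ifs with h
      · rw [h]
      · rw [zero_mul]
    have e2 : (if b' = c then Eh (n := n) b d else 0) * Eh b' b = if b' = c then Eh b d * Eh c b else 0 := by
      split_ifs with h
      · rw [h]
      · rw [zero_mul]
    have e3 : Eh (n := n) b b' * (if d = b' then Eh c b else 0) = if d = b' then Eh b d * Eh c b else 0 := by
      split_ifs with h
      · rw [h]
      · rw [mul_zero]
    have e4 : Eh (n := n) b b' * (if b = c then Eh b' d else 0) = if b = c then Eh c b' * Eh b' d else 0 := by
      split_ifs with h
      · rw [h]
      · rw [mul_zero]
    rw [sub_mul, mul_sub, e1, e2, e3, e4]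
    abel
  simp only [key, Finset.sum_add_distrib, Finset.sum_sub_distrib]
  have e1 : ∑ b ∈ s, ∑ b' ∈ s, (if d = b then Eh (n := n) c b' * Eh b' d else 0) =
     if d ∈ s then ∑ b' ∈ s, Eh (n := n) c b' * Eh b' d else 0 := by
    rw [Finset.sum_comm]; simp
  have e2 : ∑ b ∈ s, ∑ b' ∈ s, (if b = c then Eh (n := n) c b' * Eh b' d else 0) =
     if c ∈ s then ∑ b' ∈ s, Eh (n := n) c b' * Eh b' d else 0 := by
    rw [Finset.sum_comm]; simp
  have e3 : ∑ b ∈ s, ∑ b' ∈ s, (if d = b' then Eh (n := n) b d * Eh c b else 0) =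
     if d ∈ s then ∑ b ∈ s, Eh (n := n) b d * Eh c b else 0 := by
    simp
  have e4 : ∑ b ∈ s, ∑ b' ∈ s, (if b' = c then Eh (n := n) b d * Eh c b else 0) =
     if c ∈ s then ∑ b ∈ s, Eh (n := n) b d * Eh c b else 0 := by
    simp
  rw [e1, e2, e3, e4]
  simp [h]

end Cont


section MZero
variable {B : Type*} [Fintype B] {n : ℕ} {κ : Type*}

/-- lowering-stable hull -/
def M0 (blk : B → κ) (pos : B → ℕ) (Z : Submodule ℂ ((Fin n → B) → ℂ)) :
    Submodule ℂ ((Fin n → B) → ℂ) :=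
  sInf {S | Z ≤ S ∧ ∀ b b', blk b = blk b' → pos b' < pos b → Stab S (Eh b b')}

/-- highest weight data -/
structure HW (blk : B → κ) (pos : B → ℕ) (Z : Submodule ℂ ((Fin n → B) → ℂ)) (L : B → ℕ) : Prop where
  inj : ∀ b b', blk b = blk b' → pos b = pos b' → b = b'
  kill : ∀ b b', blk b = blk b' → pos b < pos b' → ∀ z ∈ Z, (Eh b b').mulVec z = 0
  wt : ∀ z ∈ Z, ∀ t, z t ≠ 0 → cont t = L

variable {blk : B → κ} {pos : B → ℕ} {Z : Submodule ℂ ((Fin n → B) → ℂ)} {L : B → ℕ}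

lemma le_M0 : Z ≤ M0 blk pos Z := le_sInf fun _ h => h.1

lemma M0_low (b b' : B) (h : blk b = blk b') (h' : pos b' < pos b) : Stab (M0 blk pos Z) (Eh b b') := by
  intro v hv
  rw [M0, Submodule.mem_sInf] at hv ⊢
  intro S hS
  exact hS.2 b b' h h' v (hv S hS)

lemma M0_le (S : Submodule ℂ ((Fin n → B) → ℂ)) (h : Z ≤ S)
    (h' : ∀ b b', blk b = blk b' → pos b' < pos b → Stab S (Eh b b')) : M0 blk pos Z ≤ S :=
  sInf_le ⟨h, h'⟩

lemma HW.dC_mulVec (H : HW blk pos Z L) (φ : (B → ℕ) → ℂ) (z) (hz : z ∈ Z) :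
    (dC φ).mulVec z = φ L • z := by
  funext t
  unfold dC
  rw [Matrix.mulVec_diagonal, Pi.smul_apply, smul_eq_mul]
  by_cases h : z t = 0
  · simp [h]
  · rw [H.wt z hz t h]

lemma HW.M0_dC (H : HW blk pos Z L) (φ : (B → ℕ) → ℂ) : Stab (M0 blk pos Z) (dC φ) := by
  have : M0 blk pos Z ≤ ⨅ φ : (B → ℕ) → ℂ, (M0 blk pos Z).comap (Matrix.mulVecLin (dC φ)) := by
    apply M0_le
    · intro z hz
      rw [Submodule.mem_iInf]
      intro φ
      rw [Submodule.mem_comap, Matrix.mulVecLin_apply, H.dC_mulVec φ z hz]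
      exact Submodule.smul_mem _ _ (le_M0 hz)
    · intro b b' h1 h2 v hv
      rw [Submodule.mem_iInf] at hv ⊢
      intro φ
      rw [Submodule.mem_comap, Matrix.mulVecLin_apply, Matrix.mulVec_mulVec, dC_Eh, ← Matrix.mulVec_mulVec]
      exact M0_low b b' h1 h2 _ (hv _)
  intro v hv
  have := this hv
  rw [Submodule.mem_iInf] at this
  exact this φ

lemma BD_single (b b' : B) (h : blk b = blk b') : BD blk (Matrix.single b b' (1 : ℂ)) := by
  intro c c' hc
  rw [Matrix.single_apply, if_neg]
  rintro ⟨rfl, rfl⟩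
  exact hc h

lemma HW.M0_hat (H : HW blk pos Z L) (X : Matrix B B ℂ) (hX : BD blk X) :
    Stab (M0 blk pos Z) (hat X) := by
  have : M0 blk pos Z ≤ M0 blk pos Z ⊓ ⨅ X : {X : Matrix B B ℂ // BD blk X},
      (M0 blk pos Z).comap (Matrix.mulVecLin (hat X.1)) := by
    apply M0_le
    · intro z hz
      refine ⟨le_M0 hz, ?_⟩
      simp only [SetLike.mem_coe, Submodule.mem_iInf, Submodule.mem_comap, Matrix.mulVecLin_apply]
      rintro ⟨X, hX⟩
      rw [hat_eq_sum, Matrix.sum_mulVec]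
      refine Submodule.sum_mem _ fun b _ => ?_
      rw [Matrix.sum_mulVec]
      refine Submodule.sum_mem _ fun b' _ => ?_
      rw [Matrix.smul_mulVec]
      by_cases h : blk b = blk b'
      · apply Submodule.smul_mem
        rcases lt_trichotomy (pos b) (pos b') with h1 | h1 | h1
        · rw [H.kill b b' h h1 z hz]; exact Submodule.zero_mem _
        · rw [← H.inj b b' h h1, Eh_self]
          exact H.M0_dC _ z (le_M0 hz)
        · exact M0_low b b' h h1 z (le_M0 hz)
      · change X b b' • _ ∈ _
        rw [hX b b' h, zero_smul]; exact Submodule.zero_mem _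
    · intro b b' h1 h2 v hv
      refine ⟨M0_low b b' h1 h2 v hv.1, ?_⟩
      have hv2 := hv.2
      simp only [SetLike.mem_coe, Submodule.mem_iInf, Submodule.mem_comap, Matrix.mulVecLin_apply] at hv2 ⊢
      rintro ⟨X, hX⟩
      have hE := BD_single (blk := blk) b b' h1
      rw [Matrix.mulVec_mulVec, Eh, hat_comm, Matrix.add_mulVec, ← Matrix.mulVec_mulVec]
      exact Submodule.add_mem _ (M0_low b b' h1 h2 _ (hv2 ⟨X, hX⟩))
        (hv2 ⟨_, (hX.mul hE).sub (hE.mul hX)⟩)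
  intro v hv
  have := (this hv).2
  simp only [SetLike.mem_coe, Submodule.mem_iInf, Submodule.mem_comap, Matrix.mulVecLin_apply] at this
  exact this ⟨X, hX⟩

lemma HW.M0_tP (H : HW blk pos Z L) (g : Matrix B B ℂ) (hg : BD blk g) :
    Stab (M0 blk pos Z) (tP g) := stab_tP blk _ (fun X hX => H.M0_hat X hX) g hg

lemma HW.M0_Eh (H : HW blk pos Z L) (b b' : B) (h : blk b = blk b') :
    Stab (M0 blk pos Z) (Eh b b') := H.M0_hat _ (BD_single b b' h)

/-- vectors supported on contents satisfying `P` -/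
def supp (P : (B → ℕ) → Prop) : Submodule ℂ ((Fin n → B) → ℂ) where
  carrier := {v | ∀ t, v t ≠ 0 → P (cont t)}
  zero_mem' := fun t h => absurd rfl h
  add_mem' := by
    intro v w hv hw t h
    by_cases h1 : v t = 0
    · apply hw t; intro h2; apply h; simp [h1, h2]
    · exact hv t h1
  smul_mem' := by
    intro a v hv t h
    apply hv t; intro h2; apply h; simp [h2]

/-- dominance -/
def Dom (blk : B → κ) (pos : B → ℕ) (L c : B → ℕ) : Prop :=
  (∀ k r, ∑ b, (if blk b = k ∧ pos b < r then c b else 0) ≤ ∑ b, (if blk b = k ∧ pos b < r then L b else 0)) ∧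
  ∀ k, ∑ b, (if blk b = k then c b else 0) = ∑ b, (if blk b = k then L b else 0)

lemma mask_sum (Q : B → Prop) [DecidablePred Q] (c c' : B → ℕ) (b b' : B)
    (h : ∀ x, c' x + (if x = b' then 1 else 0) = c x + (if x = b then 1 else 0)) :
    ∑ x, (if Q x then c' x else 0) + (if Q b' then 1 else 0) =
    ∑ x, (if Q x then c x else 0) + (if Q b then 1 else 0) := by
  have e : ∀ (c : B → ℕ) b, ∑ x, (if Q x then c x else 0) + (if Q b then 1 else 0) =
      ∑ x, (if Q x then c x + (if x = b then 1 else 0) else 0) := by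
    intro c b
    have : (if Q b then 1 else 0) = ∑ x, (if x = b then (if Q x then 1 else 0) else 0) := by
      simp
    rw [this, ← Finset.sum_add_distrib]
    refine Finset.sum_congr rfl fun x _ => ?_
    split_ifs <;> rfl
  rw [e, e]
  simp only [h]

lemma mulVec_ne {T : Type*} [Fintype T] (M : Matrix T T ℂ) (v : T → ℂ) (t' : T) (h : M.mulVec v t' ≠ 0) :
    ∃ t, M t' t ≠ 0 ∧ v t ≠ 0 := by
  obtain ⟨t, -, ht⟩ := Finset.exists_ne_zero_of_sum_ne_zero (s := Finset.univ) (f := fun t => M t' t * v t) h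
  exact ⟨t, left_ne_zero_of_mul ht, right_ne_zero_of_mul ht⟩

lemma HW.M0_dom (H : HW blk pos Z L) : M0 blk pos Z ≤ supp (Dom blk pos L) := by
  apply M0_le
  · intro z hz t ht
    rw [H.wt z hz t ht]
    exact ⟨fun _ _ => le_rfl, fun _ => rfl⟩
  · intro b b' h1 h2 v hv t' ht'
    obtain ⟨t, h3, h4⟩ := mulVec_ne _ _ _ ht'
    have h5 := Eh_ne b b' t' t h3
    have h6 := hv t h4
    refine ⟨fun k r => le_trans ?_ (h6.1 k r), fun k => Eq.trans ?_ (h6.2 k)⟩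
    · have := mask_sum (fun b => blk b = k ∧ pos b < r) _ _ b b' h5
      have h7 : (if blk b = k ∧ pos b < r then 1 else 0) ≤ (if blk b' = k ∧ pos b' < r then 1 else 0) := by
        split_ifs with g1 g2
        · exact le_rfl
        · exact absurd ⟨h1 ▸ g1.1, h2.trans g1.2⟩ g2
        · exact Nat.zero_le _
        · exact le_rfl
      omega
    · have := mask_sum (fun b => blk b = k) _ _ b b' h5
      rw [h1] at this
      omega

lemma HW.M0_top (H : HW blk pos Z L) (v) (hv : v ∈ M0 blk pos Z) :
    (dC (fun c => if c = L then 1 else 0)).mulVec v ∈ Z := by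
  have : M0 blk pos Z ≤ supp (Dom blk pos L) ⊓
      Z.comap (Matrix.mulVecLin (dC (fun c => if c = L then 1 else 0))) := by
    apply M0_le
    · intro z hz
      refine ⟨H.M0_dom (le_M0 hz), ?_⟩
      simp only [SetLike.mem_coe, Submodule.mem_comap, Matrix.mulVecLin_apply]
      rw [H.dC_mulVec _ z hz]
      exact Submodule.smul_mem _ _ hz
    · intro b b' h1 h2 v hv
      have hst : Stab (supp (n := n) (Dom blk pos L)) (Eh b b') := by
        intro v hv t' ht'
        obtain ⟨t, h3, h4⟩ := mulVec_ne _ _ _ ht'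
        have h5 := Eh_ne b b' t' t h3
        have h6 := hv t h4
        refine ⟨fun k r => le_trans ?_ (h6.1 k r), fun k => Eq.trans ?_ (h6.2 k)⟩
        · have := mask_sum (fun b => blk b = k ∧ pos b < r) _ _ b b' h5
          have h7 : (if blk b = k ∧ pos b < r then 1 else 0) ≤ (if blk b' = k ∧ pos b' < r then 1 else 0) := by
            split_ifs with g1 g2
            · exact le_rfl
            · exact absurd ⟨h1 ▸ g1.1, h2.trans g1.2⟩ g2
            · exact Nat.zero_le _
            · exact le_rfl
          omega
        · have := mask_sum (fun b => blk b = k) _ _ b b' h5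
          rw [h1] at this
          omega
      refine ⟨hst v hv.1, ?_⟩
      simp only [SetLike.mem_coe, Submodule.mem_comap, Matrix.mulVecLin_apply]
      convert Submodule.zero_mem Z
      funext t'
      unfold dC
      rw [Matrix.mulVec_diagonal]
      by_cases h : cont t' = L
      · rw [Pi.zero_apply]
        convert mul_zero _
        by_contra ht'
        obtain ⟨t, h3, h4⟩ := mulVec_ne _ _ _ ht'
        have h5 := Eh_ne b b' t' t h3
        have h6 := (hv.1 t h4).1 (blk b') (pos b' + 1)
        have := mask_sum (fun b => blk b = blk b' ∧ pos b < pos b' + 1) _ _ b b' h5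
        rw [h, if_pos ⟨rfl, Nat.lt_succ_self _⟩, if_neg (by rintro ⟨-, h⟩; omega)] at this
        omega
      · change (if cont t' = L then (1 : ℂ) else 0) * _ = 0
        rw [if_neg h, zero_mul]
  exact (this hv).2

lemma HW.M0_cas (H : HW blk pos Z L) (k : κ) (v) (hv : v ∈ M0 blk pos Z) :
    (Cas (Finset.univ.filter fun b => blk b = k)).mulVec v =
    (∑ b ∈ Finset.univ.filter (fun b => blk b = k), (L b : ℂ) ^ 2 +
      ∑ b ∈ Finset.univ.filter (fun b => blk b = k), ∑ b' ∈ Finset.univ.filter (fun b => blk b = k),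
        (if pos b < pos b' then (L b : ℂ) - L b' else 0)) • v := by
  set s := Finset.univ.filter (fun b => blk b = k) with hs
  set c := (∑ b ∈ s, (L b : ℂ) ^ 2 +
      ∑ b ∈ s, ∑ b' ∈ s, (if pos b < pos b' then (L b : ℂ) - L b' else 0)) with hc
  have : M0 blk pos Z ≤ LinearMap.eqLocus (Matrix.mulVecLin (Cas s)) (c • LinearMap.id) := by
    apply M0_le
    · intro z hz
      rw [LinearMap.mem_eqLocus, Matrix.mulVecLin_apply]
      change _ = c • z
      rw [Cas, hc, add_smul, Finset.sum_smul, Finset.sum_smul, ← Finset.sum_add_distrib, Matrix.sum_mulVec]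
      refine Finset.sum_congr rfl fun b hb => ?_
      rw [Finset.sum_smul, Matrix.sum_mulVec]
      have e : (L b : ℂ) ^ 2 • z = ∑ b' ∈ s, if b' = b then (L b : ℂ) ^ 2 • z else 0 := by
        rw [Finset.sum_ite_eq' , if_pos hb]
      rw [e, ← Finset.sum_add_distrib]
      refine Finset.sum_congr rfl fun b' hb' => ?_
      have hbb : blk b = blk b' := by
        rw [(Finset.mem_filter.mp hb).2, (Finset.mem_filter.mp hb').2]
      rcases lt_trichotomy (pos b) (pos b') with h1 | h1 | h1
      · rw [if_neg (by rintro rfl; omega), if_pos h1, Eh_comm, if_pos rfl, if_pos rfl, Matrix.add_mulVec,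
          Matrix.sub_mulVec, ← Matrix.mulVec_mulVec, H.kill b b' hbb h1 z hz, Matrix.mulVec_zero,
          Eh_self, Eh_self, H.dC_mulVec _ z hz, H.dC_mulVec _ z hz, sub_smul]
      · have := H.inj b b' hbb h1
        subst this
        rw [if_pos rfl, if_neg (lt_irrefl _), Eh_self, dC_mul, H.dC_mulVec _ z hz, zero_smul, add_zero, sq]
      · rw [if_neg (by rintro rfl; omega), if_neg (by omega), ← Matrix.mulVec_mulVec, H.kill b' b hbb.symm h1 z hz,
          Matrix.mulVec_zero, zero_smul, add_zero]
    · intro b b' h1 h2 v hv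
      rw [LinearMap.mem_eqLocus, Matrix.mulVecLin_apply] at hv ⊢
      rw [Matrix.mulVec_mulVec, ← Cas_comm, ← Matrix.mulVec_mulVec, hv]
      · change (Eh b b').mulVec (c • v) = c • _
        rw [Matrix.mulVec_smul]; rfl
      · simp [hs, h1]
  exact this hv

lemma infinite_unit (X : Matrix B B ℂ) : {t : ℂ | IsUnit (1 + t • X)}.Infinite := by
  have hfin : {t : ℂ | ¬ IsUnit (1 + t • X)}.Finite := by
    let P : Polynomial ℂ := (1 + (Polynomial.X : Polynomial ℂ) • X.map Polynomial.C).det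
    have hev : ∀ t, P.eval t = (1 + t • X).det := by
      intro t
      have := RingHom.map_det (Polynomial.evalRingHom t) (1 + (Polynomial.X : Polynomial ℂ) • X.map Polynomial.C)
      simp only [Polynomial.coe_evalRingHom] at this
      rw [this]
      congr 1
      ext i k
      simp [Matrix.one_apply]
      split_ifs <;> simp [mul_comm]
    have hP : P ≠ 0 := by
      intro h
      have := hev 0
      rw [h] at this
      simp at this
    refine (Polynomial.finite_setOf_isRoot hP).subset ?_
    intro t ht
    simp only [Set.mem_setOf_eq, Polynomial.IsRoot] at ht ⊢
    rw [hev]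
    by_contra h
    exact ht ((Matrix.isUnit_iff_isUnit_det _).mpr (isUnit_iff_ne_zero.mpr h))
  have := hfin.infinite_compl
  convert this using 1
  ext t; simp

lemma HW.M0_span (H : HW blk pos Z L) : M0 blk pos Z =
    Submodule.span ℂ {u | ∃ g z, BD blk g ∧ IsUnit g ∧ z ∈ Z ∧ u = (tP g).mulVec z} := by
  apply le_antisymm
  · apply M0_le
    · intro z hz
      exact Submodule.subset_span ⟨1, z, BD.one, isUnit_one, hz, by rw [tP_one, Matrix.one_mulVec]⟩
    · intro b b' h1 h2 v hv
      apply hat_of_tP _ _ _ _ (infinite_unit (Matrix.single b b' 1)) _ hv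
      intro t ht
      have hg : BD blk (1 + t • Matrix.single b b' (1 : ℂ)) := BD.one.add ((BD_single b b' h1).smul t)
      set S := Submodule.span ℂ {u | ∃ g z, BD blk g ∧ IsUnit g ∧ z ∈ Z ∧ u = (tP g).mulVec z} with hS
      have : S ≤ S.comap (Matrix.mulVecLin (tP (1 + t • Matrix.single b b' (1 : ℂ)))) := by
        conv_lhs => rw [hS]
        rw [Submodule.span_le]
        rintro u ⟨g, z, g1, g2, g3, rfl⟩
        apply Submodule.subset_span
        refine ⟨(1 + t • Matrix.single b b' (1 : ℂ)) * g, z, hg.mul g1, ht.mul g2, g3, ?_⟩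
        rw [Matrix.mulVecLin_apply, Matrix.mulVec_mulVec, tP_mul]
      exact this hv
  · rw [Submodule.span_le]
    rintro u ⟨g, z, g1, g2, g3, rfl⟩
    exact H.M0_tP g g1 z (le_M0 g3)

end MZero


section Tr
variable {T : Type*} [Fintype T]

lemma trace_mulVecLin (A : Matrix T T ℂ) : LinearMap.trace ℂ (T → ℂ) (Matrix.mulVecLin A) = A.trace := by
  rw [← Matrix.trace_toLin'_eq]; rfl

lemma traceOn_eq (S : Submodule ℂ (T → ℂ)) (Y G : Matrix T T ℂ) (hG : ∀ v, G.mulVec v ∈ S)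
    (hY : ∀ v ∈ S, G.mulVec v = Y.mulVec v) : traceOn S (Matrix.mulVecLin Y) = G.trace := by
  have h1 : ∀ v ∈ S, Matrix.mulVecLin Y v ∈ S := by
    intro v hv
    rw [Matrix.mulVecLin_apply, ← hY v hv]
    exact hG v
  unfold traceOn
  rw [dif_pos h1, ← trace_mulVecLin, ← LinearMap.trace_restrict_eq_of_forall_mem S (Matrix.mulVecLin G) hG]
  congr 1
  refine LinearMap.ext fun v => Subtype.ext ?_
  exact (hY v v.2).symm

lemma exists_proj (S : Submodule ℂ (T → ℂ)) : ∃ P : Matrix T T ℂ, (∀ v, P.mulVec v ∈ S) ∧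
    ∀ v ∈ S, P.mulVec v = v := by
  obtain ⟨g, hg⟩ := LinearMap.exists_leftInverse_of_injective S.subtype (Submodule.ker_subtype S)
  refine ⟨LinearMap.toMatrix' (S.subtype ∘ₗ g), fun v => ?_, fun v hv => ?_⟩
  · rw [LinearMap.toMatrix'_mulVec]; exact (g v).2
  · rw [LinearMap.toMatrix'_mulVec]
    have := LinearMap.congr_fun hg ⟨v, hv⟩
    simp only [LinearMap.comp_apply, Submodule.subtype_apply, LinearMap.id_apply] at this ⊢
    rw [this]

lemma mul_eq_of_proj {S : Submodule ℂ (T → ℂ)} {P X Y : Matrix T T ℂ} (hP : ∀ v, P.mulVec v ∈ S)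
    (h : ∀ v ∈ S, X.mulVec v = Y.mulVec v) : X * P = Y * P := by
  apply Matrix.ext_of_mulVec_single
  intro t
  rw [← Matrix.mulVec_mulVec, ← Matrix.mulVec_mulVec]
  exact h _ (hP _)

end Tr

section Core
variable {B : Type*} [Fintype B] {n : ℕ} {K : Type*} [Fintype K] {N : K → ℕ} {h : ℕ} [NeZero h]

/-- the twist -/
def piB (ε : B ≃ ZMod h × (Σ k, Fin (N k))) : B ≃ B :=
  ε.trans ((Equiv.prodCongr (Equiv.addRight 1) (Equiv.refl _)).trans ε.symm)

lemma piB_symm (ε : B ≃ ZMod h × (Σ k, Fin (N k))) (s : ZMod h) (a : Σ k, Fin (N k)) :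
    piB ε (ε.symm (s, a)) = ε.symm (s + 1, a) := by
  simp [piB]

/-- block -/
def blkE (ε : B ≃ ZMod h × (Σ k, Fin (N k))) (b : B) : ZMod h × K := ((ε b).1, (ε b).2.1)
/-- position -/
def posE (ε : B ≃ ZMod h × (Σ k, Fin (N k))) (b : B) : ℕ := ((ε b).2.2 : ℕ)

/-- the setting of the core trace computation -/
structure Core (ε : B ≃ ZMod h × (Σ k, Fin (N k))) (Z : Submodule ℂ ((Fin n → B) → ℂ)) (L : B → ℕ)
    (f : Matrix (Fin n → B) (Fin n → B) ℂ) : Prop where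
  hw : HW (blkE ε) (posE ε) Z L
  fP : ∀ g, BD (blkE ε) g → f * tP g = tP (g.submatrix (piB ε).symm (piB ε).symm) * f
  fc : ∀ t' t, f t' t ≠ 0 → ∀ b, cont t' (piB ε b) = cont t b
  Linv : ∀ b, L (piB ε b) = L b
  Lanti : ∀ s k, Antitone fun i => L (ε.symm (s, ⟨k, i⟩))
  fZ : Stab Z f

variable {ε : B ≃ ZMod h × (Σ k, Fin (N k))} {Z : Submodule ℂ ((Fin n → B) → ℂ)} {L : B → ℕ}
  {f : Matrix (Fin n → B) (Fin n → B) ℂ}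

lemma Core.fHat (H : Core ε Z L f) (X : Matrix B B ℂ) (hX : BD (blkE ε) X) :
    f * hat X = hat (X.submatrix (piB ε).symm (piB ε).symm) * f := by
  rcases Nat.eq_zero_or_pos n with rfl | hn
  · have : ∀ X, hat (B := B) (n := 0) X = 0 := fun X => by simp [hat]
    rw [this, this, mul_zero, zero_mul]
  have := poly_vec (⊥ : Submodule ℂ (Matrix (Fin n → B) (Fin n → B) ℂ)) (n + 1)
    (fun k => f * eK k X - eK k (X.submatrix (piB ε).symm (piB ε).symm) * f) Set.univ Set.infinite_univ (by
    intro t _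
    rw [Submodule.mem_bot]
    have h1 := H.fP (1 + t • X) (BD.one.add (hX.smul t))
    have h2 : (1 + t • X).submatrix (piB ε).symm (piB ε).symm =
        1 + t • X.submatrix (piB ε).symm (piB ε).symm := by
      rw [Matrix.submatrix_add, Matrix.submatrix_smul, Pi.add_apply, Pi.add_apply, Matrix.submatrix_one_equiv,
        Pi.smul_apply, Pi.smul_apply]
    rw [h2, tP_expand, tP_expand, Finset.mul_sum, Finset.sum_mul, ← sub_eq_zero, ← Finset.sum_sub_distrib] at h1
    rw [← h1]
    refine Finset.sum_congr rfl fun k _ => ?_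
    rw [smul_sub, Matrix.mul_smul, Matrix.smul_mul]) 1 (by omega)
  rw [Submodule.mem_bot, eK_one, eK_one, sub_eq_zero] at this
  exact this

lemma Core.fE (H : Core ε Z L f) (b b' : B) (hb : blkE ε b = blkE ε b') :
    f * Eh b b' = Eh (piB ε b) (piB ε b') * f := by
  unfold Eh
  rw [H.fHat _ (BD_single b b' hb)]
  congr 2
  ext c c'
  simp only [Matrix.submatrix_apply, Matrix.single_apply, Equiv.eq_symm_apply]

lemma blkE_piB (b b' : B) (hb : blkE ε b = blkE ε b') : blkE ε (piB ε b) = blkE ε (piB ε b') := by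
  simp only [blkE, piB, Equiv.trans_apply, Equiv.apply_symm_apply, Equiv.prodCongr_apply, Prod.map, Prod.mk.injEq,
    Equiv.coe_addRight, Equiv.refl_apply] at hb ⊢
  rw [hb.1]; exact ⟨rfl, hb.2⟩

lemma posE_piB (b : B) : posE ε (piB ε b) = posE ε b := by
  unfold posE piB
  rw [Equiv.trans_apply, Equiv.trans_apply, Equiv.apply_symm_apply]
  rfl

lemma Core.M0_f (H : Core ε Z L f) : Stab (M0 (blkE ε) (posE ε) Z) f := by
  have : M0 (blkE ε) (posE ε) Z ≤ (M0 (blkE ε) (posE ε) Z).comap (Matrix.mulVecLin f) := by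
    apply M0_le
    · intro z hz
      exact le_M0 (H.fZ z hz)
    · intro b b' h1 h2 v hv
      rw [Submodule.mem_comap, Matrix.mulVecLin_apply] at hv ⊢
      rw [Matrix.mulVec_mulVec, H.fE b b' h1, ← Matrix.mulVec_mulVec]
      exact M0_low _ _ (blkE_piB _ _ h1) (by rw [posE_piB, posE_piB]; exact h2) _ hv
  exact this

/-- data with a chosen projection -/
structure CoreP (ε : B ≃ ZMod h × (Σ k, Fin (N k))) (Z : Submodule ℂ ((Fin n → B) → ℂ)) (L : B → ℕ)
    (f P : Matrix (Fin n → B) (Fin n → B) ℂ) : Prop extends Core ε Z L f where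
  P1 : ∀ v, P.mulVec v ∈ M0 (blkE ε) (posE ε) Z
  P2 : ∀ v ∈ M0 (blkE ε) (posE ε) Z, P.mulVec v = v

variable {P : Matrix (Fin n → B) (Fin n → B) ℂ}

lemma CoreP.PYP (H : CoreP ε Z L f P) (Y) (hY : Stab (M0 (blkE ε) (posE ε) Z) Y) : P * Y * P = Y * P := by
  apply mul_eq_of_proj H.P1
  intro v hv
  rw [← Matrix.mulVec_mulVec]
  exact H.P2 _ (hY v hv)

lemma CoreP.cyc (H : CoreP ε Z L f P) (X Y) (hX : Stab (M0 (blkE ε) (posE ε) Z) X)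
    (hY : Stab (M0 (blkE ε) (posE ε) Z) Y) : (X * Y * P).trace = (Y * X * P).trace := by
  have e1 : X * Y * P = (X * P) * (Y * P) := by
    rw [mul_assoc X P, ← mul_assoc P, H.PYP Y hY, mul_assoc]
  have e2 : Y * X * P = (Y * P) * (X * P) := by
    rw [mul_assoc Y P, ← mul_assoc P, H.PYP X hX, mul_assoc]
  rw [e1, e2, Matrix.trace_mul_comm]

lemma CoreP.traceOn (H : CoreP ε Z L f P) (Y) (hY : Stab (M0 (blkE ε) (posE ε) Z) Y) :
    traceOn (M0 (blkE ε) (posE ε) Z) (Matrix.mulVecLin Y) = (Y * P).trace := by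
  apply traceOn_eq
  · intro v
    rw [← Matrix.mulVec_mulVec]
    exact hY _ (H.P1 v)
  · intro v hv
    rw [← Matrix.mulVec_mulVec, H.P2 v hv]

/-- projection to a weight space -/
noncomputable def Pb (β : B → ℕ) : Matrix (Fin n → B) (Fin n → B) ℂ := dC fun c => if c = β then 1 else 0

lemma dC_expand (φ : (B → ℕ) → ℂ) : dC (n := n) φ =
    ∑ β ∈ Finset.univ.image (cont : (Fin n → B) → B → ℕ), φ β • Pb β := by
  ext t' t
  rw [Matrix.sum_apply]
  unfold Pb dC
  simp only [Matrix.smul_apply, Matrix.diagonal_apply]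
  by_cases hh : t' = t
  · subst hh
    simp only [if_true, smul_eq_mul, mul_ite, mul_one, mul_zero]
    rw [Finset.sum_ite_eq, if_pos (Finset.mem_image_of_mem _ (Finset.mem_univ _))]
  · simp [hh]

lemma CoreP.tr_pi (H : CoreP ε Z L f P) (φ ψ : (B → ℕ) → ℂ)
    (hh : ∀ β : B → ℕ, (∀ b, β (piB ε b) = β b) → φ β = ψ β) :
    (dC φ * f * P).trace = (dC ψ * f * P).trace := by
  rw [dC_expand φ, dC_expand ψ]
  simp only [Finset.sum_mul, Matrix.trace_sum]
  refine Finset.sum_congr rfl fun β _ => ?_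
  simp only [Matrix.smul_mul, Matrix.trace_smul]
  by_cases hβ : ∀ b, β (piB ε b) = β b
  · rw [hh β hβ]
  · have e1 : Pb (n := n) β * f = f * Pb (fun b => β (piB ε b)) := by
      unfold Pb dC
      apply diag_comm
      intro t' t ht
      have := H.fc t' t ht
      have : (cont t' = β) ↔ (cont t = fun b => β (piB ε b)) := by
        constructor
        · intro h1; funext b; rw [← this, h1]
        · intro h1; funext b
          have h2 := congrFun h1 ((piB ε).symm b)
          rw [← this, Equiv.apply_symm_apply] at h2
          exact h2
      simp only [this]
    have e2 : Pb (n := n) β * Pb β = Pb β := by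
      unfold Pb; rw [dC_mul]; congr 1; funext c; split_ifs <;> simp
    have e3 : Pb (n := n) (fun b => β (piB ε b)) * Pb β = 0 := by
      unfold Pb; rw [dC_mul]
      have : (fun c : B → ℕ => (if c = (fun b => β (piB ε b)) then (1 : ℂ) else 0) * (if c = β then 1 else 0)) = fun _ => 0 := by
        funext c
        split_ifs with h1 h2 <;> simp
        exact hβ fun b => by rw [h2] at h1; exact (congrFun h1 b).symm
      rw [this]
      unfold dC; exact Matrix.diagonal_zero
    have : (Pb (n := n) β * f * P).trace = 0 := by
      rw [← e2, mul_assoc (Pb β) (Pb β) f, e1, ← mul_assoc, H.cyc, ← mul_assoc, e3, zero_mul, zero_mul, Matrix.trace_zero]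
      · exact (H.hw.M0_dC _).mul H.M0_f
      · exact H.hw.M0_dC _
    rw [this, smul_zero, smul_zero]

/-- extension of an assignment -/
noncomputable def ext0 (ε : B ≃ ZMod h × (Σ k, Fin (N k))) (y : (Σ k, Fin (N k)) → ℂ) (b : B) : ℂ :=
  if (ε b).1 = 0 then y (ε b).2 else 1

lemma prodE (ε : B ≃ ZMod h × (Σ k, Fin (N k))) (g : B → ℂ) : ∏ b, g b = ∏ a, ∏ s, g (ε.symm (s, a)) := by
  rw [← Equiv.prod_comp ε.symm g, Fintype.prod_prod_type, Finset.prod_comm]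

lemma prod_ext0 (y : (Σ k, Fin (N k)) → ℂ) (c : B → ℕ) :
    ∏ b, ext0 ε y b ^ c b = ∏ a, y a ^ c (ε.symm (0, a)) := by
  rw [prodE ε]
  refine Finset.prod_congr rfl fun a _ => ?_
  rw [Finset.prod_eq_single 0]
  · simp [ext0]
  · intro s _ hs; simp [ext0, hs]
  · simp

/-- exponent -/
noncomputable def bet (ε : B ≃ ZMod h × (Σ k, Fin (N k))) (t : Fin n → B) : (Σ k, Fin (N k)) →₀ ℕ :=
  Finsupp.equivFunOnFinite.symm fun a => cont t (ε.symm (0, a))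

/-- the trace polynomial -/
noncomputable def Ptr (ε : B ≃ ZMod h × (Σ k, Fin (N k))) (Y : Matrix (Fin n → B) (Fin n → B) ℂ) :
    MvPolynomial (Σ k, Fin (N k)) ℂ := ∑ t, MvPolynomial.monomial (bet ε t) (Y t t)

lemma Ptr_eval (Y : Matrix (Fin n → B) (Fin n → B) ℂ) (y) :
    MvPolynomial.eval y (Ptr ε Y) = (Dx (ext0 ε y) * Y).trace := by
  unfold Ptr Dx dC Matrix.trace
  rw [map_sum]
  refine Finset.sum_congr rfl fun t _ => ?_
  rw [MvPolynomial.eval_monomial, Matrix.diag_apply, Matrix.diagonal_mul, mul_comm]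
  congr 1
  refine Eq.trans ?_ (prod_ext0 y (cont t)).symm
  rw [Finsupp.prod_fintype _ _ (by simp)]
  rfl

lemma thD_Ptr (Y : Matrix (Fin n → B) (Fin n → B) ℂ) (a) :
    thD a (Ptr ε Y) = Ptr ε (Eh (ε.symm (0, a)) (ε.symm (0, a)) * Y) := by
  unfold Ptr
  rw [map_sum]
  refine Finset.sum_congr rfl fun t _ => ?_
  rw [thD_monomial, Eh_self, dC, Matrix.diagonal_mul]
  rfl

lemma Ptr_coeff (Y : Matrix (Fin n → B) (Fin n → B) ℂ) (β) :
    MvPolynomial.coeff β (Ptr ε Y) = (dC (fun c => if (fun a => c (ε.symm (0, a))) = ⇑β then 1 else 0) * Y).trace := by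
  unfold Ptr Matrix.trace dC
  rw [MvPolynomial.coeff_sum]
  refine Finset.sum_congr rfl fun t _ => ?_
  rw [MvPolynomial.coeff_monomial, Matrix.diag_apply, Matrix.diagonal_mul]
  have : bet ε t = β ↔ (fun a => cont t (ε.symm (0, a))) = ⇑β := by
    rw [← DFunLike.coe_injective.eq_iff]; rfl
  simp only [this, ite_mul, one_mul, zero_mul]

lemma Ptr_add (X Y : Matrix (Fin n → B) (Fin n → B) ℂ) : Ptr ε (X + Y) = Ptr ε X + Ptr ε Y := by
  unfold Ptr
  rw [← Finset.sum_add_distrib]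
  refine Finset.sum_congr rfl fun t _ => ?_
  rw [Matrix.add_apply, map_add]

lemma Ptr_smul (c : ℂ) (Y : Matrix (Fin n → B) (Fin n → B) ℂ) : Ptr ε (c • Y) = c • Ptr ε Y := by
  unfold Ptr
  rw [Finset.smul_sum]
  refine Finset.sum_congr rfl fun t _ => ?_
  rw [Matrix.smul_apply, MvPolynomial.smul_monomial]

lemma Ptr_zero : Ptr ε (0 : Matrix (Fin n → B) (Fin n → B) ℂ) = 0 := by
  unfold Ptr; simp

lemma Ptr_sum {ι : Type*} (s : Finset ι) (Y : ι → Matrix (Fin n → B) (Fin n → B) ℂ) :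
    Ptr ε (∑ i ∈ s, Y i) = ∑ i ∈ s, Ptr ε (Y i) := by
  induction s using Finset.induction_on with
  | empty => simp [Ptr_zero]
  | insert a s ha ih => rw [Finset.sum_insert ha, Finset.sum_insert ha, Ptr_add, ih]

end Core


section Core2
variable {B : Type*} [Fintype B] {n : ℕ} {K : Type*} [Fintype K] {N : K → ℕ} {h : ℕ} [NeZero h]
variable {ε : B ≃ ZMod h × (Σ k, Fin (N k))} {Z : Submodule ℂ ((Fin n → B) → ℂ)} {L : B → ℕ}
  {f P : Matrix (Fin n → B) (Fin n → B) ℂ}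

lemma blkE_symm (s : ZMod h) (a : Σ k, Fin (N k)) : blkE ε (ε.symm (s, a)) = (s, a.1) := by
  simp [blkE]
lemma posE_symm (s : ZMod h) (a : Σ k, Fin (N k)) : posE ε (ε.symm (s, a)) = a.2.val := by
  unfold posE; rw [Equiv.apply_symm_apply]
lemma ext0_symm (y) (s : ZMod h) (a : Σ k, Fin (N k)) : ext0 ε y (ε.symm (s, a)) = if s = 0 then y a else 1 := by
  unfold ext0; rw [Equiv.apply_symm_apply]

lemma CoreP.tw_step (H : CoreP ε Z L f P) (y) (k : K) (i i' : Fin (N k)) (s : ZMod h) (hs : s + 1 ≠ 0) :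
    (Dx (ext0 ε y) * f * (Eh (ε.symm (s, ⟨k, i⟩)) (ε.symm (s, ⟨k, i'⟩)) *
      Eh (ε.symm (0, ⟨k, i'⟩)) (ε.symm (0, ⟨k, i⟩))) * P).trace =
    (Dx (ext0 ε y) * f * (Eh (ε.symm (s + 1, ⟨k, i⟩)) (ε.symm (s + 1, ⟨k, i'⟩)) *
      Eh (ε.symm (0, ⟨k, i'⟩)) (ε.symm (0, ⟨k, i⟩))) * P).trace := by
  have hD : Stab (M0 (blkE ε) (posE ε) Z) (Dx (ext0 ε y)) := H.hw.M0_dC _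
  have hE1 : Stab (M0 (blkE ε) (posE ε) Z) (Eh (ε.symm (s + 1, ⟨k, i⟩)) (ε.symm (s + 1, ⟨k, i'⟩))) :=
    H.hw.M0_Eh _ _ (by rw [blkE_symm, blkE_symm])
  have hG : Stab (M0 (blkE ε) (posE ε) Z) (Eh (ε.symm (0, ⟨k, i'⟩)) (ε.symm (0, ⟨k, i⟩))) :=
    H.hw.M0_Eh _ _ (by rw [blkE_symm, blkE_symm])
  have e1 := H.fE (ε.symm (s, ⟨k, i⟩)) (ε.symm (s, ⟨k, i'⟩)) (by rw [blkE_symm, blkE_symm])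
  rw [piB_symm, piB_symm] at e1
  have e2 := Dx_Eh (n := n) (ext0 ε y) (ε.symm (s + 1, ⟨k, i⟩)) (ε.symm (s + 1, ⟨k, i'⟩))
  rw [ext0_symm, ext0_symm, if_neg hs, if_neg hs, one_smul, one_smul] at e2
  have e3 := Eh_comm (n := n) (ε.symm (0, ⟨k, i'⟩)) (ε.symm (0, ⟨k, i⟩)) (ε.symm (s + 1, ⟨k, i⟩)) (ε.symm (s + 1, ⟨k, i'⟩))
  rw [if_neg (by rw [ε.symm.injective.eq_iff]; simp [hs.symm]), if_neg (by rw [ε.symm.injective.eq_iff]; simp [hs]), sub_zero, add_zero] at e3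
  set D := Dx (n := n) (ext0 ε y)
  set E0 := Eh (n := n) (ε.symm (s, ⟨k, i⟩)) (ε.symm (s, ⟨k, i'⟩))
  set E1 := Eh (n := n) (ε.symm (s + 1, ⟨k, i⟩)) (ε.symm (s + 1, ⟨k, i'⟩))
  set G := Eh (n := n) (ε.symm (0, ⟨k, i'⟩)) (ε.symm (0, ⟨k, i⟩))
  have : D * f * (E0 * G) = E1 * (D * f * G) := by
    calc D * f * (E0 * G) = D * (f * E0) * G := by simp only [mul_assoc]
      _ = (D * E1) * (f * G) := by rw [e1]; simp only [mul_assoc]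
      _ = _ := by rw [e2]; simp only [mul_assoc]
  rw [this, H.cyc _ _ hE1 ((hD.mul H.M0_f).mul hG), mul_assoc (D * f), e3]

lemma CoreP.tw (H : CoreP ε Z L f P) (y) (k : K) (i i' : Fin (N k)) (s : ℕ) (hs : s < h) :
    (Dx (ext0 ε y) * f * (Eh (ε.symm (0, ⟨k, i⟩)) (ε.symm (0, ⟨k, i'⟩)) *
      Eh (ε.symm (0, ⟨k, i'⟩)) (ε.symm (0, ⟨k, i⟩))) * P).trace =
    (Dx (ext0 ε y) * f * (Eh (ε.symm ((s : ZMod h), ⟨k, i⟩)) (ε.symm ((s : ZMod h), ⟨k, i'⟩)) *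
      Eh (ε.symm (0, ⟨k, i'⟩)) (ε.symm (0, ⟨k, i⟩))) * P).trace := by
  induction s with
  | zero => rw [Nat.cast_zero]
  | succ s ih =>
    rw [ih (by omega), H.tw_step y k i i' s]
    · push_cast; rfl
    · have : ((s + 1 : ℕ) : ZMod h) ≠ 0 := by
        rw [Ne, ZMod.natCast_eq_zero_iff]
        intro hd
        exact absurd (Nat.le_of_dvd (Nat.succ_pos s) hd) (by omega)
      simpa using this

set_option maxHeartbeats 1600000 in
lemma CoreP.tw_final (H : CoreP ε Z L f P) (y) (k : K) (i i' : Fin (N k)) :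
    (y ⟨k, i⟩ - y ⟨k, i'⟩) * (Dx (ext0 ε y) * f * (Eh (ε.symm (0, ⟨k, i⟩)) (ε.symm (0, ⟨k, i'⟩)) *
      Eh (ε.symm (0, ⟨k, i'⟩)) (ε.symm (0, ⟨k, i⟩))) * P).trace =
    y ⟨k, i⟩ * ((Dx (ext0 ε y) * f * Eh (ε.symm (0, ⟨k, i⟩)) (ε.symm (0, ⟨k, i⟩)) * P).trace -
      (Dx (ext0 ε y) * f * Eh (ε.symm (0, ⟨k, i'⟩)) (ε.symm (0, ⟨k, i'⟩)) * P).trace) := by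
  have hpos : 0 < h := Nat.pos_of_ne_zero (NeZero.ne h)
  have h0 := H.tw y k i i' (h - 1) (by omega)
  have hD : Stab (M0 (blkE ε) (posE ε) Z) (Dx (ext0 ε y)) := H.hw.M0_dC _
  have hE1 : Stab (M0 (blkE ε) (posE ε) Z) (Eh (ε.symm (0, ⟨k, i⟩)) (ε.symm (0, ⟨k, i'⟩))) :=
    H.hw.M0_Eh _ _ (by rw [blkE_symm, blkE_symm])
  have hG : Stab (M0 (blkE ε) (posE ε) Z) (Eh (ε.symm (0, ⟨k, i'⟩)) (ε.symm (0, ⟨k, i⟩))) :=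
    H.hw.M0_Eh _ _ (by rw [blkE_symm, blkE_symm])
  have e1 := H.fE (ε.symm (((h - 1 : ℕ) : ZMod h), ⟨k, i⟩)) (ε.symm (((h - 1 : ℕ) : ZMod h), ⟨k, i'⟩)) (by rw [blkE_symm, blkE_symm])
  have hz : ((h - 1 : ℕ) : ZMod h) + 1 = 0 := by
    have : ((h - 1 + 1 : ℕ) : ZMod h) = 0 := by rw [Nat.sub_add_cancel hpos]; simp
    rw [← this]; push_cast; rfl
  rw [piB_symm, piB_symm, hz] at e1
  have e2 := Dx_Eh (n := n) (ext0 ε y) (ε.symm (0, ⟨k, i⟩)) (ε.symm (0, ⟨k, i'⟩))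
  rw [ext0_symm, ext0_symm, if_pos rfl, if_pos rfl] at e2
  have e3 := Eh_comm (n := n) (ε.symm (0, ⟨k, i'⟩)) (ε.symm (0, ⟨k, i⟩)) (ε.symm (0, ⟨k, i⟩)) (ε.symm (0, ⟨k, i'⟩))
  rw [if_pos rfl, if_pos rfl] at e3
  set D := Dx (n := n) (ext0 ε y)
  set E0 := Eh (n := n) (ε.symm (((h - 1 : ℕ) : ZMod h), ⟨k, i⟩)) (ε.symm (((h - 1 : ℕ) : ZMod h), ⟨k, i'⟩))
  set E1 := Eh (n := n) (ε.symm (0, ⟨k, i⟩)) (ε.symm (0, ⟨k, i'⟩))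
  set G := Eh (n := n) (ε.symm (0, ⟨k, i'⟩)) (ε.symm (0, ⟨k, i⟩))
  set F1 := Eh (n := n) (ε.symm (0, ⟨k, i⟩)) (ε.symm (0, ⟨k, i⟩))
  set F2 := Eh (n := n) (ε.symm (0, ⟨k, i'⟩)) (ε.symm (0, ⟨k, i'⟩))
  clear_value D E0 E1 G F1 F2
  have h1 : D * f * (E0 * G) = D * E1 * (f * G) := by
    calc D * f * (E0 * G) = D * (f * E0) * G := by simp only [mul_assoc]
      _ = (D * E1) * (f * G) := by rw [e1]; simp only [mul_assoc]
  have h2 : y ⟨k, i'⟩ * (D * f * (E1 * G) * P).trace = y ⟨k, i⟩ * (D * f * (G * E1) * P).trace := by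
    rw [h0, h1, ← smul_eq_mul, ← Matrix.trace_smul, ← Matrix.smul_mul, ← Matrix.smul_mul, e2, Matrix.smul_mul,
      Matrix.smul_mul, Matrix.trace_smul, smul_eq_mul]
    congr 1
    have : E1 * D * (f * G) = E1 * (D * f * G) := by simp only [mul_assoc]
    rw [this, H.cyc _ _ hE1 ((hD.mul H.M0_f).mul hG), mul_assoc (D * f) G E1]
  have h3 : D * f * (G * E1) * P = D * f * (E1 * G) * P + D * f * F2 * P - D * f * F1 * P := by
    rw [e3]
    simp only [mul_add, mul_sub, add_mul, sub_mul]
    abel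
  have h4 : (D * f * (G * E1) * P).trace = (D * f * (E1 * G) * P).trace + (D * f * F2 * P).trace -
      (D * f * F1 * P).trace := by
    rw [h3, Matrix.trace_sub, Matrix.trace_add]
  rw [sub_mul, h2, h4]
  ring

lemma CoreP.hS (H : CoreP ε Z L f P) (k : K) (i i' : Fin (N k)) :
    (MvPolynomial.X ⟨k, i⟩ - MvPolynomial.X ⟨k, i'⟩) *
      Ptr ε (f * (Eh (ε.symm (0, ⟨k, i⟩)) (ε.symm (0, ⟨k, i'⟩)) *
      Eh (ε.symm (0, ⟨k, i'⟩)) (ε.symm (0, ⟨k, i⟩))) * P) =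
      MvPolynomial.X ⟨k, i⟩ * (thD ⟨k, i⟩ (Ptr ε (f * P)) - thD ⟨k, i'⟩ (Ptr ε (f * P))) := by
  apply MvPolynomial.funext
  intro y
  have hD : Stab (M0 (blkE ε) (posE ε) Z) (Dx (ext0 ε y)) := H.hw.M0_dC _
  have key : ∀ b, Dx (ext0 ε y) * Eh b b = Eh (n := n) b b * Dx (ext0 ε y) := by
    intro b; rw [Eh_self]; unfold Dx; rw [dC_mul, dC_mul]; simp only [mul_comm]
  have k2 : ∀ b : B, (Dx (ext0 ε y) * (Eh b b * (f * P))).trace = (Dx (ext0 ε y) * f * Eh b b * P).trace := by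
    intro b
    have : Dx (ext0 ε y) * (Eh b b * (f * P)) = Eh b b * (Dx (ext0 ε y) * f) * P := by
      rw [← mul_assoc, key]; simp only [mul_assoc]
    rw [this, H.cyc _ _ (H.hw.M0_Eh _ _ rfl) (hD.mul H.M0_f)]
  rw [thD_Ptr, thD_Ptr]
  simp only [map_mul, map_sub, MvPolynomial.eval_X, Ptr_eval, k2]
  rw [← H.tw_final y k i i']
  simp only [mul_assoc]

lemma sum_blk {A : Type*} [AddCommMonoid A] (s : ZMod h) (k : K) (g : B → A)
    [DecidablePred fun b => blkE ε b = (s, k)] :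
    ∑ b, (if blkE ε b = (s, k) then g b else 0) = ∑ i, g (ε.symm (s, ⟨k, i⟩)) := by
  rw [← Equiv.sum_comp ε.symm, Fintype.sum_prod_type, Finset.sum_eq_single s]
  · rw [Fintype.sum_sigma, Finset.sum_eq_single k]
    · simp [blkE_symm]
    · intro k' _ hk'
      simp [blkE_symm, hk']
    · simp
  · intro s' _ hs'
    simp [blkE_symm, hs']
  · simp

lemma sum_blk_filter {A : Type*} [AddCommMonoid A] (s : ZMod h) (k : K) (g : B → A)
    [DecidablePred fun b => blkE ε b = (s, k)] :
    ∑ b ∈ Finset.univ.filter (fun b => blkE ε b = (s, k)), g b = ∑ i, g (ε.symm (s, ⟨k, i⟩)) := by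
  rw [Finset.sum_filter, sum_blk]

lemma sum_blkC {A : Type*} [AddCommMonoid A] (s : ZMod h) (k : K) (g : B → A) :
    ∑ b, (@ite A (blkE ε b = (s, k)) (Classical.propDecidable _) (g b) 0) = ∑ i, g (ε.symm (s, ⟨k, i⟩)) := by
  exact @sum_blk _ _ _ _ _ _ _ _ _ _ s k g (fun _ => Classical.propDecidable _)

/-- a block as a finset -/
noncomputable def blkS (ε : B ≃ ZMod h × (Σ k, Fin (N k))) (s : ZMod h) (k : K) : Finset B :=
  @Finset.filter B (fun b => blkE ε b = (s, k)) (fun _ => Classical.propDecidable _) Finset.univ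

lemma sum_blkS {A : Type*} [AddCommMonoid A] (s : ZMod h) (k : K) (g : B → A) :
    ∑ b ∈ blkS ε s k, g b = ∑ i, g (ε.symm (s, ⟨k, i⟩)) := by
  exact @sum_blk_filter _ _ _ _ _ _ _ _ _ _ s k g (fun _ => Classical.propDecidable _)

/-- the weight as a finsupp -/
noncomputable def lamE (ε : B ≃ ZMod h × (Σ k, Fin (N k))) (L : B → ℕ) : (Σ k, Fin (N k)) →₀ ℕ :=
  Finsupp.equivFunOnFinite.symm fun a => L (ε.symm (0, a))

lemma CoreP.hC (H : CoreP ε Z L f P) (k : K) :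
    ∑ i, thD ⟨k, i⟩ (thD ⟨k, i⟩ (Ptr ε (f * P))) + ∑ i, ∑ i', (if i ≠ i' then
       Ptr ε (f * (Eh (ε.symm (0, ⟨k, i⟩)) (ε.symm (0, ⟨k, i'⟩)) *
      Eh (ε.symm (0, ⟨k, i'⟩)) (ε.symm (0, ⟨k, i⟩))) * P) else 0) =
      (∑ i, (lamE ε L ⟨k, i⟩ : ℂ) ^ 2 +
        ∑ i, ∑ j, (if i < j then (lamE ε L ⟨k, i⟩ : ℂ) - lamE ε L ⟨k, j⟩ else 0)) • Ptr ε (f * P) := by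
  have h1 : ∀ i, thD ⟨k, i⟩ (thD ⟨k, i⟩ (Ptr ε (f * P))) = Ptr ε (f * (Eh (ε.symm (0, ⟨k, i⟩)) (ε.symm (0, ⟨k, i⟩)) *
      Eh (ε.symm (0, ⟨k, i⟩)) (ε.symm (0, ⟨k, i⟩))) * P) := by
    intro i
    apply MvPolynomial.funext
    intro y
    rw [thD_Ptr, thD_Ptr, Ptr_eval, Ptr_eval]
    set E := Eh (n := n) (ε.symm (0, ⟨k, i⟩)) (ε.symm (0, ⟨k, i⟩)) with hE
    have hD : Stab (M0 (blkE ε) (posE ε) Z) (Dx (ext0 ε y)) := H.hw.M0_dC _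
    have hEs : Stab (M0 (blkE ε) (posE ε) Z) E := H.hw.M0_Eh _ _ rfl
    have key : Dx (ext0 ε y) * E = E * Dx (ext0 ε y) := by
      rw [hE, Eh_self]; unfold Dx; rw [dC_mul, dC_mul]; simp only [mul_comm]
    have : Dx (ext0 ε y) * (E * (E * (f * P))) = (E * E) * (Dx (ext0 ε y) * f) * P := by
      rw [← mul_assoc, key, mul_assoc, ← mul_assoc (Dx _), key]; simp only [mul_assoc]
    rw [this, H.cyc _ _ (hEs.mul hEs) (hD.mul H.M0_f)]
    simp only [mul_assoc]
  have h2 : Cas (blkS ε 0 k) * P =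
    (∑ i, (lamE ε L ⟨k, i⟩ : ℂ) ^ 2 +
        ∑ i, ∑ j, (if i < j then (lamE ε L ⟨k, i⟩ : ℂ) - lamE ε L ⟨k, j⟩ else 0)) • P := by
    have := mul_eq_of_proj (X := Cas (blkS ε 0 k))
      (Y := (∑ i, (lamE ε L ⟨k, i⟩ : ℂ) ^ 2 +
        ∑ i, ∑ j, (if i < j then (lamE ε L ⟨k, i⟩ : ℂ) - lamE ε L ⟨k, j⟩ else 0)) • 1) H.P1 (by
      intro v hv
      have hcas : (Cas (blkS ε 0 k)).mulVec v = (∑ b ∈ blkS ε 0 k, (L b : ℂ) ^ 2 +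
        ∑ b ∈ blkS ε 0 k, ∑ b' ∈ blkS ε 0 k, (if posE ε b < posE ε b' then (L b : ℂ) - L b' else 0)) • v := by
        convert H.hw.M0_cas ((0 : ZMod h), k) v hv <;> rfl
      rw [hcas, Matrix.smul_mulVec, Matrix.one_mulVec]
      congr 1
      rw [sum_blkS, sum_blkS]
      simp only [sum_blkS, posE_symm]
      rfl)
    rw [this, Matrix.smul_mul, one_mul]
  have h3 : Ptr ε (f * (Cas (blkS ε 0 k) * P)) =
    ∑ i, ∑ i', Ptr ε (f * (Eh (ε.symm (0, ⟨k, i⟩)) (ε.symm (0, ⟨k, i'⟩)) *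
      Eh (ε.symm (0, ⟨k, i'⟩)) (ε.symm (0, ⟨k, i⟩))) * P) := by
    unfold Cas
    rw [sum_blkS]
    simp only [sum_blkS, Finset.sum_mul, Finset.mul_sum, Ptr_sum, mul_assoc]
  rw [← Ptr_smul, ← Matrix.mul_smul, ← h2, h3, ← Finset.sum_add_distrib]
  refine Finset.sum_congr rfl fun i _ => ?_
  rw [h1]
  have gen : ∀ g : Fin (N k) → MvPolynomial (Σ k, Fin (N k)) ℂ, g i + ∑ i', (if i ≠ i' then g i' else 0) = ∑ i', g i' := by
    intro g
    have : ∀ i', g i' = (if i = i' then g i' else 0) + (if i ≠ i' then g i' else 0) := by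
      intro i'; by_cases hh : i = i' <;> simp [hh]
    rw [Finset.sum_congr rfl fun i' _ => this i', Finset.sum_add_distrib]
    congr 1
    simp
  exact gen fun i' => Ptr ε (f * (Eh (ε.symm (0, ⟨k, i⟩)) (ε.symm (0, ⟨k, i'⟩)) *
      Eh (ε.symm (0, ⟨k, i'⟩)) (ε.symm (0, ⟨k, i⟩))) * P)

lemma CoreP.supp_dom (H : CoreP ε Z L f P) (β) (hβ : MvPolynomial.coeff β (Ptr ε (f * P)) ≠ 0) :
    ∃ c, Dom (blkE ε) (posE ε) L c ∧ ∀ a, c (ε.symm (0, a)) = β a := by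
  unfold Ptr at hβ
  rw [MvPolynomial.coeff_sum] at hβ
  obtain ⟨t, -, ht⟩ := Finset.exists_ne_zero_of_sum_ne_zero hβ
  rw [MvPolynomial.coeff_monomial] at ht
  have h1 : bet ε t = β := by by_contra hh; rw [if_neg hh] at ht; exact ht rfl
  rw [if_pos h1] at ht
  refine ⟨cont t, ?_, fun a => by rw [← h1]; rfl⟩
  have h2 : (f * P).mulVec (Pi.single t 1) ∈ M0 (blkE ε) (posE ε) Z := by
    rw [← Matrix.mulVec_mulVec]; exact H.M0_f _ (H.P1 _)
  apply H.hw.M0_dom h2 t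
  rw [Matrix.mulVec_single_one]
  exact ht

lemma CoreP.hdom (H : CoreP ε Z L f P) (β) (hβ : MvPolynomial.coeff β (Ptr ε (f * P)) ≠ 0) (k r) :
    psum (fun i => β ⟨k, i⟩) r ≤ psum (fun i => lamE ε L ⟨k, i⟩) r := by
  obtain ⟨c, hc, hca⟩ := H.supp_dom β hβ
  have := hc.1 (0, k) r
  have e : ∀ (c : B → ℕ), ∑ b, (@ite ℕ (blkE ε b = (0, k) ∧ posE ε b < r) (@instDecidableAnd _ _ (Classical.propDecidable _) _) (c b) 0) =
      psum (fun i => c (ε.symm (0, ⟨k, i⟩))) r := by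
    intro c
    have := sum_blk (ε := ε) 0 k (fun b => if posE ε b < r then c b else 0)
    simp only [posE_symm] at this
    unfold psum
    rw [← this]
    refine Finset.sum_congr rfl fun b _ => ?_
    by_cases h1 : blkE ε b = (0, k) <;> simp [h1]
  rw [e, e] at this
  simp only [hca] at this
  exact this

lemma CoreP.htot (H : CoreP ε Z L f P) (β) (hβ : MvPolynomial.coeff β (Ptr ε (f * P)) ≠ 0) (k) :
    ∑ i, β ⟨k, i⟩ = ∑ i, lamE ε L ⟨k, i⟩ := by
  obtain ⟨c, hc, hca⟩ := H.supp_dom β hβ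
  have := hc.2 (0, k)
  rw [sum_blkC, sum_blkC] at this
  simp only [hca] at this
  exact this

/-- block permutation -/
def permE (ε : B ≃ ZMod h × (Σ k, Fin (N k))) (u : ∀ k, Equiv.Perm (Fin (N k))) : B ≃ B :=
  ε.trans ((Equiv.prodCongr (Equiv.refl _) (Equiv.sigmaCongrRight u)).trans ε.symm)

lemma permE_symm (u : ∀ k, Equiv.Perm (Fin (N k))) (s : ZMod h) (a : Σ k, Fin (N k)) :
    permE ε u (ε.symm (s, a)) = ε.symm (s, Equiv.sigmaCongrRight u a) := by
  unfold permE
  rw [Equiv.trans_apply, Equiv.trans_apply, Equiv.apply_symm_apply]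
  rfl

lemma permE_blk (u : ∀ k, Equiv.Perm (Fin (N k))) (b : B) : blkE ε (permE ε u b) = blkE ε b := by
  obtain ⟨⟨s, a⟩, rfl⟩ := ε.symm.surjective b
  rw [permE_symm, blkE_symm, blkE_symm]
  rfl

lemma permE_pi (u : ∀ k, Equiv.Perm (Fin (N k))) (b : B) : permE ε u (piB ε b) = piB ε (permE ε u b) := by
  obtain ⟨⟨s, a⟩, rfl⟩ := ε.symm.surjective b
  rw [permE_symm, piB_symm, piB_symm, permE_symm]

lemma CoreP.hsym (H : CoreP ε Z L f P) (u : ∀ k, Equiv.Perm (Fin (N k))) :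
    MvPolynomial.rename (Equiv.sigmaCongrRight u) (Ptr ε (f * P)) = Ptr ε (f * P) := by
  apply MvPolynomial.funext
  intro y
  rw [MvPolynomial.eval_rename, Ptr_eval, Ptr_eval]
  set v := permE ε u with hv
  have h1 : ext0 ε (y ∘ Equiv.sigmaCongrRight u) = ext0 ε y ∘ v := by
    funext b
    obtain ⟨⟨s, a⟩, rfl⟩ := ε.symm.surjective b
    rw [Function.comp_apply, hv, permE_symm, ext0_symm, ext0_symm]
    rfl
  set R : Matrix B B ℂ := (1 : Matrix B B ℂ).submatrix id v with hR
  set R' : Matrix B B ℂ := (1 : Matrix B B ℂ).submatrix v id with hR'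
  have bR : BD (blkE ε) R := by
    intro b b' hb
    rw [hR, Matrix.submatrix_apply, Matrix.one_apply_ne]
    rintro h2
    apply hb
    rw [show b = v b' from h2, hv, permE_blk]
  have bR' : BD (blkE ε) R' := by
    intro b b' hb
    rw [hR', Matrix.submatrix_apply, Matrix.one_apply_ne]
    rintro h2
    apply hb
    rw [← show v b = b' from h2, hv, permE_blk]
  have hRR : R * R' = 1 := by
    rw [hR, hR']
    have := Matrix.submatrix_mul_equiv (1 : Matrix B B ℂ) (1 : Matrix B B ℂ) id v id
    rw [this, one_mul]; rfl
  have hconj : R' * Matrix.diagonal (ext0 ε y) * R = Matrix.diagonal (ext0 ε y ∘ v) := by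
    have e1 : R' * Matrix.diagonal (ext0 ε y) = (Matrix.diagonal (ext0 ε y)).submatrix v id := by
      have := Matrix.submatrix_mul_equiv (1 : Matrix B B ℂ) (Matrix.diagonal (ext0 ε y)) v (Equiv.refl B) id
      rw [one_mul] at this; exact this
    have e2 : (Matrix.diagonal (ext0 ε y)).submatrix v id * R = (Matrix.diagonal (ext0 ε y)).submatrix v v := by
      have := Matrix.submatrix_mul_equiv (Matrix.diagonal (ext0 ε y)) (1 : Matrix B B ℂ) v (Equiv.refl B) v
      rw [mul_one] at this; exact this
    rw [e1, e2, Matrix.submatrix_diagonal_equiv]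
  have hfR : f * tP R = tP R * f := by
    rw [H.fP R bR]
    congr 2
    ext b b'
    rw [hR]
    simp only [Matrix.submatrix_apply, id, Matrix.one_apply]
    have : (piB ε).symm b = v ((piB ε).symm b') ↔ b = v b' := by
      rw [Equiv.symm_apply_eq, hv, ← permE_pi, Equiv.apply_symm_apply]
    simp only [this]
  have hD : Stab (M0 (blkE ε) (posE ε) Z) (Dx (ext0 ε y)) := H.hw.M0_dC _
  have sR := H.hw.M0_tP R bR
  have sR' := H.hw.M0_tP R' bR'
  have e : Dx (n := n) (ext0 ε y ∘ v) = tP R' * Dx (ext0 ε y) * tP R := by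
    rw [Dx_eq_tP, Dx_eq_tP, tP_mul, tP_mul, hconj]
  rw [h1, e]
  have : tP R' * Dx (ext0 ε y) * tP R * (f * P) = tP R' * (Dx (ext0 ε y) * (f * tP R)) * P := by
    rw [hfR]; simp only [mul_assoc]
  rw [this, H.cyc _ _ sR' (hD.mul (H.M0_f.mul sR))]
  have : Dx (ext0 ε y) * (f * tP R) * tP R' * P = Dx (ext0 ε y) * (f * ((tP R * tP R') * P)) := by
    simp only [mul_assoc]
  rw [this, tP_mul, hRR, tP_one, one_mul]

lemma inv_of_pi (c : B → ℕ) (hc : ∀ b, c (piB ε b) = c b) (s : ZMod h) (a) :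
    c (ε.symm (s, a)) = c (ε.symm (0, a)) := by
  have : ∀ s : ℕ, c (ε.symm ((s : ZMod h), a)) = c (ε.symm (0, a)) := by
    intro s
    induction s with
    | zero => rw [Nat.cast_zero]
    | succ s ih => rw [← ih, ← hc (ε.symm ((s : ZMod h), a)), piB_symm]; push_cast; rfl
  rw [← this s.val, ZMod.natCast_zmod_val]

theorem CoreP.final (H : CoreP ε Z L f P) (x : B → ℂ) :
    GreenII.traceOn (M0 (blkE ε) (posE ε) Z) (Matrix.mulVecLin (Dx x * f)) =
    (∏ k, schurGen (N k) (fun i => L (ε.symm (0, ⟨k, i⟩))) (fun i => ∏ s, x (ε.symm (s, ⟨k, i⟩)))) *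
      GreenII.traceOn Z (Matrix.mulVecLin f) := by
  have hD : Stab (M0 (blkE ε) (posE ε) Z) (Dx x) := H.hw.M0_dC _
  rw [H.traceOn _ (hD.mul H.M0_f)]
  have h1 : (Dx x * f * P).trace = (Dx (ext0 ε fun a => ∏ s, x (ε.symm (s, a))) * f * P).trace := by
    apply H.tr_pi
    intro β hβ
    rw [prod_ext0, prodE ε]
    refine Finset.prod_congr rfl fun a _ => ?_
    rw [← Finset.prod_pow]
    refine Finset.prod_congr rfl fun s _ => ?_
    rw [inv_of_pi β hβ s a]
  have h2 := weyl (Ptr ε (f * P)) (lamE ε L) (fun k => H.Lanti 0 k) H.hdom H.htot H.hsym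
    (fun k i i' => Ptr ε (f * (Eh (ε.symm (0, ⟨k, i⟩)) (ε.symm (0, ⟨k, i'⟩)) *
      Eh (ε.symm (0, ⟨k, i'⟩)) (ε.symm (0, ⟨k, i⟩))) * P)) (fun k i i' _ => H.hS k i i') (fun k => by
        convert H.hC k)
  have h3 : MvPolynomial.coeff (lamE ε L) (Ptr ε (f * P)) = GreenII.traceOn Z (Matrix.mulVecLin f) := by
    rw [Ptr_coeff, ← mul_assoc, H.tr_pi _ (fun c => if c = L then 1 else 0)]
    · symm
      apply traceOn_eq
      · intro v
        rw [mul_assoc, ← Matrix.mulVec_mulVec]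
        apply H.hw.M0_top
        rw [← Matrix.mulVec_mulVec]
        exact H.M0_f _ (H.P1 _)
      · intro v hv
        rw [← Matrix.mulVec_mulVec, H.P2 v (le_M0 hv), ← Matrix.mulVec_mulVec, H.hw.dC_mulVec _ _ (H.fZ v hv),
          if_pos rfl, one_smul]
    · intro β hβ
      have : ((fun a => β (ε.symm (0, a))) = ⇑(lamE ε L)) ↔ β = L := by
        constructor
        · intro h4
          funext b
          obtain ⟨⟨s, a⟩, rfl⟩ := ε.symm.surjective b
          rw [inv_of_pi β hβ, inv_of_pi L H.Linv]
          exact congrFun h4 a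
        · rintro rfl; rfl
      simp only [this]
  rw [h1, mul_assoc, ← Ptr_eval, h2, h3, map_mul, MvPolynomial.eval_C, mul_comm, map_prod]
  congr 1
  refine Finset.prod_congr rfl fun k _ => ?_
  rw [schurGen_map]
  simp only [MvPolynomial.eval_X]
  rfl

theorem Core.final (H : Core ε Z L f) (x : B → ℂ) :
    GreenII.traceOn (M0 (blkE ε) (posE ε) Z) (Matrix.mulVecLin (Dx x * f)) =
    (∏ k, schurGen (N k) (fun i => L (ε.symm (0, ⟨k, i⟩))) (fun i => ∏ s, x (ε.symm (s, ⟨k, i⟩)))) *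
      GreenII.traceOn Z (Matrix.mulVecLin f) := by
  obtain ⟨P, h1, h2⟩ := exists_proj (M0 (blkE ε) (posE ε) Z)
  exact CoreP.final ⟨H, h1, h2⟩ x

end Core2


section UP
variable {B : Type*} [Fintype B] {n : ℕ} {κ : Type*}

/-- permutation matrix -/
noncomputable def pM (σ : Equiv.Perm B) : Matrix B B ℂ := fun b' b => if b' = σ b then 1 else 0

/-- permutation of basis vectors acting on tensors -/
noncomputable def uP (σ : Equiv.Perm B) : Matrix (Fin n → B) (Fin n → B) ℂ := tP (pM σ)

lemma pM_mul (σ : Equiv.Perm B) (g : Matrix B B ℂ) (b b' : B) : (pM σ * g) b b' = g (σ.symm b) b' := by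
  rw [Matrix.mul_apply, Finset.sum_eq_single (σ.symm b)]
  · simp [pM]
  · intro c _ hc
    have : b ≠ σ c := by rintro rfl; simp at hc
    simp [pM, this]
  · simp

lemma mul_pM (σ : Equiv.Perm B) (g : Matrix B B ℂ) (b b' : B) : (g * pM σ) b b' = g b (σ b') := by
  rw [Matrix.mul_apply, Finset.sum_eq_single (σ b')]
  · simp [pM]
  · intro c _ hc
    simp [pM, hc]
  · simp

lemma pM_mul_pM (σ σ' : Equiv.Perm B) : pM σ * pM σ' = pM (σ * σ') := by
  ext b b'
  rw [pM_mul]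
  unfold pM
  refine if_congr ?_ rfl rfl
  rw [Equiv.symm_apply_eq]; rfl

lemma pM_one : pM (1 : Equiv.Perm B) = 1 := by
  ext b b'
  rw [Matrix.one_apply]
  exact if_congr Iff.rfl rfl rfl

lemma uP_mul (σ σ' : Equiv.Perm B) : uP (n := n) σ * uP σ' = uP (σ * σ') := by
  unfold uP; rw [tP_mul, pM_mul_pM]

lemma uP_one : uP (n := n) (1 : Equiv.Perm B) = 1 := by
  unfold uP; rw [pM_one, tP_one]

lemma uP_pow (σ : Equiv.Perm B) (i : ℕ) : uP (n := n) σ ^ i = uP (σ ^ i) := by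
  induction i with
  | zero => rw [pow_zero, pow_zero, uP_one]
  | succ i ih => rw [pow_succ, pow_succ, ih, uP_mul]

lemma uP_apply (σ : Equiv.Perm B) (t' t : Fin n → B) : uP σ t' t = if t' = σ ∘ t then 1 else 0 := by
  unfold uP tP
  rw [tF_apply]
  by_cases h : t' = σ ∘ t
  · subst h; simp [pM]
  · rw [if_neg h]
    obtain ⟨s, hs⟩ := Function.ne_iff.mp h
    apply Finset.prod_eq_zero (Finset.mem_univ s)
    unfold pM; exact if_neg hs

lemma uP_mul_apply (σ : Equiv.Perm B) (M : Matrix (Fin n → B) (Fin n → B) ℂ) (t' t : Fin n → B) :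
    (uP (n := n) σ * M : Matrix (Fin n → B) (Fin n → B) ℂ) t' t = M (σ.symm ∘ t') t := by
  rw [Matrix.mul_apply, Finset.sum_eq_single (σ.symm ∘ t')]
  · rw [uP_apply, if_pos (by funext s; simp), one_mul]
  · intro u _ hu
    rw [uP_apply, if_neg, zero_mul]
    rintro rfl
    apply hu; funext s; simp
  · simp

lemma mul_uP_apply (σ : Equiv.Perm B) (M : Matrix (Fin n → B) (Fin n → B) ℂ) (t' t : Fin n → B) :
    (M * uP (n := n) σ : Matrix (Fin n → B) (Fin n → B) ℂ) t' t = M t' (σ ∘ t) := by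
  rw [Matrix.mul_apply, Finset.sum_eq_single (σ ∘ t)]
  · rw [uP_apply, if_pos rfl, mul_one]
  · intro u _ hu
    rw [uP_apply, if_neg hu, mul_zero]
  · simp

lemma uP_mulVec (σ : Equiv.Perm B) (v : (Fin n → B) → ℂ) (t : Fin n → B) :
    (uP σ).mulVec v t = v (σ.symm ∘ t) := by
  rw [Matrix.mulVec, dotProduct, Finset.sum_eq_single (σ.symm ∘ t)]
  · rw [uP_apply, if_pos (by funext s; simp), one_mul]
  · intro u _ hu
    rw [uP_apply, if_neg, zero_mul]
    rintro rfl
    apply hu; funext s; simp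
  · simp

lemma uP_tP (σ : Equiv.Perm B) (g : Matrix B B ℂ) :
    uP (n := n) σ * tP g = tP (g.submatrix σ.symm σ.symm) * uP σ := by
  unfold uP
  rw [tP_mul, tP_mul]
  congr 1
  ext b b'
  rw [pM_mul, mul_pM]
  simp

lemma fHat_gen (blk : B → κ) (σ : Equiv.Perm B) (f : Matrix (Fin n → B) (Fin n → B) ℂ)
    (fP : ∀ g, BD blk g → f * tP g = tP (g.submatrix σ.symm σ.symm) * f)
    (X : Matrix B B ℂ) (hX : BD blk X) :
    f * hat X = hat (X.submatrix σ.symm σ.symm) * f := by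
  rcases Nat.eq_zero_or_pos n with rfl | hn
  · have : ∀ X, hat (B := B) (n := 0) X = 0 := fun X => by simp [hat]
    rw [this, this, mul_zero, zero_mul]
  have := poly_vec (⊥ : Submodule ℂ (Matrix (Fin n → B) (Fin n → B) ℂ)) (n + 1)
    (fun k => f * eK k X - eK k (X.submatrix σ.symm σ.symm) * f) Set.univ Set.infinite_univ (by
    intro t _
    rw [Submodule.mem_bot]
    have h1 := fP (1 + t • X) (BD.one.add (hX.smul t))
    have h2 : (1 + t • X).submatrix σ.symm σ.symm =
        1 + t • X.submatrix σ.symm σ.symm := by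
      rw [Matrix.submatrix_add, Matrix.submatrix_smul, Pi.add_apply, Pi.add_apply, Matrix.submatrix_one_equiv,
        Pi.smul_apply, Pi.smul_apply]
    rw [h2, tP_expand, tP_expand, Finset.mul_sum, Finset.sum_mul, ← sub_eq_zero, ← Finset.sum_sub_distrib] at h1
    rw [← h1]
    refine Finset.sum_congr rfl fun k _ => ?_
    rw [smul_sub, Matrix.mul_smul, Matrix.smul_mul]) 1 (by omega)
  rw [Submodule.mem_bot, eK_one, eK_one, sub_eq_zero] at this
  exact this

lemma fE_gen (blk : B → κ) (σ : Equiv.Perm B) (f : Matrix (Fin n → B) (Fin n → B) ℂ)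
    (fP : ∀ g, BD blk g → f * tP g = tP (g.submatrix σ.symm σ.symm) * f) (b b' : B) (hb : blk b = blk b') :
    f * Eh b b' = Eh (σ b) (σ b') * f := by
  unfold Eh
  rw [fHat_gen blk σ f fP _ (BD_single b b' hb)]
  congr 2
  ext c c'
  simp only [Matrix.submatrix_apply, Matrix.single_apply, Equiv.eq_symm_apply]

lemma M0_congr {κ' : Type*} (blk : B → κ) (blk' : B → κ') (pos : B → ℕ) (h : ∀ b b', blk b = blk b' ↔ blk' b = blk' b')
    (Z : Submodule ℂ ((Fin n → B) → ℂ)) : M0 blk pos Z = M0 blk' pos Z := by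
  unfold M0
  simp only [h]

lemma M0_maps (blk : B → κ) (pos : B → ℕ) (σ : Equiv.Perm B) (f : Matrix (Fin n → B) (Fin n → B) ℂ)
    (fP : ∀ g, BD blk g → f * tP g = tP (g.submatrix σ.symm σ.symm) * f)
    (hσ : ∀ b b', blk b = blk b' → blk (σ b) = blk (σ b')) (hpos : ∀ b, pos (σ b) = pos b)
    (Z Z' : Submodule ℂ ((Fin n → B) → ℂ)) (hZ : ∀ z ∈ Z, f.mulVec z ∈ Z') :
    ∀ v ∈ M0 blk pos Z, f.mulVec v ∈ M0 blk pos Z' := by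
  have : M0 blk pos Z ≤ (M0 blk pos Z').comap (Matrix.mulVecLin f) := by
    apply M0_le
    · intro z hz
      exact le_M0 (hZ z hz)
    · intro b b' h1 h2 v hv
      rw [Submodule.mem_comap, Matrix.mulVecLin_apply] at hv ⊢
      rw [Matrix.mulVec_mulVec, fE_gen blk σ f fP b b' h1, ← Matrix.mulVec_mulVec]
      exact M0_low _ _ (hσ _ _ h1) (by rw [hpos, hpos]; exact h2) _ hv
  exact this

lemma Dom_antisymm (blk : B → κ) (pos : B → ℕ) (inj : ∀ b b', blk b = blk b' → pos b = pos b' → b = b')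
    (L L' : B → ℕ) (h : Dom blk pos L L') (h' : Dom blk pos L' L) : L = L' := by
  funext b
  have key : ∀ L : B → ℕ, ∑ x, (if blk x = blk b ∧ pos x < pos b + 1 then L x else 0) =
      ∑ x, (if blk x = blk b ∧ pos x < pos b then L x else 0) + L b := by
    intro L
    have : L b = ∑ x, (if x = b then L x else 0) := by simp
    rw [this, ← Finset.sum_add_distrib]
    refine Finset.sum_congr rfl fun x _ => ?_
    by_cases hx : x = b
    · subst hx; simp
    · by_cases hb : blk x = blk b
      · have : pos x ≠ pos b := fun hh => hx (inj _ _ hb hh)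
        by_cases h3 : pos x < pos b
        · simp [hx, hb, h3, Nat.lt_succ_of_lt h3]
        · have : ¬ pos x < pos b + 1 := by omega
          simp [hx, h3, this]
      · simp [hb, hx]
  have a1 := h.1 (blk b) (pos b + 1)
  have a2 := h.1 (blk b) (pos b)
  have b1 := h'.1 (blk b) (pos b + 1)
  have b2 := h'.1 (blk b) (pos b)
  rw [key, key] at a1 b1
  omega

lemma hat_conjTranspose (b b' : B) : (Eh (n := n) b b').conjTranspose = Eh b' b := by
  unfold Eh hat
  rw [Matrix.conjTranspose_sum]
  refine Finset.sum_congr rfl fun s _ => ?_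
  ext t' t
  rw [Matrix.conjTranspose_apply, tF_apply, tF_apply, star_prod]
  refine Finset.prod_congr rfl fun s' _ => ?_
  by_cases h : s' = s
  · subst h
    simp only [Function.update_self, Matrix.single_apply]
    by_cases h1 : b = t s' ∧ b' = t' s'
    · rw [if_pos h1, if_pos ⟨h1.2, h1.1⟩, star_one]
    · rw [if_neg h1, if_neg (fun h2 => h1 ⟨h2.2, h2.1⟩), star_zero]
  · simp only [Function.update_of_ne h, Pi.one_apply, Matrix.one_apply]
    by_cases h1 : t s' = t' s'
    · rw [if_pos h1, if_pos h1.symm, star_one]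
    · rw [if_neg h1, if_neg (fun h2 => h1 h2.symm), star_zero]

/-- orthogonal complement -/
def orth (S : Submodule ℂ ((Fin n → B) → ℂ)) : Submodule ℂ ((Fin n → B) → ℂ) where
  carrier := {u | ∀ v ∈ S, star v ⬝ᵥ u = 0}
  zero_mem' := fun v _ => by simp
  add_mem' := fun {a b} ha hb v hv => by rw [dotProduct_add, ha v hv, hb v hv, add_zero]
  smul_mem' := fun c u hu v hv => by rw [dotProduct_smul, hu v hv, smul_zero]

lemma orth_comm {S S' : Submodule ℂ ((Fin n → B) → ℂ)} (h : S ≤ orth S') : S' ≤ orth S := by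
  intro u hu v hv
  have := h hv u hu
  rw [Matrix.star_dotProduct, this, star_zero]

lemma orth_stab {S : Submodule ℂ ((Fin n → B) → ℂ)} (b b' : B) (h : Stab S (Eh b' b)) : Stab (orth S) (Eh b b') := by
  intro u hu v hv
  have := hu _ (h v hv)
  rw [Matrix.star_mulVec, hat_conjTranspose] at this
  rw [Matrix.dotProduct_mulVec]
  exact this

lemma HW.orth_M0 {blk : B → κ} {pos : B → ℕ} {Z Z' : Submodule ℂ ((Fin n → B) → ℂ)} {L L' : B → ℕ}
    (H : HW blk pos Z L) (H' : HW blk pos Z' L') (hD : ¬ Dom blk pos L' L) :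
    M0 blk pos Z ≤ orth (M0 blk pos Z') := by
  apply M0_le
  · intro z hz v hv
    apply Finset.sum_eq_zero
    intro t _
    by_contra hne
    have h1 : z t ≠ 0 := fun h => hne (by rw [h, mul_zero])
    have h2 : v t ≠ 0 := fun h => hne (by simp [h])
    have h3 := H'.M0_dom hv t h2
    rw [H.wt z hz t h1] at h3
    exact hD h3
  · intro b b' h1 _
    exact orth_stab b b' (H'.M0_Eh _ _ h1.symm)

lemma HW.orth_ne {blk : B → κ} {pos : B → ℕ} {Z Z' : Submodule ℂ ((Fin n → B) → ℂ)} {L L' : B → ℕ}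
    (H : HW blk pos Z L) (H' : HW blk pos Z' L') (hne : L ≠ L') :
    M0 blk pos Z ≤ orth (M0 blk pos Z') := by
  by_cases hD : Dom blk pos L' L
  · apply orth_comm
    apply H'.orth_M0 H
    intro hD'
    exact hne (Dom_antisymm blk pos H.inj L L' hD' hD)
  · exact H.orth_M0 H' hD

open scoped ComplexOrder in
lemma orth_disj (S : Submodule ℂ ((Fin n → B) → ℂ)) : Disjoint S (orth S) := by
  rw [Submodule.disjoint_def]
  intro v hv hv'
  exact dotProduct_star_self_eq_zero.mp (hv' v hv)

lemma exists_proj2 (A C : Submodule ℂ ((Fin n → B) → ℂ)) (h : Disjoint A C) :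
    ∃ P : Matrix (Fin n → B) (Fin n → B) ℂ, (∀ v, P.mulVec v ∈ A) ∧ (∀ v ∈ A, P.mulVec v = v) ∧
      ∀ v ∈ C, P.mulVec v = 0 := by
  obtain ⟨C', hC, hc⟩ := h.symm.exists_isCompl
  refine ⟨LinearMap.toMatrix' (A.subtype ∘ₗ Submodule.linearProjOfIsCompl A C' hc.symm), ?_, ?_, ?_⟩
  · intro v; rw [LinearMap.toMatrix'_mulVec]; exact Subtype.mem _
  · intro v hv; rw [LinearMap.toMatrix'_mulVec]
    have := Submodule.linearProjOfIsCompl_apply_left hc.symm ⟨v, hv⟩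
    simp only [LinearMap.comp_apply, Submodule.subtype_apply]
    exact congrArg Subtype.val this
  · intro v hv; rw [LinearMap.toMatrix'_mulVec]
    have := Submodule.linearProjOfIsCompl_apply_right hc.symm ⟨v, hC hv⟩
    simp only [LinearMap.comp_apply, Submodule.subtype_apply]
    exact congrArg Subtype.val this

/-- trace on an orthogonal sum of permuted subspaces -/
lemma trace_sup {ι : Type*} [Fintype ι] (S : ι → Submodule ℂ ((Fin n → B) → ℂ))
    (ho : ∀ i i', i ≠ i' → S i ≤ orth (S i')) (Y : Matrix (Fin n → B) (Fin n → B) ℂ)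
    (π : ι → ι) (hY : ∀ i, ∀ v ∈ S i, Y.mulVec v ∈ S (π i)) :
    traceOn (⨆ i, S i) (Matrix.mulVecLin Y) =
      ∑ i, if π i = i then traceOn (S i) (Matrix.mulVecLin Y) else 0 := by
  have h0 : ∀ i, ∃ P : Matrix (Fin n → B) (Fin n → B) ℂ, (∀ v, P.mulVec v ∈ S i) ∧ (∀ v ∈ S i, P.mulVec v = v) ∧
      ∀ v ∈ orth (S i), P.mulVec v = 0 := fun i => exists_proj2 _ _ (orth_disj _)
  choose P p1 p2 p3 using h0
  have hU : ∀ i, S i ≤ ⨆ i, S i := fun i => le_iSup S i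
  have h1 : ∀ v ∈ ⨆ i, S i, (∑ i, P i).mulVec v = v := by
    have : (⨆ i, S i) ≤ LinearMap.eqLocus (Matrix.mulVecLin (∑ i, P i)) LinearMap.id := by
      apply iSup_le
      intro i v hv
      rw [LinearMap.mem_eqLocus, Matrix.mulVecLin_apply, Matrix.sum_mulVec, Finset.sum_eq_single i]
      · exact p2 i v hv
      · intro i' _ hi'
        exact p3 i' v (ho i i' hi'.symm hv)
      · simp
    intro v hv
    exact this hv
  rw [traceOn_eq _ Y (Y * ∑ i, P i)]
  · rw [Finset.mul_sum, Matrix.trace_sum]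
    refine Finset.sum_congr rfl fun i _ => ?_
    by_cases hi : π i = i
    · rw [if_pos hi]
      symm
      apply traceOn_eq
      · intro v
        rw [← Matrix.mulVec_mulVec]
        have := hY i _ (p1 i v)
        rwa [hi] at this
      · intro v hv
        rw [← Matrix.mulVec_mulVec, p2 i v hv]
    · rw [if_neg hi]
      have e1 : P (π i) * Y * P i = Y * P i := by
        have := mul_eq_of_proj (X := P (π i) * Y) (Y := Y) (p1 i) (by
          intro v hv
          rw [← Matrix.mulVec_mulVec]
          exact p2 _ _ (hY i v hv))
        exact this
      have e2 : P i * P (π i) = 0 := by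
        have := mul_eq_of_proj (X := P i) (Y := 0) (p1 (π i)) (by
          intro v hv
          rw [Matrix.zero_mulVec]
          exact p3 i v (ho _ _ hi hv))
        rw [this, zero_mul]
      rw [← e1, mul_assoc, Matrix.trace_mul_comm, mul_assoc, e2, mul_zero, Matrix.trace_zero]
  · intro v
    rw [← Matrix.mulVec_mulVec, Matrix.sum_mulVec, Matrix.mulVec_sum]
    exact Submodule.sum_mem _ fun i _ => hU _ (hY i _ (p1 i v))
  · intro v hv
    rw [← Matrix.mulVec_mulVec, h1 v hv]

lemma traceOn_map (S : Submodule ℂ ((Fin n → B) → ℂ)) (A A' Y X : Matrix (Fin n → B) (Fin n → B) ℂ) (hA : A' * A = 1)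
    (μ : ℂ) (hX : Stab S X) (hY : ∀ v ∈ S, Y.mulVec (A.mulVec v) = μ • A.mulVec (X.mulVec v)) :
    traceOn (S.map (Matrix.mulVecLin A)) (Matrix.mulVecLin Y) = μ * traceOn S (Matrix.mulVecLin X) := by
  obtain ⟨P, p1, p2⟩ := exists_proj S
  have hAv : ∀ v, A'.mulVec (A.mulVec v) = v := fun v => by rw [Matrix.mulVec_mulVec, hA, Matrix.one_mulVec]
  rw [traceOn_eq S X (X * P), traceOn_eq _ Y (μ • (A * (X * P) * A')), Matrix.trace_smul, smul_eq_mul,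
    Matrix.trace_mul_comm, ← mul_assoc, hA, one_mul]
  · intro v
    rw [Matrix.smul_mulVec, ← Matrix.mulVec_mulVec, ← Matrix.mulVec_mulVec, ← Matrix.mulVec_mulVec]
    exact Submodule.smul_mem _ _ ⟨_, hX _ (p1 _), rfl⟩
  · rintro _ ⟨v, hv, rfl⟩
    rw [Matrix.mulVecLin_apply, hY v hv, Matrix.smul_mulVec, ← Matrix.mulVec_mulVec, ← Matrix.mulVec_mulVec,
      ← Matrix.mulVec_mulVec, hAv, p2 v hv]
  · intro v; rw [← Matrix.mulVec_mulVec]; exact hX _ (p1 v)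
  · intro v hv; rw [← Matrix.mulVec_mulVec, p2 v hv]

end UP


lemma ite_inst {p q : Prop} {ip : Decidable p} {iq : Decidable q} {X : Type*} {x y : X} (h : p ↔ q) :
    @ite X p ip x y = @ite X q iq x y := by
  by_cases hp : p
  · exact (if_pos hp).trans (if_pos (h.mp hp)).symm
  · exact (if_neg hp).trans (if_neg (fun hq => hp (h.mpr hq))).symm

section Gen
variable {B : Type*} [Fintype B] {n : ℕ}

lemma kill_gen (z : (Fin n → B) → ℂ) (b b' : B) (hn : 0 < n)
    (h1 : ∀ t : ℂ, (tP (1 + t • Matrix.single b b' 1)).mulVec z = z) : (Eh b b').mulVec z = 0 := by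
  have := poly_vec (⊥ : Submodule ℂ ((Fin n → B) → ℂ)) (n + 1)
      (fun k => if k = 0 then 0 else (eK k (Matrix.single b b' 1)).mulVec z) Set.univ Set.infinite_univ (by
      intro t _
      rw [Submodule.mem_bot]
      have h2 := h1 t
      rw [tP_expand, Matrix.sum_mulVec, Finset.sum_range_succ'] at h2
      rw [Finset.sum_range_succ', if_pos rfl, smul_zero, add_zero]
      rw [eK_zero, pow_zero, one_smul, Matrix.one_mulVec, add_eq_right] at h2
      rw [← h2]
      refine Finset.sum_congr rfl fun k _ => ?_
      rw [if_neg (Nat.succ_ne_zero k), Matrix.smul_mulVec]) 1 (by omega)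
  rw [Submodule.mem_bot, if_neg one_ne_zero, eK_one] at this
  exact this

lemma wt_gen (z : (Fin n → B) → ℂ) (L : B → ℕ)
    (h : ∀ dv : B → ℂ, (tP (Matrix.diagonal dv)).mulVec z = (∏ b, dv b ^ L b) • z)
    (t : Fin n → B) (ht : z t ≠ 0) : cont t = L := by
  funext b
  have h2 := h (fun c => if c = b then 2 else 1)
  have h3 := congrFun h2 t
  rw [← Dx_eq_tP, Dx, dC, Matrix.mulVec_diagonal, Pi.smul_apply, smul_eq_mul] at h3
  have h4 := mul_right_cancel₀ ht h3
  have key : ∀ f : B → ℕ, ∏ c, (if c = b then (2 : ℂ) else 1) ^ f c = 2 ^ f b := by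
    intro f
    rw [Finset.prod_eq_single b]
    · simp
    · intro c _ hc; simp [hc]
    · simp
  have h5 : (2 : ℂ) ^ cont t b = 2 ^ L b := by
    rw [← key, ← key]; exact h4
  have h6 : (2 : ℕ) ^ cont t b = 2 ^ L b := by exact_mod_cast h5
  exact Nat.pow_right_injective (le_refl 2) h6

end Gen

section Conc
variable {e n d : ℕ} [NeZero e] {m : ZMod e → ℕ}

lemma bext (b b' : BIdx e m) (h1 : b.1 = b'.1) (h2 : b.2.val = b'.2.val) : b = b' := by
  obtain ⟨k, i⟩ := b
  obtain ⟨k', i'⟩ := b'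
  simp only at h1
  subst h1
  simp only at h2
  rw [Fin.ext h2]

lemma tauB_inj (hm : ∀ k, m (k + (d : ZMod e)) = m k) : Function.Injective (tauB e d m hm) := by
  intro b b' h
  apply bext
  · have := congrArg Sigma.fst h
    simpa [tauB] using this
  · have : ∀ c c' : BIdx e m, c = c' → c.2.val = c'.2.val := by rintro c _ rfl; rfl
    have h2 := this (tauB e d m hm b) (tauB e d m hm b') h
    exact h2

/-- τ as a permutation of the basis -/
noncomputable def tauE (hm : ∀ k, m (k + (d : ZMod e)) = m k) : Equiv.Perm (BIdx e m) :=
  Equiv.ofBijective (tauB e d m hm) (Finite.injective_iff_bijective.mp (tauB_inj hm))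

variable (hm : ∀ k, m (k + (d : ZMod e)) = m k)

lemma tauMat_eq : tauMat e n d m hm = uP (tauE hm) := by
  unfold tauMat uP
  change tP (tauV e d m hm) = _
  congr 1
  funext b' b
  unfold tauV pM
  exact ite_inst Iff.rfl

lemma tauMat_pow (i : ℕ) : tauMat e n d m hm ^ i = uP (tauE hm ^ i) := by
  rw [tauMat_eq]
  convert uP_pow (n := n) (tauE hm) i

lemma tauE_pow_fst (i : ℕ) (b : BIdx e m) : ((tauE hm ^ i) b).1 = b.1 + ((i * d : ℕ) : ZMod e) := by
  induction i with
  | zero => simp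
  | succ i ih =>
    rw [pow_succ', Equiv.Perm.mul_apply]
    change ((tauE hm ^ i) b).1 + (d : ZMod e) = _
    rw [ih]; push_cast; ring

lemma tauE_pow_snd (i : ℕ) (b : BIdx e m) : ((tauE hm ^ i) b).2.val = b.2.val := by
  induction i with
  | zero => rfl
  | succ i ih =>
    rw [pow_succ', Equiv.Perm.mul_apply]
    change ((tauE hm ^ i) b).2.val = _
    rw [ih]

lemma tauE_pow_symm_fst (i : ℕ) (b : BIdx e m) : ((tauE hm ^ i).symm b).1 = b.1 - ((i * d : ℕ) : ZMod e) := by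
  have := tauE_pow_fst hm i ((tauE hm ^ i).symm b)
  rw [Equiv.apply_symm_apply] at this
  rw [this]; ring

lemma tauE_pow_symm_snd (i : ℕ) (b : BIdx e m) : ((tauE hm ^ i).symm b).2.val = b.2.val := by
  have := tauE_pow_snd hm i ((tauE hm ^ i).symm b)
  rw [Equiv.apply_symm_apply] at this
  exact this.symm

lemma theta_iter (i : ℕ) (α : ZMod e → Multiset ℕ) (k : ZMod e) :
    ((theta e d)^[i] α) k = α (k - ((i * d : ℕ) : ZMod e)) := by
  induction i generalizing k with
  | zero => simp
  | succ i ih =>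
    rw [Function.iterate_succ_apply']
    unfold theta at ih ⊢
    rw [ih]
    congr 1
    push_cast; ring

/-- weight function -/
noncomputable def LW (m : ZMod e → ℕ) (α : ZMod e → Multiset ℕ) (b : BIdx e m) : ℕ := lamOf (α b.1) b.2.val

lemma LW_symm (i : ℕ) (α : ZMod e → Multiset ℕ) (b : BIdx e m) :
    LW m α ((tauE hm ^ i).symm b) = LW m ((theta e d)^[i] α) b := by
  have : ∀ (x y : ZMod e) (i j : ℕ), x = y → i = j → lamOf (α x) i = lamOf (α y) j := by
    rintro x _ i _ rfl rfl; rfl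
  unfold LW
  rw [theta_iter]
  exact this _ _ _ _ (tauE_pow_symm_fst hm i b) (tauE_pow_symm_snd hm i b)

/-- position in block -/
def posB (b : BIdx e m) : ℕ := b.2.val

/-- block of a basis vector -/
def blkB (b : BIdx e m) : ZMod e := b.1

lemma mem_hw (α : ZMod e → Multiset ℕ) (v : TIdx e n m → ℂ) : v ∈ hwSubmodule e n m α ↔
    (∀ g, IsUpperUni e m g → (tP g).mulVec v = v) ∧
    ∀ dv, (tP (Matrix.diagonal dv)).mulVec v = weightOf e m α dv • v := by
  unfold hwSubmodule
  rw [Submodule.mem_inf]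
  simp only [Submodule.mem_iInf, Module.End.mem_eigenspace_iff, Matrix.mulVecLin_apply, one_smul, Set.mem_setOf_eq]
  exact Iff.rfl

lemma upper_BD (g : Matrix (BIdx e m) (BIdx e m) ℂ) (h : IsUpperUni e m g) : BD (blkB (m := m)) g := by
  intro b b' hb
  apply h.2
  · rintro rfl; exact hb rfl
  · rintro ⟨h1, -⟩; exact hb h1

lemma diag_BD (dv : BIdx e m → ℂ) : BD (blkB (m := m)) (Matrix.diagonal dv) := by
  intro b b' hb
  apply Matrix.diagonal_apply_ne
  rintro rfl; exact hb rfl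

lemma hw_HW [NeZero n] (α : ZMod e → Multiset ℕ) (Z : Submodule ℂ (TIdx e n m → ℂ)) (hZ : Z ≤ hwSubmodule e n m α) :
    HW (blkB (m := m)) posB Z (LW m α) where
  inj := fun b b' h1 h2 => bext b b' h1 h2
  kill := by
    intro b b' hb hlt z hz
    have h1 := ((mem_hw α z).mp (hZ hz)).1
    have hne : b ≠ b' := by rintro rfl; exact lt_irrefl _ hlt
    have hn : 0 < n := Nat.pos_of_ne_zero (NeZero.ne n)
    refine kill_gen z b b' hn fun t => h1 _ ?_
    constructor
    · intro c
      have : ¬ (b = c ∧ b' = c) := by rintro ⟨rfl, h⟩; exact hne h.symm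
      simp [Matrix.single_apply, this, Matrix.one_apply]
    · intro c c' hc hc'
      have : ¬ (b = c ∧ b' = c') := by rintro ⟨rfl, rfl⟩; exact hc' ⟨hb, hlt⟩
      simp [Matrix.single_apply, this, hc, Matrix.one_apply]
  wt := by
    intro z hz t ht
    refine wt_gen z (LW m α) (fun dv => ?_) t ht
    have h2 := ((mem_hw α z).mp (hZ hz)).2 dv
    have h3 : ∏ b, dv b ^ LW m α b = weightOf e m α dv := rfl
    rw [h3]
    convert h2

lemma HW_map (i : ℕ) (α : ZMod e → Multiset ℕ) (Z : Submodule ℂ (TIdx e n m → ℂ))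
    (H : HW (blkB (m := m)) posB Z (LW m α)) :
    HW (blkB (m := m)) posB (Z.map (Matrix.mulVecLin (uP (tauE hm ^ i)))) (LW m ((theta e d)^[i] α)) where
  inj := H.inj
  kill := by
    rintro b b' hb hlt _ ⟨z, hz, rfl⟩
    obtain ⟨c, rfl⟩ := (tauE hm ^ i).surjective b
    obtain ⟨c', rfl⟩ := (tauE hm ^ i).surjective b'
    have hc : blkB c = blkB c' := by
      unfold blkB at hb ⊢
      rw [tauE_pow_fst, tauE_pow_fst] at hb
      exact add_right_cancel hb
    have hp : posB c < posB c' := by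
      unfold posB at hlt ⊢
      rwa [tauE_pow_snd, tauE_pow_snd] at hlt
    rw [Matrix.mulVecLin_apply, Matrix.mulVec_mulVec, ← fE_gen blkB (tauE hm ^ i) _ (fun g _ => uP_tP _ g) c c' hc,
      ← Matrix.mulVec_mulVec, H.kill c c' hc hp z hz, Matrix.mulVec_zero]
  wt := by
    rintro _ ⟨z, hz, rfl⟩ t ht
    rw [Matrix.mulVecLin_apply, uP_mulVec] at ht
    have h1 := H.wt z hz _ ht
    funext b
    rw [← LW_symm hm, ← h1]
    unfold cont
    simp only [Function.comp_apply, EmbeddingLike.apply_eq_iff_eq]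
    exact Finset.sum_congr rfl fun _ _ => ite_inst Iff.rfl

end Conc


section Conc3
variable {e n d : ℕ} [NeZero e] {m : ZMod e → ℕ}
variable (hm : ∀ k, m (k + (d : ZMod e)) = m k) (ζ : ℂ)

/-- scalar part of the action of `w` -/
noncomputable def Csc (m : ZMod e → ℕ) (ζ : ℂ) (w : Wt e n) (t : TIdx e n m) : ℂ :=
  ∏ s, ζ ^ (((w.left s).toAdd.val) * (t s).1.val)

lemma rho_mul_apply (w : Wt e n) (M : Matrix (TIdx e n m) (TIdx e n m) ℂ) (t' t : TIdx e n m) :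
    (rhoMat e n ζ m w * M) t' t = Csc m ζ w t' * M (t' ∘ ⇑w.right) t := by
  rw [Matrix.mul_apply, Finset.sum_eq_single (t' ∘ ⇑w.right)]
  · unfold rhoMat
    rw [if_pos]
    · rfl
    · funext s; simp
  · intro u _ hu
    unfold rhoMat
    rw [if_neg, zero_mul]
    rintro rfl
    apply hu
    funext s; simp
  · simp

lemma mul_rho_apply (w : Wt e n) (M : Matrix (TIdx e n m) (TIdx e n m) ℂ) (t' t : TIdx e n m) :
    (M * rhoMat e n ζ m w) t' t = M t' (t ∘ ⇑w.right.symm) * Csc m ζ w (t ∘ ⇑w.right.symm) := by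
  rw [Matrix.mul_apply, Finset.sum_eq_single (t ∘ ⇑w.right.symm)]
  · unfold rhoMat
    rw [if_pos rfl]
    rfl
  · intro u _ hu
    unfold rhoMat
    rw [if_neg hu, mul_zero]
  · simp

lemma rho_tP (w : Wt e n) (g : Matrix (BIdx e m) (BIdx e m) ℂ) (hg : BD (blkB (m := m)) g) :
    rhoMat e n ζ m w * tP g = tP g * rhoMat e n ζ m w := by
  ext t' t
  rw [rho_mul_apply, mul_rho_apply]
  have h1 : tP g (t' ∘ ⇑w.right) t = tP g t' (t ∘ ⇑w.right.symm) := by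
    unfold tP
    rw [tF_apply, tF_apply, ← Equiv.prod_comp w.right (fun s => g (t' s) ((t ∘ ⇑w.right.symm) s))]
    simp
  rw [h1]
  by_cases h0 : tP g t' (t ∘ ⇑w.right.symm) = 0
  · rw [h0]; simp
  · rw [mul_comm]
    congr 1
    unfold tP at h0
    rw [tF_apply] at h0
    unfold Csc
    refine Finset.prod_congr rfl fun s _ => ?_
    have h2 : g (t' s) ((t ∘ ⇑w.right.symm) s) ≠ 0 := fun h => h0 (Finset.prod_eq_zero (Finset.mem_univ s) h)
    have h3 : (t' s).1 = ((t ∘ ⇑w.right.symm) s).1 := by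
      by_contra h; exact h2 (hg _ _ h)
    rw [h3]

lemma zpow_val (hζ : ζ ^ e = 1) (a : ℕ) (k : ZMod e) (d : ℕ) :
    ζ ^ (a * (k + (d : ZMod e)).val) = ζ ^ (a * d) * ζ ^ (a * k.val) := by
  rw [← pow_add]
  apply pow_eq_pow_of_modEq _ hζ
  rw [← mul_add]
  apply Nat.ModEq.mul_left
  rw [← ZMod.natCast_eq_natCast_iff]
  push_cast
  rw [ZMod.natCast_zmod_val, ZMod.natCast_zmod_val]
  ring

/-- commutation factor -/
noncomputable def lamW (d : ℕ) (ζ : ℂ) (w : Wt e n) : ℂ := ∏ s, ζ ^ ((w.left s).toAdd.val * d)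

lemma rho_uP (hζ : ζ ^ e = 1) (w : Wt e n) :
    rhoMat e n ζ m w * uP (tauE hm) = lamW d ζ w • (uP (tauE hm) * rhoMat e n ζ m w) := by
  ext t' t
  rw [Matrix.smul_apply, mul_uP_apply, uP_mul_apply, smul_eq_mul]
  unfold rhoMat
  by_cases h : t' = (⇑(tauE hm) ∘ t) ∘ ⇑w.right.symm
  · rw [if_pos h, if_pos]
    · subst h
      unfold lamW
      rw [← Finset.prod_mul_distrib]
      refine Finset.prod_congr rfl fun s _ => ?_
      rw [← zpow_val ζ hζ]
      simp only [Function.comp_apply, Equiv.symm_apply_apply]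
      rfl
    · subst h
      funext s; simp
  · rw [if_neg h, if_neg, mul_zero]
    intro h2
    apply h
    funext s
    have := congrFun h2 s
    simp only [Function.comp_apply] at this ⊢
    rw [← this]; simp

lemma rho_uP_pow (hζ : ζ ^ e = 1) (w : Wt e n) (i : ℕ) :
    rhoMat e n ζ m w * uP (tauE hm ^ i) = lamW d ζ w ^ i • (uP (tauE hm ^ i) * rhoMat e n ζ m w) := by
  induction i with
  | zero =>
    rw [pow_zero, pow_zero, one_smul]
    ext t' t
    rw [mul_uP_apply, uP_mul_apply]
    rfl
  | succ i ih =>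
    rw [pow_succ, ← uP_mul, ← Matrix.mul_assoc, ih, Matrix.smul_mul, Matrix.mul_assoc, rho_uP hm ζ hζ,
      Matrix.mul_smul, smul_smul, ← Matrix.mul_assoc, pow_succ]

lemma lamW_eq [NeZero n] (p q : ℕ) (hp : p ∣ e) (hd : d = e / p) (hζ : ζ ^ e = 1) (w : Wt e n)
    (hw : inCoset e p n hp q w) : lamW d ζ w = ζ ^ (q * d) := by
  unfold lamW
  rw [Finset.prod_pow_eq_pow_sum, ← Finset.sum_mul]
  apply pow_eq_pow_of_modEq _ hζ
  have he : e = p * d := by rw [hd, Nat.mul_div_cancel' hp]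
  have key : (∑ s, (w.left s).toAdd.val) ≡ q [MOD p] := by
    rw [← ZMod.natCast_eq_natCast_iff]
    obtain ⟨u, hu, rfl⟩ := hw
    have h1 : wsumHom e p n hp (sigmaElt e n ^ q * u) = Multiplicative.ofAdd ((q : ZMod p)) := by
      rw [map_mul, map_pow, (MonoidHom.mem_ker).mp hu, mul_one]
      have : wsumHom e p n hp (sigmaElt e n) = Multiplicative.ofAdd (1 : ZMod p) := by
        change Multiplicative.ofAdd (∑ i, ZMod.castHom hp (ZMod p) (if i = (0 : Fin n) then (1 : ZMod e) else 0)) = _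
        congr 1
        rw [Finset.sum_eq_single (0 : Fin n)]
        · rw [if_pos rfl, map_one]
        · intro b _ hb; rw [if_neg hb, map_zero]
        · simp
      rw [this, ← ofAdd_nsmul]
      simp
    have h2 : (∑ i, ZMod.castHom hp (ZMod p) ((sigmaElt e n ^ q * u).left i).toAdd) = (q : ZMod p) :=
      Multiplicative.ofAdd.injective h1
    rw [← h2]
    push_cast
    refine Finset.sum_congr rfl fun s _ => ?_
    conv_rhs => rw [← ZMod.natCast_zmod_val (Multiplicative.toAdd ((sigmaElt e n ^ q * u).left s)), map_natCast]
  have h4 := Nat.ModEq.mul_right' d key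
  rwa [← he] at h4

lemma mem_Z (α : ZMod e → Multiset ℕ) (r : ℕ) (v : TIdx e n m → ℂ) : v ∈ ZSub e n d m hm ζ α r ↔
    v ∈ hwSubmodule e n m α ∧ (uP (tauE hm ^ csize e d α)).mulVec v = ζ ^ (csize e d α * d * r) • v := by
  unfold ZSub
  rw [Submodule.mem_inf, Module.End.mem_eigenspace_iff, Matrix.mulVecLin_apply, tauMat_pow]

lemma rho_Z (α : ZMod e → Multiset ℕ) (r : ℕ) (hζ : ζ ^ e = 1) (w : Wt e n)
    (hl : lamW d ζ w ^ csize e d α = 1) :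
    Stab (ZSub e n d m hm ζ α r) (rhoMat e n ζ m w) := by
  intro v hv
  rw [mem_Z, mem_hw] at hv ⊢
  obtain ⟨⟨h1, h2⟩, h3⟩ := hv
  refine ⟨⟨fun g hg => ?_, fun dv => ?_⟩, ?_⟩
  · rw [Matrix.mulVec_mulVec, ← rho_tP ζ w g (upper_BD g hg), ← Matrix.mulVec_mulVec, h1 g hg]
  · rw [Matrix.mulVec_mulVec, ← rho_tP ζ w _ (diag_BD dv), ← Matrix.mulVec_mulVec, h2 dv, Matrix.mulVec_smul]
  · have h := rho_uP_pow hm ζ hζ w (csize e d α)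
    rw [hl, one_smul] at h
    rw [Matrix.mulVec_mulVec, ← h, ← Matrix.mulVec_mulVec, h3, Matrix.mulVec_smul]

end Conc3


lemma lam_anti (μ : Multiset ℕ) : Antitone (lamOf μ) := by
  intro i j hij
  unfold lamOf
  have hs : ((μ.sort (· ≤ ·)).reverse).Pairwise (· ≥ ·) := by
    rw [List.pairwise_reverse]
    exact Multiset.pairwise_sort μ (· ≤ ·)
  set l := (μ.sort (· ≤ ·)).reverse
  rcases Nat.lt_or_ge j l.length with hj | hj
  · rw [List.getD_eq_getElem _ _ hj, List.getD_eq_getElem _ _ (lt_of_le_of_lt hij hj)]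
    rcases eq_or_lt_of_le hij with rfl | h
    · exact le_rfl
    · exact (List.pairwise_iff_getElem.mp hs) i j _ _ h
  · rw [List.getD_eq_default _ _ hj]
    exact Nat.zero_le _

lemma lam_inj_aux (l l' : List ℕ) (hl : ∀ x ∈ l, 0 < x) (hl' : ∀ x ∈ l', 0 < x) (h : ∀ i, l.getD i 0 = l'.getD i 0) :
    l.length ≤ l'.length := by
  by_contra hlt
  push Not at hlt
  have := h l'.length
  rw [List.getD_eq_getElem _ _ hlt, List.getD_eq_default _ _ le_rfl] at this
  have h2 := hl _ (List.getElem_mem hlt)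
  omega

lemma lam_inj (μ ν : Multiset ℕ) (N : ℕ) (hμ : ∀ x ∈ μ, 0 < x) (hν : ∀ x ∈ ν, 0 < x) (hc : μ.card ≤ N) (hc' : ν.card ≤ N)
    (h : ∀ i < N, lamOf μ i = lamOf ν i) : μ = ν := by
  set l := (μ.sort (· ≤ ·)).reverse with hl
  set l' := (ν.sort (· ≤ ·)).reverse with hl'
  have e1 : l.length = μ.card := by simp [hl]
  have e2 : l'.length = ν.card := by simp [hl']
  have hh : ∀ i, l.getD i 0 = l'.getD i 0 := by
    intro i
    rcases Nat.lt_or_ge i N with hi | hi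
    · exact h i hi
    · rw [List.getD_eq_default _ _ (by omega), List.getD_eq_default _ _ (by omega)]
  have p1 : ∀ x ∈ l, 0 < x := fun x hx => hμ x (by simpa [hl] using hx)
  have p2 : ∀ x ∈ l', 0 < x := fun x hx => hν x (by simpa [hl'] using hx)
  have hlen : l.length = l'.length := le_antisymm (lam_inj_aux _ _ p1 p2 hh) (lam_inj_aux _ _ p2 p1 fun i => (hh i).symm)
  have hll : l = l' := by
    apply List.ext_getElem hlen
    intro i h1 h2
    have := hh i
    rwa [List.getD_eq_getElem _ _ h1, List.getD_eq_getElem _ _ h2] at this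
  have h3 : μ.sort (· ≤ ·) = ν.sort (· ≤ ·) := List.reverse_injective hll
  rw [← Multiset.sort_eq μ (· ≤ ·), ← Multiset.sort_eq ν (· ≤ ·), h3]

section Conc4
variable {e n d : ℕ} [NeZero e] {m : ZMod e → ℕ}

lemma card_le_sum (μ : Multiset ℕ) (h : ∀ x ∈ μ, 0 < x) : μ.card ≤ μ.sum := by
  have := Multiset.card_nsmul_le_sum (s := μ) (a := 1) (fun x hx => h x hx)
  simpa using this

lemma part_card (α : ZMod e → Multiset ℕ) (hα : IsEPartition e n α) (k : ZMod e) : (α k).card ≤ n := by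
  refine (card_le_sum _ (hα.1 k)).trans ?_
  rw [← hα.2]
  exact Finset.single_le_sum (f := fun k => (α k).sum) (fun _ _ => Nat.zero_le _) (Finset.mem_univ k)

lemma LW_ne (hmn : ∀ k, n ≤ m k) (α : ZMod e → Multiset ℕ) (hα : IsEPartition e n α) (i i' : ℕ)
    (h : LW m ((theta e d)^[i] α) = LW m ((theta e d)^[i'] α)) : (theta e d)^[i] α = (theta e d)^[i'] α := by
  funext k
  apply lam_inj _ _ (m k)
  · rw [theta_iter]; exact hα.1 _
  · rw [theta_iter]; exact hα.1 _
  · rw [theta_iter]; exact (part_card α hα _).trans (hmn k)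
  · rw [theta_iter]; exact (part_card α hα _).trans (hmn k)
  · intro a ha
    exact congrFun h ⟨k, ⟨a, ha⟩⟩

lemma theta_p (p : ℕ) (hp : p ∣ e) (hd : d = e / p) (α : ZMod e → Multiset ℕ) : (theta e d)^[p] α = α := by
  funext k
  rw [theta_iter, hd, Nat.mul_div_cancel' hp]
  simp

lemma csize_dvd (p : ℕ) (hp : p ∣ e) (hd : d = e / p) (α : ZMod e → Multiset ℕ) : csize e d α ∣ p :=
  Function.IsPeriodicPt.minimalPeriod_dvd (theta_p p hp hd α)

lemma csize_pos (p : ℕ) (hp : p ∣ e) (hd : d = e / p) (α : ZMod e → Multiset ℕ) : 0 < csize e d α :=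
  Nat.pos_of_dvd_of_pos (csize_dvd p hp hd α) (Nat.pos_of_dvd_of_pos hp (Nat.pos_of_ne_zero (NeZero.ne e)))

lemma theta_dvd (α : ZMod e → Multiset ℕ) (j : ℕ) (h : csize e d α ∣ j) : (theta e d)^[j] α = α :=
  (Function.isPeriodicPt_iff_minimalPeriod_dvd.mpr h)

variable (hm : ∀ k, m (k + (d : ZMod e)) = m k) (ζ : ℂ)

/-- translates of `Z` -/
noncomputable def Zi (hm : ∀ k, m (k + (d : ZMod e)) = m k) (ζ : ℂ) (α : ZMod e → Multiset ℕ) (r i : ℕ) :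
    Submodule ℂ (TIdx e n m → ℂ) :=
  (ZSub e n d m hm ζ α r).map (Matrix.mulVecLin (uP (tauE hm ^ i)))

lemma Zi_add (α : ZMod e → Multiset ℕ) (r i : ℕ) (h0 : ζ ≠ 0) :
    Zi (n := n) hm ζ α r (i + csize e d α) = Zi hm ζ α r i := by
  have key : ∀ z ∈ ZSub e n d m hm ζ α r, (uP (tauE hm ^ (i + csize e d α))).mulVec z =
      ζ ^ (csize e d α * d * r) • (uP (tauE hm ^ i)).mulVec z := by
    intro z hz
    rw [pow_add, ← uP_mul, ← Matrix.mulVec_mulVec, ((mem_Z hm ζ α r z).mp hz).2, Matrix.mulVec_smul]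
  apply le_antisymm
  · rintro _ ⟨z, hz, rfl⟩
    rw [Matrix.mulVecLin_apply, key z hz]
    exact Submodule.smul_mem _ _ ⟨z, hz, rfl⟩
  · rintro _ ⟨z, hz, rfl⟩
    rw [Matrix.mulVecLin_apply]
    have hne : ζ ^ (csize e d α * d * r) ≠ 0 := pow_ne_zero _ h0
    refine ⟨(ζ ^ (csize e d α * d * r))⁻¹ • z, Submodule.smul_mem _ _ hz, ?_⟩
    rw [Matrix.mulVecLin_apply, Matrix.mulVec_smul, key z hz, smul_smul, inv_mul_cancel₀ hne, one_smul]

lemma Zi_add_mul (α : ZMod e → Multiset ℕ) (r i k : ℕ) (h0 : ζ ≠ 0) :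
    Zi (n := n) hm ζ α r (i + csize e d α * k) = Zi hm ζ α r i := by
  induction k with
  | zero => simp
  | succ k ih => rw [Nat.mul_succ, ← add_assoc, Zi_add hm ζ α r _ h0, ih]

lemma Zi_mod (α : ZMod e → Multiset ℕ) (r i : ℕ) (h0 : ζ ≠ 0) :
    Zi (n := n) hm ζ α r (i % csize e d α) = Zi hm ζ α r i := by
  conv_rhs => rw [← Nat.mod_add_div i (csize e d α)]
  rw [Zi_add_mul hm ζ α r _ _ h0]

lemma Zi_HW [NeZero n] (α : ZMod e → Multiset ℕ) (r i : ℕ) :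
    HW (blkB (m := m)) posB (Zi (n := n) hm ζ α r i) (LW m ((theta e d)^[i] α)) :=
  HW_map hm i α _ (hw_HW α _ inf_le_left)

/-- components -/
noncomputable def Si (hm : ∀ k, m (k + (d : ZMod e)) = m k) (ζ : ℂ) (α : ZMod e → Multiset ℕ) (r i : ℕ) :
    Submodule ℂ (TIdx e n m → ℂ) := M0 (blkB (m := m)) posB (Zi hm ζ α r i)

lemma compSub_eq [NeZero n] (α : ZMod e → Multiset ℕ) (r : ℕ) (h0 : ζ ≠ 0) (hc : 0 < csize e d α) :
    compSub e n d m hm ζ α r = ⨆ i : Fin (csize e d α), Si hm ζ α r i := by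
  apply le_antisymm
  · unfold compSub
    rw [Submodule.span_le]
    rintro _ ⟨g, i, v, hg, hu, hv, rfl⟩
    have h1 : Si hm ζ α r i ≤ ⨆ i : Fin (csize e d α), Si (n := n) hm ζ α r i := by
      have h2 : Si (n := n) hm ζ α r i = Si hm ζ α r (i % csize e d α) := by
        unfold Si; rw [Zi_mod hm ζ α r i h0]
      rw [h2]
      exact le_iSup (fun i : Fin (csize e d α) => Si (n := n) hm ζ α r i) ⟨i % csize e d α, Nat.mod_lt _ hc⟩
    apply h1
    rw [Matrix.mulVecLin_apply, tauMat_pow, ← Matrix.mulVec_mulVec]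
    apply (Zi_HW hm ζ α r i).M0_tP g hg
    exact le_M0 ⟨v, hv, rfl⟩
  · apply iSup_le
    intro i
    unfold Si
    rw [(Zi_HW hm ζ α r i).M0_span, Submodule.span_le]
    rintro _ ⟨g, _, hg, hu, ⟨z, hz, rfl⟩, rfl⟩
    apply Submodule.subset_span
    refine ⟨g, i, z, hg, by convert hu, hz, ?_⟩
    rw [Matrix.mulVecLin_apply, tauMat_pow, Matrix.mulVecLin_apply, Matrix.mulVec_mulVec]
    rfl

lemma Si_orth [NeZero n] (hmn : ∀ k, n ≤ m k) (α : ZMod e → Multiset ℕ) (hα : IsEPartition e n α) (r : ℕ)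
    (i i' : Fin (csize e d α)) (h : i ≠ i') : Si (n := n) hm ζ α r i ≤ orth (Si hm ζ α r i') := by
  apply (Zi_HW hm ζ α r i).orth_ne (Zi_HW hm ζ α r i')
  intro hL
  apply h
  apply Fin.ext
  exact Function.iterate_injOn_Iio_minimalPeriod i.2 i'.2 (LW_ne hmn α hα _ _ hL)

end Conc4


section Conc5
variable {e n d : ℕ} [NeZero e] {m : ZMod e → ℕ}
variable (hm : ∀ k, m (k + (d : ZMod e)) = m k) (ζ : ℂ)

/-- the operator `τ^j w` -/
noncomputable def fW (hm : ∀ k, m (k + (d : ZMod e)) = m k) (ζ : ℂ) (w : Wt e n) (j : ℕ) :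
    Matrix (TIdx e n m) (TIdx e n m) ℂ := uP (tauE hm ^ j) * rhoMat e n ζ m w

lemma fW_tP (w : Wt e n) (j : ℕ) (g : Matrix (BIdx e m) (BIdx e m) ℂ) (hg : BD (blkB (m := m)) g) :
    fW hm ζ w j * tP g = tP (g.submatrix (tauE hm ^ j).symm (tauE hm ^ j).symm) * fW hm ζ w j := by
  unfold fW
  rw [Matrix.mul_assoc, rho_tP ζ w g hg, ← Matrix.mul_assoc, uP_tP, Matrix.mul_assoc]

lemma cont_comp {B : Type*} [Fintype B] (σ : Equiv.Perm B) (x : Equiv.Perm (Fin n)) (t : Fin n → B) (b : B) :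
    cont ((⇑σ ∘ t) ∘ ⇑x) (σ b) = cont t b := by
  unfold cont
  rw [← Equiv.sum_comp x (fun s => if t s = b then 1 else 0)]
  refine Finset.sum_congr rfl fun s _ => ite_inst ?_
  simp

lemma fW_cont (w : Wt e n) (j : ℕ) (t' t : TIdx e n m) (h : fW hm ζ w j t' t ≠ 0) (b : BIdx e m) :
    cont t' ((tauE hm ^ j) b) = cont t b := by
  unfold fW at h
  rw [uP_mul_apply] at h
  unfold rhoMat at h
  have h1 : ⇑(tauE hm ^ j).symm ∘ t' = t ∘ ⇑w.right.symm := by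
    by_contra h2
    rw [if_neg h2] at h
    exact h rfl
  have h2 : t' = (⇑(tauE hm ^ j) ∘ t) ∘ ⇑w.right.symm := by
    rw [Function.comp_assoc, ← h1]
    funext s
    simp only [Function.comp_apply, Equiv.apply_symm_apply]
  rw [h2]
  exact cont_comp _ _ _ _

lemma fW_uP (hζ : ζ ^ e = 1) (w : Wt e n) (i j : ℕ) (z : TIdx e n m → ℂ) :
    (fW hm ζ w j).mulVec ((uP (tauE hm ^ i)).mulVec z) =
      lamW d ζ w ^ i • (uP (tauE hm ^ (i + j))).mulVec ((rhoMat e n ζ m w).mulVec z) := by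
  unfold fW
  rw [Matrix.mulVec_mulVec, Matrix.mul_assoc, rho_uP_pow hm ζ hζ, Matrix.mul_smul, ← Matrix.mul_assoc, uP_mul,
    Matrix.smul_mulVec, ← Matrix.mulVec_mulVec, ← pow_add, add_comm j i]

lemma fW_Zi (hζ : ζ ^ e = 1) (α : ZMod e → Multiset ℕ) (r : ℕ) (w : Wt e n) (hl : lamW d ζ w ^ csize e d α = 1)
    (i j : ℕ) : ∀ z ∈ Zi hm ζ α r i, (fW hm ζ w j).mulVec z ∈ Zi hm ζ α r (i + j) := by
  rintro _ ⟨z, hz, rfl⟩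
  rw [Matrix.mulVecLin_apply, fW_uP hm ζ hζ]
  exact Submodule.smul_mem _ _ ⟨_, rho_Z hm ζ α r hζ w hl z hz, rfl⟩

lemma fW_Si (hζ : ζ ^ e = 1) (α : ZMod e → Multiset ℕ) (r : ℕ) (w : Wt e n) (hl : lamW d ζ w ^ csize e d α = 1)
    (i j : ℕ) : ∀ z ∈ Si hm ζ α r i, (fW hm ζ w j).mulVec z ∈ Si hm ζ α r (i + j) := by
  unfold Si
  refine M0_maps _ _ (tauE hm ^ j) _ (fW_tP hm ζ w j) ?_ ?_ _ _ (fW_Zi hm ζ hζ α r w hl i j)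
  · intro b b' h
    unfold blkB at h ⊢
    rw [tauE_pow_fst, tauE_pow_fst, h]
  · intro b
    exact tauE_pow_snd hm j b

lemma Y_eq (w : Wt e n) (j : ℕ) (xv : BIdx e m → ℂ) :
    Dmat e n m xv * (tauMat e n d m hm) ^ j * rhoMat e n ζ m w = Dx xv * fW hm ζ w j := by
  unfold fW
  rw [tauMat_pow, Matrix.mul_assoc]
  congr 1
  rw [Dx_eq]
  unfold Dmat
  congr 1
  exact Subsingleton.elim _ _

lemma Y_Si [NeZero n] (hζ : ζ ^ e = 1) (α : ZMod e → Multiset ℕ) (r : ℕ) (w : Wt e n) (hl : lamW d ζ w ^ csize e d α = 1)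
    (xv : BIdx e m → ℂ) (i j : ℕ) : ∀ z ∈ Si hm ζ α r i, (Dx xv * fW hm ζ w j).mulVec z ∈ Si hm ζ α r (i + j) := by
  intro z hz
  rw [← Matrix.mulVec_mulVec]
  exact (Zi_HW hm ζ α r (i + j)).M0_dC _ _ (fW_Si hm ζ hζ α r w hl i j z hz)

lemma tau_Z (α : ZMod e → Multiset ℕ) (r k : ℕ) : ∀ z ∈ ZSub e n d m hm ζ α r,
    (uP (tauE hm ^ (csize e d α * k))).mulVec z = ζ ^ (d * r * (csize e d α * k)) • z := by
  intro z hz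
  induction k with
  | zero =>
    rw [mul_zero, pow_zero, mul_zero, pow_zero, one_smul]
    funext t
    rw [uP_mulVec]
    rfl
  | succ k ih =>
    rw [Nat.mul_succ, pow_add, ← uP_mul, ← Matrix.mulVec_mulVec, ((mem_Z hm ζ α r z).mp hz).2, Matrix.mulVec_smul, ih,
      smul_smul, ← pow_add]
    congr 2
    ring

lemma trace_Zi (hζ : ζ ^ e = 1) (α : ZMod e → Multiset ℕ) (r : ℕ) (w : Wt e n) (hl : lamW d ζ w ^ csize e d α = 1)
    (i j : ℕ) (hj : csize e d α ∣ j) :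
    traceOn (Zi hm ζ α r i) (Matrix.mulVecLin (fW hm ζ w j)) =
      (lamW d ζ w ^ i * ζ ^ (d * r * j)) * charExt e n d m hm ζ α r w := by
  unfold charExt
  obtain ⟨k, rfl⟩ := hj
  refine traceOn_map _ _ (uP (tauE hm ^ i)⁻¹) _ _ ?_ _ (rho_Z hm ζ α r hζ w hl) ?_
  · rw [uP_mul, inv_mul_cancel, uP_one]
  · intro v hv
    rw [fW_uP hm ζ hζ, pow_add, ← uP_mul, ← Matrix.mulVec_mulVec, tau_Z hm ζ α r k _ (rho_Z hm ζ α r hζ w hl v hv),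
      Matrix.mulVec_smul, smul_smul]

end Conc5


section Conc6
variable {e n d p : ℕ} [NeZero e] {m : ZMod e → ℕ}

lemma hOrd_dvd (j : ℕ) (hp0 : 0 < p) : hOrd p j ∣ p := by
  unfold hOrd
  apply addOrderOf_dvd_of_nsmul_eq_zero
  simp

lemma hOrd_pos (j : ℕ) (hp0 : 0 < p) : 0 < hOrd p j := Nat.pos_of_dvd_of_pos (hOrd_dvd j hp0) hp0

lemma hOrd_mul (j : ℕ) : p ∣ hOrd p j * j := by
  have h1 : hOrd p j • (j : ZMod p) = 0 := addOrderOf_nsmul_eq_zero _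
  rw [nsmul_eq_mul, ← Nat.cast_mul, ZMod.natCast_eq_zero_iff] at h1
  exact h1

lemma hOrd_inj (j a b : ℕ) (h : j * a ≡ j * b [MOD p]) : a ≡ b [MOD hOrd p j] := by
  unfold hOrd
  rw [← nsmul_eq_nsmul_iff_modEq, nsmul_eq_mul, nsmul_eq_mul, ← Nat.cast_mul, ← Nat.cast_mul,
    ZMod.natCast_eq_natCast_iff, mul_comm a, mul_comm b]
  exact h

lemma hOrd_congr (j a b : ℕ) (h : a ≡ b [MOD hOrd p j]) : j * a ≡ j * b [MOD p] := by
  have h1 := Nat.ModEq.mul_left' j h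
  exact h1.of_dvd (by rw [mul_comm]; exact hOrd_mul j)

/-- index map -/
noncomputable def idxP (e p d j : ℕ) (x : ZMod (hOrd p j) × Fin (Esys p d j)) : ZMod e :=
  ((x.2 : ℕ) : ZMod e) + ((j * x.1.val * d : ℕ) : ZMod e)

lemma idxP_inj (he : e = p * d) (j : ℕ) (hp0 : 0 < p) : Function.Injective (idxP e p d j) := by
  haveI : NeZero (hOrd p j) := ⟨(hOrd_pos j hp0).ne'⟩
  rintro ⟨s, k⟩ ⟨s', k'⟩ hx
  unfold idxP at hx
  simp only at hx
  have hd0 : 0 < d := by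
    rcases Nat.eq_zero_or_pos d with h | h
    · exact absurd (he.trans (by rw [h, mul_zero])) (NeZero.ne e)
    · exact h
  rw [← Nat.cast_add, ← Nat.cast_add, ZMod.natCast_eq_natCast_iff] at hx
  obtain ⟨j1, hj1⟩ := hOrd_dvd j hp0
  have hE : Esys p d j = j1 * d := by
    unfold Esys
    rw [Nat.div_eq_of_eq_mul_right (hOrd_pos j hp0) hj1]
  have hjj : j1 ∣ j := by
    have h1 := hOrd_mul (p := p) j
    have h2 : hOrd p j * j1 ∣ hOrd p j * j := by
      rw [← hj1]; exact h1
    exact Nat.dvd_of_mul_dvd_mul_left (hOrd_pos j hp0) h2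
  have hEe : Esys p d j ∣ e := by
    rw [hE]
    refine ⟨hOrd p j, ?_⟩
    have : p * d = (hOrd p j * j1) * d := by rw [← hj1]
    rw [he, this]; ring
  have h0 : ∀ s : ℕ, j * s * d ≡ 0 [MOD Esys p d j] := by
    intro s
    rw [Nat.modEq_zero_iff_dvd, hE]
    exact Nat.mul_dvd_mul (hjj.mul_right s) dvd_rfl
  have hk : (k : ℕ) ≡ k' [MOD Esys p d j] := by
    have h1 := hx.of_dvd hEe
    have h2 := (Nat.ModEq.rfl (a := (k : ℕ))).add (h0 s.val)
    have h3 := (Nat.ModEq.rfl (a := (k' : ℕ))).add (h0 s'.val)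
    exact (h2.symm.trans h1).trans h3
  have hk2 : k = k' := Fin.ext (Nat.ModEq.eq_of_lt_of_lt hk k.2 k'.2)
  subst hk2
  have hs := Nat.ModEq.add_left_cancel' _ hx
  rw [he] at hs
  have hs2 := Nat.ModEq.mul_right_cancel' hd0.ne' hs
  have hs3 := hOrd_inj j _ _ hs2
  have hs4 := Nat.ModEq.eq_of_lt_of_lt hs3 (ZMod.val_lt s) (ZMod.val_lt s')
  rw [ZMod.val_injective _ hs4]

lemma idxP_bij (he : e = p * d) (j : ℕ) (hp0 : 0 < p) : Function.Bijective (idxP e p d j) := by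
  haveI : NeZero (hOrd p j) := ⟨(hOrd_pos j hp0).ne'⟩
  rw [Fintype.bijective_iff_injective_and_card]
  refine ⟨idxP_inj he j hp0, ?_⟩
  rw [Fintype.card_prod, ZMod.card, ZMod.card, Fintype.card_fin, Esys, ← mul_assoc,
    Nat.mul_div_cancel' (hOrd_dvd j hp0), he]

variable (hm : ∀ k, m (k + (d : ZMod e)) = m k)

/-- index map on basis vectors -/
noncomputable def idxF (hm : ∀ k, m (k + (d : ZMod e)) = m k) (p j : ℕ)
    (x : ZMod (hOrd p j) × (Σ k : Fin (Esys p d j), Fin (m (((k : ℕ) : ZMod e))))) : BIdx e m :=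
  (tauE hm ^ (j * x.1.val)) ⟨((x.2.1 : ℕ) : ZMod e), x.2.2⟩

lemma idxF_fst (j : ℕ) (x) : (idxF hm p j x).1 = idxP e p d j (x.1, x.2.1) := by
  unfold idxF idxP
  rw [tauE_pow_fst]

lemma idxF_snd (j : ℕ) (x) : (idxF hm p j x).2.val = x.2.2.val := by
  unfold idxF
  rw [tauE_pow_snd]

lemma idxF_bij (he : e = p * d) (j : ℕ) (hp0 : 0 < p) : Function.Bijective (idxF hm p j) := by
  constructor
  · rintro ⟨s, ⟨k, i⟩⟩ ⟨s', ⟨k', i'⟩⟩ h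
    have h1 : idxP e p d j (s, k) = idxP e p d j (s', k') := by
      rw [← idxF_fst hm j (s, ⟨k, i⟩), ← idxF_fst hm j (s', ⟨k', i'⟩), h]
    have h2 : i.val = i'.val := by
      rw [← idxF_snd hm j (s, ⟨k, i⟩), ← idxF_snd hm j (s', ⟨k', i'⟩), h]
    have h3 := idxP_inj he j hp0 h1
    rw [Prod.mk.injEq] at h3
    obtain ⟨rfl, rfl⟩ := h3
    rw [Fin.ext h2]
  · intro b
    obtain ⟨⟨s, k⟩, hsk⟩ := (idxP_bij he j hp0).2 b.1
    have h1 : ((tauE hm ^ (j * s.val)).symm b).1 = ((k : ℕ) : ZMod e) := by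
      rw [tauE_pow_symm_fst, ← hsk]
      unfold idxP
      simp only
      ring
    have h2 : ((tauE hm ^ (j * s.val)).symm b).2.val < m ((k : ℕ) : ZMod e) := by
      rw [← h1]; exact ((tauE hm ^ (j * s.val)).symm b).2.2
    refine ⟨(s, ⟨k, ⟨_, h2⟩⟩), ?_⟩
    unfold idxF
    simp only
    rw [← Equiv.eq_symm_apply]
    exact bext _ _ h1.symm rfl

/-- the indexing equivalence -/
noncomputable def epsE (hm : ∀ k, m (k + (d : ZMod e)) = m k) (he : e = p * d) (j : ℕ) (hp0 : 0 < p) :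
    BIdx e m ≃ ZMod (hOrd p j) × (Σ k : Fin (Esys p d j), Fin (m (((k : ℕ) : ZMod e)))) :=
  (Equiv.ofBijective (idxF hm p j) (idxF_bij hm he j hp0)).symm

lemma epsE_symm (he : e = p * d) (j : ℕ) (hp0 : 0 < p) (x) : (epsE hm he j hp0).symm x = idxF hm p j x := rfl

lemma tauE_p (he : e = p * d) : tauE hm ^ p = 1 := by
  ext1 b
  apply bext
  · rw [tauE_pow_fst, ← he]; simp
  · rw [tauE_pow_snd]; rfl

lemma piB_eps (he : e = p * d) (j : ℕ) (hp0 : 0 < p) : piB (epsE hm he j hp0) = tauE hm ^ j := by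
  haveI : NeZero (hOrd p j) := ⟨(hOrd_pos j hp0).ne'⟩
  ext1 b
  obtain ⟨⟨s, a⟩, rfl⟩ := (epsE hm he j hp0).symm.surjective b
  rw [piB_symm, epsE_symm, epsE_symm]
  unfold idxF
  simp only
  rw [← Equiv.Perm.mul_apply, ← pow_add]
  congr 1
  apply pow_eq_pow_of_modEq _ (tauE_p hm he)
  have : j + j * s.val = j * (s.val + 1) := by ring
  rw [this]
  apply hOrd_congr
  rw [← ZMod.natCast_eq_natCast_iff]
  push_cast
  rw [ZMod.natCast_zmod_val, ZMod.natCast_zmod_val]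

lemma posE_eps (he : e = p * d) (j : ℕ) (hp0 : 0 < p) : posE (epsE hm he j hp0) = posB := by
  haveI : NeZero (hOrd p j) := ⟨(hOrd_pos j hp0).ne'⟩
  funext b
  obtain ⟨⟨s, a⟩, rfl⟩ := (epsE hm he j hp0).symm.surjective b
  rw [posE_symm, epsE_symm]
  unfold posB
  rw [idxF_snd]

lemma blkE_eps (he : e = p * d) (j : ℕ) (hp0 : 0 < p) (b b' : BIdx e m) :
    blkE (epsE hm he j hp0) b = blkE (epsE hm he j hp0) b' ↔ blkB b = blkB b' := by
  haveI : NeZero (hOrd p j) := ⟨(hOrd_pos j hp0).ne'⟩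
  obtain ⟨⟨s, a⟩, rfl⟩ := (epsE hm he j hp0).symm.surjective b
  obtain ⟨⟨s', a'⟩, rfl⟩ := (epsE hm he j hp0).symm.surjective b'
  rw [blkE_symm, blkE_symm, epsE_symm, epsE_symm]
  unfold blkB
  rw [idxF_fst, idxF_fst]
  exact (idxP_inj he j hp0).eq_iff.symm

lemma core_inst [NeZero n] (ζ : ℂ) (hζ : ζ ^ e = 1) (he : e = p * d) (j : ℕ) (hp0 : 0 < p) (α : ZMod e → Multiset ℕ)
    (r : ℕ) (w : Wt e n) (hl : lamW d ζ w ^ csize e d α = 1) (h0 : ζ ≠ 0) (i : ℕ) (hj : csize e d α ∣ j) :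
    Core (epsE hm he j hp0) (Zi hm ζ α r i) (LW m ((theta e d)^[i] α)) (fW hm ζ w j) where
  hw := by
    have H := Zi_HW (n := n) hm ζ α r i
    refine ⟨fun b b' h1 h2 => ?_, fun b b' h1 h2 => ?_, H.wt⟩
    · rw [posE_eps] at h2
      exact H.inj b b' ((blkE_eps hm he j hp0 b b').mp h1) h2
    · rw [posE_eps] at h2
      exact H.kill b b' ((blkE_eps hm he j hp0 b b').mp h1) h2
  fP := by
    intro g hg
    rw [piB_eps]
    apply fW_tP
    intro b b' hb
    exact hg b b' fun h => hb ((blkE_eps hm he j hp0 b b').mp h)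
  fc := by
    intro t' t h b
    rw [piB_eps]
    exact fW_cont hm ζ w j t' t h b
  Linv := by
    intro b
    rw [piB_eps]
    have h1 := LW_symm hm j ((theta e d)^[i] α) ((tauE hm ^ j) b)
    rw [Equiv.symm_apply_apply, ← Function.iterate_add_apply, add_comm, Function.iterate_add_apply,
      theta_dvd α j hj] at h1
    exact h1.symm
  Lanti := by
    intro s k a b hab
    simp only [epsE_symm]
    unfold LW
    rw [idxF_snd, idxF_snd, idxF_fst, idxF_fst]
    exact lam_anti _ hab
  fZ := by
    obtain ⟨k, rfl⟩ := hj
    intro v hv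
    rw [← Zi_add_mul hm ζ α r i k h0]
    exact fW_Zi hm ζ hζ α r w hl i _ v hv

lemma prod_range_zmod (h : ℕ) [NeZero h] (g : ℕ → ℂ) : ∏ s ∈ Finset.range h, g s = ∏ s : ZMod h, g s.val := by
  symm
  refine Finset.prod_nbij' (fun s : ZMod h => s.val) (fun s => (s : ZMod h)) ?_ ?_ ?_ ?_ ?_
  · intro s _; exact Finset.mem_range.mpr (ZMod.val_lt s)
  · intro s _; exact Finset.mem_univ _
  · intro s _; exact ZMod.natCast_zmod_val s
  · intro s hs; exact ZMod.val_natCast_of_lt (Finset.mem_range.mp hs)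
  · intro s _; rfl

lemma xval_eq (xv : BIdx e m → ℂ) (b : BIdx e m) (k : ZMod e) (i : ℕ) (hk : b.1 = k) (hi : b.2.val = i) :
    xval e m xv k i = xv b := by
  subst hk hi
  unfold xval
  rw [dif_pos b.2.2]

lemma schur_eps (he : e = p * d) (j : ℕ) (hp0 : 0 < p) [NeZero (hOrd p j)] (xv : BIdx e m → ℂ) (β : ZMod e → Multiset ℕ) :
    (∏ k : Fin (Esys p d j), schurGen (m (((k : ℕ) : ZMod e)))
      (fun i => LW m β ((epsE hm he j hp0).symm (0, ⟨k, i⟩)))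
      (fun i => ∏ s, xv ((epsE hm he j hp0).symm (s, ⟨k, i⟩)))) = schurBrace e p d m xv j β := by
  unfold schurBrace sAlphaSys
  rw [Finset.prod_range]
  refine Finset.prod_congr rfl fun k _ => ?_
  rw [schurFin_eq]
  unfold mmX
  congr 1
  · funext i
    rw [epsE_symm]
    unfold LW
    rw [idxF_snd, idxF_fst]
    unfold idxP braceF
    rw [if_pos k.2]
    simp
  · funext i
    unfold vvX Xvar
    rw [prod_range_zmod]
    refine Finset.prod_congr rfl fun s _ => ?_
    rw [epsE_symm]
    symm
    apply xval_eq
    · rw [idxF_fst]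
      unfold idxP
      push_cast; ring
    · rw [idxF_snd]

lemma trace_Si [NeZero n] (ζ : ℂ) (hζ : ζ ^ e = 1) (he : e = p * d) (j : ℕ) (hp0 : 0 < p) (α : ZMod e → Multiset ℕ)
    (r : ℕ) (w : Wt e n) (hl : lamW d ζ w ^ csize e d α = 1) (h0 : ζ ≠ 0) (i : ℕ) (hj : csize e d α ∣ j)
    (xv : BIdx e m → ℂ) :
    traceOn (Si hm ζ α r i) (Matrix.mulVecLin (Dx xv * fW hm ζ w j)) =
      schurBrace e p d m xv j ((theta e d)^[i] α) * ((lamW d ζ w ^ i * ζ ^ (d * r * j)) * charExt e n d m hm ζ α r w) := by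
  haveI : NeZero (hOrd p j) := ⟨(hOrd_pos j hp0).ne'⟩
  have H := (core_inst hm ζ hζ he j hp0 α r w hl h0 i hj).final xv
  rw [schur_eps, trace_Zi hm ζ hζ α r w hl i j hj, posE_eps, M0_congr _ (blkB (m := m)) _ (blkE_eps hm he j hp0)] at H
  exact H

end Conc6


/-- Lemma 2.9.  Let `q ∣ e` with `e/q`, `e/p` coprime, and
suppose `χ^{α,φ}` is `σ^q`-stable.  Then for `w ∈ σ^q W` and `0 ≤ j < p`,
`Tr(Dτ^j w, V_{α,φ}⊗Z̃_{α,φ})` equals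
`φ(τ^j)·(∑_{0≤i<c} ζ^{qid} s_{θ^i(α){j}}(𝒳_j))·χ̃^{α,φ}(w)` if `c = c_{α,p} ∣ j`,
and `0` otherwise. -/
theorem statement5 (e p d n q : ℕ) [NeZero e] [NeZero n] (hp : p ∣ e) (hd : d = e / p)
    (hq : q ∣ e) (hqp : Nat.Coprime (e / q) (e / p))
    (ζ : ℂ) (hζ : IsPrimitiveRoot ζ e)
    (m : ZMod e → ℕ) (hmn : ∀ k, n ≤ m k) (hm : ∀ k, m (k + (d : ZMod e)) = m k)
    (xv : BIdx e m → ℂ)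
    (α : ZMod e → Multiset ℕ) (hα : IsEPartition e n α)
    (r : ℕ) (hr : r < p / csize e d α)
    (hstab : p ∣ q * csize e d α)
    (w : Wt e n) (hw : inCoset e p n hp q w)
    (j : ℕ) (hj : j < p) :
    traceOn (compSub e n d m hm ζ α r)
        (Matrix.mulVecLin (Dmat e n m xv * (tauMat e n d m hm) ^ j * rhoMat e n ζ m w)) =
      if csize e d α ∣ j then
        ζ ^ (d * r * j) *
          (∑ i ∈ Finset.range (csize e d α),
            ζ ^ (q * i * d) * schurBrace e p d m xv j ((theta e d)^[i] α)) *
          charExt e n d m hm ζ α r w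
      else 0 := by
  have he : e = p * d := by rw [hd, Nat.mul_div_cancel' hp]
  have hp0 : 0 < p := Nat.pos_of_dvd_of_pos hp (Nat.pos_of_ne_zero (NeZero.ne e))
  have hζ1 : ζ ^ e = 1 := hζ.pow_eq_one
  have h0 : ζ ≠ 0 := hζ.ne_zero (NeZero.ne e)
  have hc := csize_pos p hp hd α
  have hlam := lamW_eq ζ p q hp hd hζ1 w hw
  have hl : lamW d ζ w ^ csize e d α = 1 := by
    rw [hlam, ← pow_mul]
    obtain ⟨k, hk⟩ := hstab
    have : q * d * csize e d α = e * k := by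
      rw [mul_right_comm, hk, he]; ring
    rw [this, pow_mul, hζ1, one_pow]
  rw [compSub_eq hm ζ α r h0 hc, Y_eq,
    trace_sup (fun i : Fin (csize e d α) => Si hm ζ α r i) (Si_orth hm ζ hmn α hα r) _
      (fun i => ⟨(i.val + j) % csize e d α, Nat.mod_lt _ hc⟩) (by
        intro i v hv
        have h1 := Y_Si hm ζ hζ1 α r w hl xv i j v hv
        have h2 : Si (n := n) hm ζ α r ((i.val + j) % csize e d α) = Si hm ζ α r (i.val + j) := by
          unfold Si; rw [Zi_mod hm ζ α r _ h0]
        rw [h2]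
        exact h1)]
  by_cases hcj : csize e d α ∣ j
  · rw [if_pos hcj, Finset.mul_sum, Finset.sum_mul, Finset.sum_range]
    refine Finset.sum_congr rfl fun i _ => ?_
    rw [if_pos, trace_Si hm ζ hζ1 he j hp0 α r w hl h0 i hcj xv, hlam, ← pow_mul]
    · have : q * d * (i : ℕ) = q * i * d := by ring
      rw [this]
      ring
    · apply Fin.ext
      obtain ⟨k, rfl⟩ := hcj
      simp only [Nat.add_mul_mod_self_left]
      exact Nat.mod_eq_of_lt i.2
  · rw [if_neg hcj]
    refine Finset.sum_eq_zero fun i _ => if_neg ?_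
    intro h
    apply hcj
    have h1 : (i.val + j) % csize e d α = i.val := congrArg Fin.val h
    have h2 : i.val + j ≡ i.val + 0 [MOD csize e d α] := by
      unfold Nat.ModEq
      rw [h1, add_zero, Nat.mod_eq_of_lt i.2]
    exact (Nat.modEq_zero_iff_dvd).mp (Nat.ModEq.add_left_cancel' _ h2)

end GreenII
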